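/- Let t ≥ 3 and let H⃗_t be an acyclic orientation of the complete graph K_t or of the cycle C_t, with underlying graph H_t. If t = 3 (so H⃗₃ is the transitive tournament TT⃗₃ on 3 vertices), then: for every p = p(n) with p·n^{2/3} → 0 we have P(G(n,p) → H⃗₃) → 0, and for every p = p(n) with p·n^{2/3} → ∞ we have P(G(n,p) → H⃗₃) → 1. If t ≥ 4, then: for every p = p(n) with p·n^{1/m₂(H_t)} → 0 we have P(G(n,p) → H⃗_t) → 0, and for every p = p(n) with p·n^{1/m₂(H_t)} → ∞ we have P(G(n,p) → H⃗_t) → 1. -/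

import Mathlib

open Classical in
/-- The probability that the binomial random graph `G(n,p)` satisfies the property `Q`. -/
noncomputable def probGnp (n : ℕ) (p : ℝ) (Q : SimpleGraph (Fin n) → Prop) : ℝ :=
  ∑ G : SimpleGraph (Fin n),
    if Q G then p ^ G.edgeSet.ncard * (1 - p) ^ (n.choose 2 - G.edgeSet.ncard) else 0
/-- `o` is an orientation of the simple graph `G`: every edge of `G` is assigned
exactly one direction, and there are no other arcs. -/
def IsOrientation {α : Type*} (G : SimpleGraph α) (o : α → α → Prop) : Prop :=
  (∀ u v, o u v → G.Adj u v) ∧ ∀ u v, G.Adj u v → (o u v ↔ ¬ o v u)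

/-- The digraph `o` contains a (not necessarily induced) copy of the oriented graph `H`
as a subdigraph. -/
def HasCopy {α β : Type*} (o : α → α → Prop) (H : β → β → Prop) : Prop :=
  ∃ f : β → α, Function.Injective f ∧ ∀ a b, H a b → o (f a) (f b)

/-- `G → H⃗`: every orientation of `G` contains a copy of `H`. -/
def Arrows {α β : Type*} (G : SimpleGraph α) (H : β → β → Prop) : Prop :=
  ∀ o : α → α → Prop, IsOrientation G o → HasCopy o H
/-- The 2-density associated to a (sub)graph with `v` vertices and `e` edges:
`(e-1)/(v-2)` if `v ≥ 3`, `1/2` for a single edge, and `0` otherwise. -/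
noncomputable def d2 (v e : ℕ) : ℝ :=
  if 3 ≤ v then (e - 1 : ℝ) / (v - 2 : ℝ) else if e = 1 then 1 / 2 else 0

/-- The maximum 2-density `m₂(H)` of a finite simple graph `H`. -/
noncomputable def m2 {α : Type*} [Fintype α] (H : SimpleGraph α) : ℝ :=
  sSup {x : ℝ | ∃ J : H.Subgraph, x = d2 J.verts.ncard J.edgeSet.ncard}

/-- The maximum 2-density of an oriented graph: that of its underlying graph. -/
noncomputable def m2Rel {β : Type*} [Fintype β] (H : β → β → Prop) : ℝ :=
  m2 (SimpleGraph.fromRel H)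
/-- A digraph is acyclic if it has no directed cycles, i.e. the transitive closure
of its arc relation is irreflexive. -/
def RelAcyclic {β : Type*} (H : β → β → Prop) : Prop :=
  Irreflexive (Relation.TransGen H)

namespace ORam
open Finset
open scoped Classical

/-- edge finset of a graph -/
noncomputable def eF {V : Type*} [Fintype V] (G : SimpleGraph V) : Finset (Sym2 V) :=
  univ.filter (· ∈ G.edgeSet)

theorem mem_eF {V : Type*} [Fintype V] (G : SimpleGraph V) (e : Sym2 V) :
    e ∈ eF G ↔ e ∈ G.edgeSet := by simp [eF]

theorem card_eF {V : Type*} [Fintype V] (G : SimpleGraph V) : (eF G).card = G.edgeSet.ncard := by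
  rw [← Set.ncard_coe_finset]; congr 1; ext e; simp [mem_eF]

theorem eF_top_card (n : ℕ) : (eF (⊤ : SimpleGraph (Fin n))).card = n.choose 2 := by
  have := SimpleGraph.card_edgeFinset_top_eq_card_choose_two (V := Fin n)
  rw [Fintype.card_fin] at this
  rw [← this]; congr 1; ext e; simp only [mem_eF, SimpleGraph.mem_edgeFinset]

theorem mem_eF_top {V : Type*} [Fintype V] (e : Sym2 V) :
    e ∈ eF (⊤ : SimpleGraph V) ↔ ¬ e.IsDiag := by
  rw [mem_eF]; simp [SimpleGraph.edgeSet_top]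

theorem eF_subset_top {V : Type*} [Fintype V] (G : SimpleGraph V) : eF G ⊆ eF (⊤ : SimpleGraph V) := by
  intro e he; rw [mem_eF] at *; exact SimpleGraph.edgeSet_mono le_top he

theorem eF_mono {V : Type*} [Fintype V] {G G' : SimpleGraph V} (h : G ≤ G') : eF G ⊆ eF G' := by
  intro e he; rw [mem_eF] at *; exact SimpleGraph.edgeSet_mono h he

theorem eF_from {V : Type*} [Fintype V] (X : Finset (Sym2 V)) (h : X ⊆ eF (⊤ : SimpleGraph V)) :
    eF (SimpleGraph.fromEdgeSet (X : Set (Sym2 V))) = X := by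
  ext e; rw [mem_eF, SimpleGraph.edgeSet_fromEdgeSet]
  constructor
  · rintro ⟨h, _⟩; exact_mod_cast h
  · intro he; exact ⟨by exact_mod_cast he, by simpa using (mem_eF_top e).1 (h he)⟩

theorem from_eF {V : Type*} [Fintype V] (G : SimpleGraph V) :
    SimpleGraph.fromEdgeSet ((eF G : Finset (Sym2 V)) : Set (Sym2 V)) = G := by
  have : ((eF G : Finset (Sym2 V)) : Set (Sym2 V)) = G.edgeSet := by ext; simp [mem_eF]
  rw [this, SimpleGraph.fromEdgeSet_edgeSet]

/-- weight of a graph -/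
noncomputable def wt (n : ℕ) (p : ℝ) (G : SimpleGraph (Fin n)) : ℝ :=
  p ^ G.edgeSet.ncard * (1 - p) ^ (n.choose 2 - G.edgeSet.ncard)

theorem wt_nonneg {n : ℕ} {p : ℝ} (h0 : 0 ≤ p) (h1 : p ≤ 1) (G) : 0 ≤ wt n p G :=
  mul_nonneg (pow_nonneg h0 _) (pow_nonneg (by linarith) _)

theorem pr_def (n : ℕ) (p : ℝ) (Q) : probGnp n p Q = ∑ G, if Q G then wt n p G else 0 := by
  unfold probGnp wt
  refine Finset.sum_congr rfl fun G _ => ?_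
  congr

theorem pr_nonneg {n : ℕ} {p : ℝ} (h0 : 0 ≤ p) (h1 : p ≤ 1) (Q) : 0 ≤ probGnp n p Q := by
  rw [pr_def]; refine sum_nonneg fun G _ => ?_
  split_ifs; exacts [wt_nonneg h0 h1 G, le_rfl]

theorem pr_mono {n : ℕ} {p : ℝ} (h0 : 0 ≤ p) (h1 : p ≤ 1) {Q Q' : SimpleGraph (Fin n) → Prop}
    (h : ∀ G, Q G → Q' G) : probGnp n p Q ≤ probGnp n p Q' := by
  rw [pr_def, pr_def]; refine sum_le_sum fun G _ => ?_
  have := wt_nonneg h0 h1 G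
  by_cases hq : Q G
  · simp [hq, h G hq]
  · simp only [hq, if_false]; split_ifs <;> simp [this]

theorem pr_union {n : ℕ} {p : ℝ} (h0 : 0 ≤ p) (h1 : p ≤ 1) {ι : Type*} (s : Finset ι)
    (Q : ι → SimpleGraph (Fin n) → Prop) :
    probGnp n p (fun G => ∃ i ∈ s, Q i G) ≤ ∑ i ∈ s, probGnp n p (Q i) := by
  simp only [pr_def]
  rw [sum_comm]
  refine sum_le_sum fun G _ => ?_
  have := wt_nonneg h0 h1 G
  split_ifs with h
  · obtain ⟨i, hi, hq⟩ := h
    have := single_le_sum (f := fun i => if Q i G then wt n p G else 0) (s := s)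
      (fun j _ => by split_ifs <;> simp [this]) hi
    simpa [hq] using this
  · exact sum_nonneg fun j _ => by split_ifs <;> simp [this]

theorem pr_or {n : ℕ} {p : ℝ} (h0 : 0 ≤ p) (h1 : p ≤ 1) (Q Q' : SimpleGraph (Fin n) → Prop) :
    probGnp n p (fun G => Q G ∨ Q' G) ≤ probGnp n p Q + probGnp n p Q' := by
  simp only [pr_def, ← sum_add_distrib]
  refine sum_le_sum fun G _ => ?_
  have := wt_nonneg h0 h1 G
  by_cases a : Q G <;> by_cases b : Q' G <;> simp [a, b, this]

theorem sum_graph (n : ℕ) (f : SimpleGraph (Fin n) → ℝ) :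
    ∑ G, f G = ∑ X ∈ (eF (⊤ : SimpleGraph (Fin n))).powerset,
      f (SimpleGraph.fromEdgeSet (X : Set (Sym2 (Fin n)))) := by
  refine Finset.sum_bij' (fun G _ => eF G) (fun X _ => SimpleGraph.fromEdgeSet (X : Set (Sym2 (Fin n))))
    ?_ ?_ ?_ ?_ ?_
  · intro G _; exact mem_powerset.2 (eF_subset_top G)
  · intro X _; exact mem_univ _
  · intro G _; exact from_eF G
  · intro X hX; exact eF_from X (mem_powerset.1 hX)
  · intro G _; rw [from_eF]

theorem pr_cyl (n : ℕ) (p : ℝ) (S D : Finset (Sym2 (Fin n)))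
    (hS : S ⊆ eF (⊤ : SimpleGraph (Fin n))) (hD : D ⊆ eF (⊤ : SimpleGraph (Fin n)))
    (hSD : Disjoint S D) :
    probGnp n p (fun G => S ⊆ eF G ∧ Disjoint D (eF G)) = p ^ S.card * (1 - p) ^ D.card := by
  rw [pr_def, sum_graph]
  set U := eF (⊤ : SimpleGraph (Fin n)) with hU
  have e1 : ∀ X ∈ U.powerset,
      (if (S ⊆ eF (SimpleGraph.fromEdgeSet (X : Set (Sym2 (Fin n)))) ∧
        Disjoint D (eF (SimpleGraph.fromEdgeSet (X : Set (Sym2 (Fin n))))))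
        then wt n p (SimpleGraph.fromEdgeSet (X : Set (Sym2 (Fin n)))) else 0)
      = if (S ⊆ X ∧ Disjoint D X) then p ^ X.card * (1 - p) ^ (U.card - X.card) else 0 := by
    intro X hX
    unfold wt
    rw [← card_eF, eF_from X (mem_powerset.1 hX), ← eF_top_card n]
  have e0 := sum_congr (rfl : U.powerset = U.powerset) e1
  refine Eq.trans ?_ (e0.trans ?_)
  · refine sum_congr rfl fun X _ => ?_
    congr
  have e2 : ∑ X ∈ U.powerset.filter (fun X => S ⊆ X ∧ Disjoint D X),
      p ^ X.card * (1 - p) ^ (U.card - X.card) =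
      ∑ Y ∈ (U \ (S ∪ D)).powerset, p ^ S.card * (1 - p) ^ D.card *
        (p ^ Y.card * (1 - p) ^ ((U \ (S ∪ D)).card - Y.card)) := by
    refine Finset.sum_bij' (fun X _ => X \ S) (fun Y _ => S ∪ Y) ?_ ?_ ?_ ?_ ?_
    · intro X hX
      simp only [mem_filter, mem_powerset] at hX ⊢
      intro e he
      rw [mem_sdiff] at he
      rw [mem_sdiff, mem_union]
      exact ⟨hX.1 he.1, fun h => h.elim he.2 (fun h => disjoint_left.1 hX.2.2 h he.1)⟩
    · intro Y hY
      simp only [mem_filter, mem_powerset] at hY ⊢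
      refine ⟨union_subset hS (hY.trans sdiff_subset), subset_union_left, ?_⟩
      rw [disjoint_union_right]
      refine ⟨hSD.symm, disjoint_left.2 fun e he he' => ?_⟩
      have := mem_sdiff.1 (hY he')
      exact this.2 (mem_union_right _ he)
    · intro X hX
      simp only [mem_filter, mem_powerset] at hX
      exact union_sdiff_of_subset hX.2.1
    · intro Y hY
      simp only [mem_powerset] at hY
      apply union_sdiff_cancel_left
      exact disjoint_left.2 fun e he he' => (mem_sdiff.1 (hY he')).2 (mem_union_left _ he)
    · intro X hX
      simp only [mem_filter, mem_powerset] at hX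
      have c1 : (X \ S).card + S.card = X.card := card_sdiff_add_card_eq_card hX.2.1
      have c2 : (U \ (S ∪ D)).card + (S ∪ D).card = U.card :=
        card_sdiff_add_card_eq_card (union_subset hS hD)
      rw [card_union_of_disjoint hSD] at c2
      have c3 : (X ∪ D).card ≤ U.card := card_le_card (union_subset hX.1 hD)
      rw [card_union_of_disjoint hX.2.2.symm] at c3
      have c4 : U.card - X.card = D.card + ((U \ (S ∪ D)).card - (X \ S).card) := by omega
      rw [c4, ← c1, pow_add, pow_add]; ring
  rw [← sum_filter]
  refine e2.trans ?_
  rw [← mul_sum, sum_pow_mul_eq_add_pow]; simp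

theorem pr_true (n : ℕ) (p : ℝ) : probGnp n p (fun _ => True) = 1 := by
  have := pr_cyl n p ∅ ∅ (by simp) (by simp) (by simp)
  simpa using this

theorem pr_compl (n : ℕ) (p : ℝ) (Q) : probGnp n p Q = 1 - probGnp n p (fun G => ¬ Q G) := by
  rw [← pr_true n p, eq_sub_iff_add_eq, pr_def, pr_def, pr_def, ← sum_add_distrib]
  refine sum_congr rfl fun G _ => ?_
  by_cases h : Q G <;> simp [h]

theorem pr_sub (n : ℕ) (p : ℝ) (S : Finset (Sym2 (Fin n)))
    (hS : S ⊆ eF (⊤ : SimpleGraph (Fin n))) :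
    probGnp n p (fun G => S ⊆ eF G) = p ^ S.card := by
  have := pr_cyl n p S ∅ hS (by simp) (by simp)
  simpa using this

theorem pr_sub_le {n : ℕ} {p : ℝ} (h0 : 0 ≤ p) (S : Finset (Sym2 (Fin n))) :
    probGnp n p (fun G => S ⊆ eF G) ≤ p ^ S.card := by
  by_cases hS : S ⊆ eF (⊤ : SimpleGraph (Fin n))
  · exact (pr_sub n p S hS).le
  · have : probGnp n p (fun G => S ⊆ eF G) = 0 := by
      rw [pr_def]; refine sum_eq_zero fun G _ => ?_
      rw [if_neg]; exact fun h => hS (h.trans (eF_subset_top G))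
    rw [this]; positivity

theorem pr_cyl_le {n : ℕ} {p : ℝ} (h0 : 0 ≤ p) (h1 : p ≤ 1) (S D : Finset (Sym2 (Fin n)))
    (hD : D ⊆ eF (⊤ : SimpleGraph (Fin n))) :
    probGnp n p (fun G => S ⊆ eF G ∧ Disjoint D (eF G)) ≤ p ^ S.card * (1 - p) ^ D.card := by
  by_cases hS : S ⊆ eF (⊤ : SimpleGraph (Fin n)) ∧ Disjoint S D
  · exact (pr_cyl n p S D hS.1 hD hS.2).le
  · have : probGnp n p (fun G => S ⊆ eF G ∧ Disjoint D (eF G)) = 0 := by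
      rw [pr_def]; refine sum_eq_zero fun G _ => ?_
      rw [if_neg]
      exact fun h => hS ⟨h.1.trans (eF_subset_top G), h.2.symm.mono_left h.1⟩
    rw [this]
    have : 0 ≤ 1 - p := by linarith
    positivity

end ORam

namespace ORam
open Finset
open scoped Classical

noncomputable def deg {α : Type} [Fintype α] (w : Finset α → ℝ) (T : Finset α) : ℝ :=
  ∑ e ∈ univ.filter (fun e => T ⊆ e), w e

noncomputable def tot {α : Type} [Fintype α] (w : Finset α → ℝ) : ℝ := ∑ e, w e

/-- The conclusion of the container lemma. -/
def Conc {α : Type} [Fintype α] (w : Finset α → ℝ) (ind : Finset α → Prop) (δ s : ℝ) : Prop :=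
  ∃ C : Finset α → Finset α, ∀ I, ind I → I ⊆ C I ∧
    δ * Fintype.card α ≤ ((univ.filter (fun v => v ∉ C I ∧ deg w {v} ≠ 0)).card : ℝ) ∧
    ∃ S ⊆ I, (S.card : ℝ) ≤ s ∧ ∀ U, S ⊆ U → U ⊆ I → C U = C I

def CL (l : ℕ) : Prop :=
  ∀ K : ℝ, 0 < K → ∃ δ > (0 : ℝ), ∃ B > (0 : ℝ), ∀ (α : Type) [Fintype α] (w : Finset α → ℝ) (q : ℝ),
    (∀ e, 0 ≤ w e) → (∀ e, w e ≠ 0 → e.card = l) → 0 < q → q ≤ 1 → 0 < tot w →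
    (∀ T, 1 ≤ T.card → T.card ≤ l → deg w T ≤ K * q ^ (T.card - 1) * (tot w / Fintype.card α)) →
    Conc w (fun I => ∀ e ⊆ I, w e = 0) δ (B * (q * Fintype.card α + 1))

theorem deg_nonneg {α : Type} [Fintype α] {w : Finset α → ℝ} (h : ∀ e, 0 ≤ w e) (T) :
    0 ≤ deg w T := sum_nonneg fun e _ => h e

theorem deg_mono {α : Type} [Fintype α] {w w' : Finset α → ℝ} (h : ∀ e, w e ≤ w' e) (T) :
    deg w T ≤ deg w' T := sum_le_sum fun e _ => h e

/-- sum over vertices (in a set) of degrees -/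
theorem sum_deg_singleton {α : Type} [Fintype α] (w : Finset α → ℝ) :
    ∑ v, deg w {v} = ∑ e, (e.card : ℝ) * w e := by
  unfold deg
  simp only [sum_filter, singleton_subset_iff]
  rw [sum_comm]
  refine sum_congr rfl fun e _ => ?_
  rw [← sum_filter, sum_const, nsmul_eq_mul]
  congr 2
  congr 1; ext; simp

theorem count_large {α : Type} [Fintype α] (w A : Finset α → ℝ) (hA0 : ∀ e, 0 ≤ A e)
    (hAw : ∀ e, A e ≤ w e) (l : ℕ) (hl : 1 ≤ l) (hu : ∀ e, w e ≠ 0 → e.card = l)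
    (K β : ℝ) (hK : 0 < K) (hβ0 : 0 ≤ β) (hβ : β ≤ 1 / 4) (hE : 0 < tot w)
    (hdeg : ∀ v, deg w {v} ≤ K * (tot w / Fintype.card α)) (htot : tot w / 2 ≤ tot A) :
    (1 / (4 * K)) * Fintype.card α ≤ ((univ.filter (fun v =>
      v ∉ univ.filter (fun v => deg A {v} < β * (tot w / Fintype.card α)) ∧ deg w {v} ≠ 0)).card : ℝ) := by
  have hN : 0 < (Fintype.card α : ℝ) := by
    rcases Nat.eq_zero_or_pos (Fintype.card α) with h | h
    · exfalso
      have hem := Fintype.card_eq_zero_iff.1 h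
      have : ∀ e, w e = 0 := by
        intro e; by_contra h'
        have := hu e h'
        rw [eq_empty_of_isEmpty e] at this; simp at this; omega
      simp [tot, this] at hE
    · exact_mod_cast h
  set a := tot w / Fintype.card α with ha
  have haN : a * Fintype.card α = tot w := by rw [ha]; field_simp
  have ha0 : 0 < a := by positivity
  have h1 : tot w / 2 ≤ ∑ v, deg A {v} := by
    rw [sum_deg_singleton]
    refine htot.trans (sum_le_sum fun e _ => ?_)
    by_cases h : A e = 0
    · simp [h]
    · have : w e ≠ 0 := by
        intro h'; have := hAw e; have := hA0 e; apply h; linarith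
      have hc : (1 : ℝ) ≤ e.card := by rw [hu e this]; exact_mod_cast hl
      have := hA0 e
      nlinarith
  set F := univ.filter (fun v =>
      v ∉ univ.filter (fun v => deg A {v} < β * a) ∧ deg w {v} ≠ 0) with hF
  have h2 : ∀ v : α, deg A {v} ≤ β * a + (if v ∈ F then K * a else 0) := by
    intro v
    have h3 := deg_mono hAw {v}
    have h4 := hdeg v
    have h5 := deg_nonneg hA0 {v}
    have h7 := mul_nonneg hβ0 ha0.le
    by_cases h : v ∈ F
    · simp only [h, if_true]
      linarith
    · simp only [h, if_false]
      simp only [hF, mem_filter, mem_univ, true_and, not_and, not_lt, not_not] at h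
      by_cases h6 : deg A {v} < β * a
      · linarith
      · have := h (by linarith)
        linarith
  have h8 : ∑ v, deg A {v} ≤ ∑ v : α, (β * a + (if v ∈ F then K * a else 0)) :=
    sum_le_sum fun v _ => h2 v
  rw [sum_add_distrib, sum_const, ← sum_filter, sum_const, nsmul_eq_mul, nsmul_eq_mul, card_univ] at h8
  have h9 : univ.filter (fun v => v ∈ F) = F := by ext; simp
  rw [h9] at h8
  have h10 : (Fintype.card α : ℝ) * (β * a) ≤ tot w / 4 := by nlinarith
  have h11 : tot w / 4 ≤ F.card * (K * a) := by linarith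
  rw [← haN] at h11
  have h12 : (Fintype.card α : ℝ) / 4 ≤ F.card * K := by
    by_contra hh
    push Not at hh
    nlinarith
  rw [div_mul_eq_mul_div, one_mul, div_le_iff₀ (by positivity)]
  linarith

theorem sum_deg_le {α : Type} [Fintype α] (B : Finset α → ℝ) (hB : ∀ e, 0 ≤ B e) (l : ℕ)
    (hu : ∀ e, B e ≠ 0 → e.card = l) : ∑ T, deg B T ≤ 2 ^ l * tot B := by
  unfold deg tot
  simp only [sum_filter]
  rw [sum_comm, mul_sum]
  refine sum_le_sum fun e _ => ?_
  rw [← sum_filter, sum_const, nsmul_eq_mul]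
  by_cases h : B e = 0
  · simp [h]
  · have : univ.filter (fun T => T ⊆ e) = e.powerset := by ext; simp
    rw [this, card_powerset, hu e h]; push_cast; exact le_rfl

noncomputable def Aw {α : Type} [Fintype α] (l : ℕ) (w B : Finset α → ℝ) (Pk : Finset α) (q a : ℝ)
    (e : Finset α) : ℝ :=
  if Disjoint e Pk ∧ ∀ T ⊆ e, 1 ≤ T.card → T.card ≤ l → deg B T < q ^ T.card * a then w e else 0

theorem tot_Aw {α : Type} [Fintype α] (l : ℕ) (w B : Finset α → ℝ) (Pk : Finset α) (q a K c N : ℝ)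
    (hw : ∀ e, 0 ≤ w e) (hB : ∀ e, 0 ≤ B e) (hBu : ∀ e, B e ≠ 0 → e.card = l) (hK : 0 < K)
    (hq : 0 < q) (hq1 : q ≤ 1) (ha : 0 < a) (hN : 0 < N) (haN : a * N = tot w)
    (hdeg : ∀ T, 1 ≤ T.card → T.card ≤ l + 1 → deg w T ≤ K * q ^ (T.card - 1) * a)
    (hPk : Pk.card * (1 / 4 * a) ≤ tot B) (htB : tot B ≤ c * q * tot w)
    (hc1 : c * K * 16 ≤ 1) (hc2 : c * K * 2 ^ l * 4 ≤ 1) (hc : 0 < c) :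
    tot w / 2 ≤ tot (Aw l w B Pk q a) := by
  have key : ∀ e, w e ≤ Aw l w B Pk q a e + (∑ v ∈ Pk, if {v} ⊆ e then w e else 0) +
      ∑ T, (if (1 ≤ T.card ∧ T.card ≤ l ∧ q ^ T.card * a ≤ deg B T) then (if T ⊆ e then w e else 0) else 0) := by
    intro e
    have n1 : 0 ≤ ∑ v ∈ Pk, if {v} ⊆ e then w e else 0 :=
      sum_nonneg fun v _ => by split_ifs <;> simp [hw]
    have n2f : ∀ T : Finset α, 0 ≤ (if (1 ≤ T.card ∧ T.card ≤ l ∧ q ^ T.card * a ≤ deg B T) then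
        (if T ⊆ e then w e else 0) else 0) := fun T => by split_ifs <;> simp [hw]
    have n2 := sum_nonneg (s := (univ : Finset (Finset α))) fun T _ => n2f T
    have n0 : 0 ≤ Aw l w B Pk q a e := by unfold Aw; split_ifs <;> simp [hw]
    by_cases h1 : Disjoint e Pk
    · by_cases h2 : ∀ T ⊆ e, 1 ≤ T.card → T.card ≤ l → deg B T < q ^ T.card * a
      · have : Aw l w B Pk q a e = w e := if_pos ⟨h1, h2⟩
        linarith
      · push Not at h2
        obtain ⟨T, hT, a1, a2, a3⟩ := h2
        have := single_le_sum (fun T _ => n2f T) (mem_univ T)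
        rw [if_pos ⟨a1, a2, a3⟩, if_pos hT] at this
        linarith
    · rw [not_disjoint_iff] at h1
      obtain ⟨v, hv, hv'⟩ := h1
      have := single_le_sum (f := fun v => if {v} ⊆ e then w e else 0)
        (fun v _ => by split_ifs <;> simp [hw]) hv'
      simp only [singleton_subset_iff, hv, if_true] at this n1 ⊢
      linarith
  have k2 : tot w ≤ tot (Aw l w B Pk q a) + (∑ v ∈ Pk, deg w {v}) +
      ∑ T, (if (1 ≤ T.card ∧ T.card ≤ l ∧ q ^ T.card * a ≤ deg B T) then deg w T else 0) := by
    have := sum_le_sum fun e (_ : e ∈ (univ : Finset (Finset α))) => key e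
    rw [sum_add_distrib, sum_add_distrib] at this
    have e1 : ∑ e : Finset α, ∑ v ∈ Pk, (if {v} ⊆ e then w e else 0) = ∑ v ∈ Pk, deg w {v} := by
      rw [sum_comm]
      refine sum_congr rfl fun v _ => ?_
      rw [deg, sum_filter]
    have e2 : ∑ e : Finset α, ∑ T, (if (1 ≤ T.card ∧ T.card ≤ l ∧ q ^ T.card * a ≤ deg B T) then
        (if T ⊆ e then w e else 0) else 0) =
        ∑ T, (if (1 ≤ T.card ∧ T.card ≤ l ∧ q ^ T.card * a ≤ deg B T) then deg w T else 0) := by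
      rw [sum_comm]
      refine sum_congr rfl fun T _ => ?_
      split_ifs
      · rw [deg, sum_filter]
      · simp
    rw [e1, e2] at this
    exact this
  have k3 : ∑ v ∈ Pk, deg w {v} ≤ tot w / 4 := by
    have : ∑ v ∈ Pk, deg w {v} ≤ Pk.card * (K * a) := by
      rw [← nsmul_eq_mul]
      refine sum_le_card_nsmul _ _ _ fun v _ => ?_
      have := hdeg {v} (by simp) (by simp)
      simpa using this
    have h0 : 0 ≤ tot w := by rw [← haN]; positivity
    have h5 : c * q * tot w ≤ c * tot w := by
      have : c * tot w * q ≤ c * tot w * 1 := mul_le_mul_of_nonneg_left hq1 (by positivity)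
      linarith
    have h6 : Pk.card * a ≤ 4 * (c * tot w) := by linarith
    have h7 : Pk.card * a * K ≤ 4 * (c * tot w) * K := mul_le_mul_of_nonneg_right h6 hK.le
    have h8 : c * K * 16 * tot w ≤ 1 * tot w := mul_le_mul_of_nonneg_right hc1 h0
    linarith
  have k4 : ∑ T, (if (1 ≤ T.card ∧ T.card ≤ l ∧ q ^ T.card * a ≤ deg B T) then deg w T else 0)
      ≤ tot w / 4 := by
    have : ∑ T, (if (1 ≤ T.card ∧ T.card ≤ l ∧ q ^ T.card * a ≤ deg B T) then deg w T else 0)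
        ≤ ∑ T, K / q * deg B T := by
      refine sum_le_sum fun T _ => ?_
      split_ifs with h
      · refine (hdeg T h.1 (by omega)).trans ?_
        rw [div_mul_eq_mul_div, le_div_iff₀ hq]
        obtain ⟨j, hj⟩ : ∃ j, T.card = j + 1 := ⟨T.card - 1, by omega⟩
        rw [hj] at h ⊢
        have := mul_le_mul_of_nonneg_left h.2.2 hK.le
        simp only [Nat.add_sub_cancel]
        rw [pow_succ] at this
        linarith
      · have := deg_nonneg hB T
        positivity
    refine this.trans ?_
    rw [← mul_sum]
    have h1 := sum_deg_le B hB l hBu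
    have h2 : (2:ℝ) ^ l * tot B ≤ 2 ^ l * (c * q * tot w) := mul_le_mul_of_nonneg_left htB (by positivity)
    have h0 : 0 ≤ tot w := by rw [← haN]; positivity
    calc K / q * ∑ T, deg B T ≤ K / q * (2 ^ l * (c * q * tot w)) :=
          mul_le_mul_of_nonneg_left (h1.trans h2) (by positivity)
      _ = c * K * 2 ^ l * 4 * (tot w / 4) := by field_simp
      _ ≤ 1 * (tot w / 4) := mul_le_mul_of_nonneg_right hc2 (by positivity)
      _ = _ := one_mul _
  linarith
end ORam

namespace ORam
open Finset
open scoped Classical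

theorem deg_ne_zero {α : Type} [Fintype α] {w : Finset α → ℝ} (h : ∀ e, 0 ≤ w e) (T) :
    deg w T ≠ 0 ↔ ∃ e, T ⊆ e ∧ w e ≠ 0 := by
  unfold deg
  rw [Ne, sum_eq_zero_iff_of_nonneg (fun e _ => h e)]
  simp

theorem deg_link {α : Type} [Fintype α] (A : Finset α → ℝ) (v : α) (T : Finset α) (hv : v ∉ T) :
    ∑ f ∈ univ.filter (fun f => T ⊆ f), (if v ∉ f then A (insert v f) else 0) = deg A (insert v T) := by
  rw [← sum_filter, deg]
  refine sum_bij' (fun f _ => insert v f) (fun e _ => e.erase v) ?_ ?_ ?_ ?_ ?_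
  · intro f hf
    simp only [mem_filter, mem_univ, true_and] at hf ⊢
    exact insert_subset_insert _ hf.1
  · intro e he
    simp only [mem_filter, mem_univ, true_and] at he ⊢
    refine ⟨fun x hx => mem_erase.2 ⟨fun h => hv (h ▸ hx), he (mem_insert_of_mem hx)⟩, by simp⟩
  · intro f hf
    simp only [mem_filter, mem_univ, true_and] at hf
    exact erase_insert hf.2
  · intro e he
    simp only [mem_filter, mem_univ, true_and] at he
    exact insert_erase (he (mem_insert_self _ _))
  · intro f hf; rfl

theorem inner {α : Type} [Fintype α] (l : ℕ) (w : Finset α → ℝ) (q a K c δ s : ℝ)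
    (hw : ∀ e, 0 ≤ w e) (hwu : ∀ e, w e ≠ 0 → e.card = l + 1) (hK : 0 < K)
    (hq : 0 < q) (hq1 : q ≤ 1) (hE : 0 < tot w) (ha : 0 < a) (haN : a = tot w / Fintype.card α)
    (hN : 0 < Fintype.card α)
    (hdeg : ∀ T, 1 ≤ T.card → T.card ≤ l + 1 → deg w T ≤ K * q ^ (T.card - 1) * a)
    (hc1 : c * K * 16 ≤ 1) (hc2 : c * K * 2 ^ l * 4 ≤ 1) (hc : 0 < c) (hs : 0 ≤ s)
    (hIH : ∀ B : Finset α → ℝ, (∀ e, 0 ≤ B e) → (∀ e, B e ≠ 0 → e.card = l) →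
      c * q * tot w < tot B →
      (∀ T, 1 ≤ T.card → T.card ≤ l → deg B T ≤ (1 + K) * q ^ T.card * a) →
      Conc B (fun I => ∀ e ⊆ I, B e = 0) δ s) :
    ∀ (k : ℕ) (Pk : Finset α) (B : Finset α → ℝ), (∀ e, 0 ≤ B e) → (∀ e, B e ≠ 0 → e.card = l) →
      (∀ T, 1 ≤ T.card → T.card ≤ l → deg B T ≤ (1 + K) * q ^ T.card * a) →
      (Pk.card * (1 / 4 * a) ≤ tot B) → (∀ f, B f ≠ 0 → ∃ e, f ⊆ e ∧ w e ≠ 0) →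
      c * q * tot w < tot B + k * (1 / 4 * a) →
      Conc w (fun I => (∀ e ⊆ I, w e = 0) ∧ ∀ e ⊆ I, B e = 0) (min δ (1 / (4 * K))) (k + s) := by
  have hN' : (0 : ℝ) < Fintype.card α := by exact_mod_cast hN
  have haN' : a * Fintype.card α = tot w := by rw [haN]; field_simp
  have big : ∀ (k : ℕ) (B : Finset α → ℝ), (∀ e, 0 ≤ B e) → (∀ e, B e ≠ 0 → e.card = l) →
      (∀ T, 1 ≤ T.card → T.card ≤ l → deg B T ≤ (1 + K) * q ^ T.card * a) →
      (∀ f, B f ≠ 0 → ∃ e, f ⊆ e ∧ w e ≠ 0) → c * q * tot w < tot B →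
      Conc w (fun I => (∀ e ⊆ I, w e = 0) ∧ ∀ e ⊆ I, B e = 0) (min δ (1 / (4 * K))) (k + s) := by
    intro k B hB hBu hBd hsup hlarge
    obtain ⟨C, hC⟩ := hIH B hB hBu hlarge hBd
    refine ⟨C, fun I hI => ?_⟩
    obtain ⟨h1, h2, S, hS, hSc, hU⟩ := hC I hI.2
    refine ⟨h1, ?_, S, hS, hSc.trans (by linarith [(Nat.cast_nonneg k : (0:ℝ) ≤ k)]), hU⟩
    calc min δ (1 / (4 * K)) * (Fintype.card α : ℝ) ≤ δ * Fintype.card α :=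
          mul_le_mul_of_nonneg_right (min_le_left _ _) hN'.le
      _ ≤ _ := h2
      _ ≤ _ := by
        exact_mod_cast card_le_card (fun v hv => by
          simp only [mem_filter, mem_univ, true_and] at hv ⊢
          refine ⟨hv.1, ?_⟩
          obtain ⟨f, hf, hf'⟩ := (deg_ne_zero hB _).1 hv.2
          obtain ⟨e, he, he'⟩ := hsup f hf'
          exact (deg_ne_zero hw _).2 ⟨e, hf.trans he, he'⟩)
  intro k
  induction k with
  | zero =>
    intro Pk B hB hBu hBd hPk hsup hlarge
    exact big 0 B hB hBu hBd hsup (by simpa using hlarge)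
  | succ k ih =>
    intro Pk B hB hBu hBd hPk hsup hlarge
    by_cases hlt : c * q * tot w < tot B
    · exact big _ B hB hBu hBd hsup hlt
    push Not at hlt
    set A := Aw l w B Pk q a with hA
    have hA0 : ∀ e, 0 ≤ A e := fun e => by
      simp only [hA, Aw]; split_ifs <;> simp [hw]
    have hAw : ∀ e, A e ≤ w e := fun e => by
      simp only [hA, Aw]; split_ifs <;> simp [hw]
    have htot : tot w / 2 ≤ tot A :=
      tot_Aw l w B Pk q a K c _ hw hB hBu hK hq hq1 ha hN' haN' hdeg hPk hlt hc1 hc2 hc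
    let thr := fun v : α => 1 / 4 * a ≤ deg A {v}
    -- next states
    have hnext : ∀ v, thr v → Conc w (fun I => (∀ e ⊆ I, w e = 0) ∧
        ∀ e ⊆ I, (B e + (if v ∉ e then A (insert v e) else 0)) = 0) (min δ (1 / (4 * K))) (k + s) := by
      intro v hv
      have hdv : ∀ T, deg (fun e => B e + (if v ∉ e then A (insert v e) else 0)) T =
          deg B T + ∑ f ∈ univ.filter (fun f => T ⊆ f), (if v ∉ f then A (insert v f) else 0) := by
        intro T; simp only [deg, sum_add_distrib]
      have htv : tot (fun e => B e + (if v ∉ e then A (insert v e) else 0)) = tot B + deg A {v} := by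
        have := deg_link A v ∅ (by simp)
        simp only [empty_subset, filter_true, insert_empty] at this
        rw [← this]; simp only [tot, sum_add_distrib]
      have hln : ∀ e, 0 ≤ (if v ∉ e then A (insert v e) else 0) := fun e => by
        split_ifs <;> simp [hA0]
      refine ih (insert v Pk) _ ?_ ?_ ?_ ?_ ?_ ?_
      · intro e; exact add_nonneg (hB e) (hln e)
      · intro e he
        by_cases h : B e = 0
        · have h2 : v ∉ e ∧ A (insert v e) ≠ 0 := by
            rw [h, zero_add] at he
            by_contra hcon
            apply he
            split_ifs with h3
            · rfl
            · by_contra h4; exact hcon ⟨h3, h4⟩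
          have h3 : w (insert v e) ≠ 0 := by
            intro h4; have := hAw (insert v e); have := hA0 (insert v e); exact h2.2 (by linarith)
          have := hwu _ h3
          rw [card_insert_of_notMem h2.1] at this
          omega
        · exact hBu e h
      · intro T hT1 hTl
        rw [hdv]
        by_cases hheavy : q ^ T.card * a ≤ deg B T
        · have : ∑ f ∈ univ.filter (fun f => T ⊆ f), (if v ∉ f then A (insert v f) else 0) = 0 := by
            refine sum_eq_zero fun f hf => ?_
            simp only [mem_filter, mem_univ, true_and] at hf
            split_ifs
            · rfl
            · simp only [hA, Aw]
              rw [if_neg]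
              rintro ⟨_, h⟩
              exact absurd (h T (hf.trans (subset_insert _ _)) hT1 hTl) (by linarith)
          rw [this, add_zero]; exact hBd T hT1 hTl
        · push Not at hheavy
          by_cases hvT : v ∈ T
          · have : ∑ f ∈ univ.filter (fun f => T ⊆ f), (if v ∉ f then A (insert v f) else 0) = 0 := by
              refine sum_eq_zero fun f hf => ?_
              simp only [mem_filter, mem_univ, true_and] at hf
              rw [if_neg]; simpa using hf hvT
            rw [this, add_zero]; exact hBd T hT1 hTl
          · rw [deg_link A v T hvT]
            have h1 := deg_mono hAw (insert v T)
            have h2 := hdeg (insert v T) (by rw [card_insert_of_notMem hvT]; omega)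
              (by rw [card_insert_of_notMem hvT]; omega)
            rw [card_insert_of_notMem hvT, Nat.add_sub_cancel] at h2
            linarith
      · rw [htv]
        have h1 : ((insert v Pk).card : ℝ) ≤ Pk.card + 1 := by exact_mod_cast card_insert_le _ _
        have h2 : 1 / 4 * a ≤ deg A {v} := hv
        nlinarith
      · intro f hf
        by_cases h : B f = 0
        · refine ⟨insert v f, subset_insert _ _, ?_⟩
          intro h4
          have := hAw (insert v f); have := hA0 (insert v f)
          apply hf
          rw [h, zero_add]; split_ifs
          · rfl
          · linarith
        · exact hsup f h
      · rw [htv]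
        have h2 : 1 / 4 * a ≤ deg A {v} := hv
        push_cast at hlarge
        linarith
    haveI : Nonempty α := Fintype.card_pos_iff.1 hN
    choose! Cn hCn using hnext
    obtain ⟨r, hr⟩ : ∃ r : α → ℕ, Function.Injective r :=
      ⟨fun x => (Fintype.equivFin α x : ℕ), fun x y h => (Fintype.equivFin α).injective (Fin.ext h)⟩
    have hmin : ∀ X : Finset α, X.Nonempty → ∃ v ∈ X, ∀ v' ∈ X, r v ≤ r v' :=
      fun X hX => exists_min_image X r hX
    choose! am ham1 ham2 using hmin
    let X := fun U : Finset α => U.filter thr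
    let C0 := univ.filter (fun v => deg A {v} < 1 / 4 * a)
    refine ⟨fun U => if (X U).Nonempty then Cn (am (X U)) U else C0, fun I hI => ?_⟩
    by_cases hX : (X I).Nonempty
    · have hv := ham1 _ hX
      have hvm := ham2 _ hX
      set v := am (X I) with hvdef
      have hvI : v ∈ I ∧ thr v := by simpa [X] using hv
      obtain ⟨h1, h2, S, hS, hSc, hSU⟩ := hCn v hvI.2 I ⟨hI.1, fun e he => by
        rw [hI.2 e he, zero_add]
        split_ifs
        · rfl
        · have := hAw (insert v e); have := hA0 (insert v e)
          have := hI.1 (insert v e) (insert_subset hvI.1 he)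
          linarith⟩
      simp only [hX, if_true]
      refine ⟨h1, h2, insert v S, insert_subset hvI.1 hS, ?_, ?_⟩
      · have h1 : ((insert v S).card : ℝ) ≤ S.card + 1 := by exact_mod_cast card_insert_le _ _
        push_cast; linarith
      · intro U hSU' hUI
        have hvU : v ∈ X U := by
          simp only [X, mem_filter]; exact ⟨hSU' (mem_insert_self _ _), hvI.2⟩
        have hne : (X U).Nonempty := ⟨v, hvU⟩
        rw [if_pos hne]
        have h3 : am (X U) ∈ X U := ham1 _ hne
        have h4 : am (X U) = v := by
          apply hr
          apply le_antisymm (ham2 _ hne v hvU)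
          apply hvm
          simp only [X, mem_filter] at h3 ⊢
          exact ⟨hUI h3.1, h3.2⟩
        rw [h4]
        exact hSU U ((subset_insert _ _).trans hSU') hUI
    · simp only [hX, if_false]
      refine ⟨?_, ?_, ∅, by simp, ?_, ?_⟩
      · intro v hv
        simp only [C0, mem_filter, mem_univ, true_and]
        by_contra h
        exact hX ⟨v, by simp only [X, thr, mem_filter]; exact ⟨hv, by linarith⟩⟩
      · have := count_large w A hA0 hAw (l + 1) (by omega) hwu K (1 / 4) hK (by norm_num) le_rfl hE
          (fun v => by
            have := hdeg {v} (by simp) (by simp)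
            rw [← haN]; simpa using this) htot
        rw [← haN] at this
        refine le_trans ?_ this
        exact mul_le_mul_of_nonneg_right (min_le_right _ _) hN'.le
      · push_cast; simp; positivity
      · intro U _ hUI
        rw [if_neg]
        rintro ⟨v, hv⟩
        simp only [X, mem_filter] at hv
        exact hX ⟨v, by simp only [X, mem_filter]; exact ⟨hUI hv.1, hv.2⟩⟩

theorem card_pos_of_tot {α : Type} [Fintype α] (w : Finset α → ℝ) (l : ℕ) (hl : 1 ≤ l)
    (hu : ∀ e, w e ≠ 0 → e.card = l) (hE : 0 < tot w) : 0 < Fintype.card α := by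
  rcases Nat.eq_zero_or_pos (Fintype.card α) with h | h
  · exfalso
    have hem := Fintype.card_eq_zero_iff.1 h
    have : ∀ e, w e = 0 := by
      intro e; by_contra h'
      have := hu e h'
      rw [eq_empty_of_isEmpty e] at this; simp at this; omega
    simp [tot, this] at hE
  · exact h

theorem CL_one : CL 1 := by
  intro K hK
  refine ⟨1 / K, by positivity, 1, by norm_num, ?_⟩
  intro α _ w q hw hu hq hq1 hE hdeg
  have hN := card_pos_of_tot w 1 le_rfl hu hE
  have hN' : (0 : ℝ) < Fintype.card α := by exact_mod_cast hN
  refine ⟨fun _ => univ.filter (fun v => deg w {v} = 0), fun I hI => ⟨?_, ?_, ∅, by simp, ?_, ?_⟩⟩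
  · intro v hv
    simp only [mem_filter, mem_univ, true_and]
    by_contra h
    obtain ⟨e, he, he'⟩ := (deg_ne_zero hw _).1 h
    have h1 := hu e he'
    have : e = {v} := (eq_of_subset_of_card_le he (by simp [h1])).symm
    apply he'; apply hI; rw [this]; simpa using hv
  · have h1 : ∑ v, deg w {v} = tot w := by
      rw [sum_deg_singleton, tot]
      refine sum_congr rfl fun e _ => ?_
      by_cases h : w e = 0
      · simp [h]
      · simp [hu e h]
    set F := univ.filter (fun v => v ∉ univ.filter (fun v => deg w {v} = 0) ∧ deg w {v} ≠ 0) with hF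
    have h2 : ∑ v, deg w {v} ≤ F.card * (K * (tot w / Fintype.card α)) := by
      rw [← nsmul_eq_mul]
      have : ∑ v, deg w {v} = ∑ v ∈ F, deg w {v} := by
        symm; apply sum_subset (subset_univ _)
        intro v _ hv
        by_contra h
        exact hv (by simp [hF, h])
      rw [this]
      refine sum_le_card_nsmul _ _ _ fun v _ => ?_
      have := hdeg {v} (by simp) (by simp)
      simpa using this
    rw [h1] at h2
    rw [div_mul_eq_mul_div, one_mul, div_le_iff₀ hK]
    have h3 : tot w * Fintype.card α ≤ F.card * K * tot w := by
      have := mul_le_mul_of_nonneg_right h2 hN'.le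
      calc _ ≤ _ := this
        _ = _ := by field_simp
    nlinarith
  · simp; positivity
  · intros; rfl

theorem CL_succ (l : ℕ) (hl : 1 ≤ l) (h : CL l) : CL (l + 1) := by
  intro K hK
  obtain ⟨c, hc, hc1, hc2⟩ : ∃ c : ℝ, 0 < c ∧ c * K * 16 ≤ 1 ∧ c * K * 2 ^ l * 4 ≤ 1 := by
    refine ⟨1 / (16 * K * 2 ^ l), by positivity, ?_, ?_⟩
    · have : (1:ℝ) ≤ 2 ^ l := one_le_pow₀ (by norm_num)
      rw [div_mul_eq_mul_div, div_mul_eq_mul_div, div_le_one (by positivity)]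
      nlinarith
    · rw [div_mul_eq_mul_div, div_mul_eq_mul_div, div_mul_eq_mul_div, div_le_one (by positivity)]
      have : 0 < K * 2 ^ l := by positivity
      linarith
  obtain ⟨δ, hδ, B', hB', hCL⟩ := h ((1 + K) / c) (by positivity)
  refine ⟨min δ (1 / (4 * K)), by positivity, 4 * c + 2 + B', by positivity, ?_⟩
  intro α _ w q hw hu hq hq1 hE hdeg
  have hN := card_pos_of_tot w (l + 1) (by omega) hu hE
  have hN' : (0 : ℝ) < Fintype.card α := by exact_mod_cast hN
  set a := tot w / Fintype.card α with ha
  have ha0 : 0 < a := by positivity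
  have haN : a * Fintype.card α = tot w := by rw [ha]; field_simp
  have := inner l w q a K c δ (B' * (q * Fintype.card α + 1)) hw hu hK hq hq1 hE ha0 ha hN hdeg
    hc1 hc2 hc (by positivity) (by
      intro B hB hBu hlarge hBd
      have htB : 0 < tot B := lt_of_le_of_lt (by positivity) hlarge
      refine hCL α B q hB hBu hq hq1 htB ?_
      intro T hT1 hTl
      refine (hBd T hT1 hTl).trans ?_
      obtain ⟨j, hj⟩ : ∃ j, T.card = j + 1 := ⟨T.card - 1, by omega⟩
      rw [hj, Nat.add_sub_cancel]
      have h1 : q * a ≤ 1 / c * (tot B / Fintype.card α) := by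
        rw [ha, div_mul_div_comm, mul_div_assoc', div_le_div_iff₀ hN' (by positivity)]
        nlinarith
      calc (1 + K) * q ^ (j + 1) * a = (1 + K) * q ^ j * (q * a) := by ring
        _ ≤ (1 + K) * q ^ j * (1 / c * (tot B / Fintype.card α)) :=
            mul_le_mul_of_nonneg_left h1 (by positivity)
        _ = _ := by ring)
    (⌈4 * c * q * Fintype.card α⌉₊ + 1) ∅ (fun _ => 0) (by simp) (by simp)
    (by intro T _ _; simp only [deg, sum_const_zero]; positivity) (by simp [tot]) (by simp) (by
      have := Nat.le_ceil (4 * c * q * Fintype.card α)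
      push_cast
      have h2 : tot (fun _ : Finset α => (0:ℝ)) = 0 := by simp [tot]
      rw [h2, ← haN]
      nlinarith)
  obtain ⟨C, hC⟩ := this
  refine ⟨C, fun I hI => ?_⟩
  obtain ⟨h1, h2, S, hS, hSc, hSU⟩ := hC I ⟨hI, by simp⟩
  refine ⟨h1, h2, S, hS, hSc.trans ?_, hSU⟩
  have := Nat.ceil_lt_add_one (show 0 ≤ 4 * c * q * Fintype.card α by positivity)
  push_cast
  have : 0 < q * Fintype.card α := by positivity
  nlinarith

theorem CL_all (l : ℕ) (hl : 1 ≤ l) : CL l := by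
  induction l, hl using Nat.le_induction with
  | base => exact CL_one
  | succ l hl ih => exact CL_succ l hl ih

end ORam

namespace ORam
open Finset
open scoped Classical

theorem iter (l : ℕ) (hl : 1 ≤ l) (K ε : ℝ) (hK : 0 < K) (hε : 0 < ε) : ∃ B > (0 : ℝ),
    ∀ (α : Type) [Fintype α] (w : Finset α → ℝ) (q : ℝ),
    (∀ e, 0 ≤ w e) → (∀ e, w e ≠ 0 → e.card = l) → 0 < q → q ≤ 1 → 0 < tot w →
    (∀ T, 1 ≤ T.card → T.card ≤ l → deg w T ≤ K * q ^ (T.card - 1) * (tot w / Fintype.card α)) →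
    ∃ C : Finset α → Finset α, ∀ I, (∀ e ⊆ I, w e = 0) → I ⊆ C I ∧
      ∑ e ∈ univ.filter (fun e => e ⊆ C I), w e ≤ ε * tot w ∧
      ∃ S ⊆ I, (S.card : ℝ) ≤ B * (q * Fintype.card α + 1) ∧ ∀ U, S ⊆ U → U ⊆ I → C U = C I := by
  obtain ⟨δ, hδ, B, hB, hCL⟩ := CL_all l hl (K / ε) (by positivity)
  refine ⟨(⌈1 / δ⌉₊ + 1) * B, by positivity, ?_⟩
  intro α _ w q hw hu hq hq1 hE hdeg
  have hN := card_pos_of_tot w l hl hu hE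
  have hN' : (0 : ℝ) < Fintype.card α := by exact_mod_cast hN
  have key : ∀ (j : ℕ) (C0 : Finset α), (C0.card : ℝ) ≤ j * (δ * Fintype.card α) →
      ∃ C : Finset α → Finset α, ∀ I, (∀ e ⊆ I, w e = 0) → I ⊆ C0 → I ⊆ C I ∧
      ∑ e ∈ univ.filter (fun e => e ⊆ C I), w e ≤ ε * tot w ∧
      ∃ S ⊆ I, (S.card : ℝ) ≤ j * (B * (q * Fintype.card α + 1)) ∧
        ∀ U, S ⊆ U → U ⊆ I → C U = C I := by
    intro j
    induction j with
    | zero =>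
      intro C0 h0
      have hC0 : C0 = ∅ := by
        rw [← card_eq_zero]; have : (C0.card : ℝ) ≤ 0 := by simpa using h0
        exact_mod_cast le_antisymm this (by positivity)
      refine ⟨fun _ => ∅, fun I hI hI0 => ⟨hC0 ▸ hI0, ?_, ∅, by simp, by simp, fun _ _ _ => rfl⟩⟩
      have : ∑ e ∈ univ.filter (fun e : Finset α => e ⊆ ∅), w e = 0 := by
        refine sum_eq_zero fun e he => ?_
        simp only [mem_filter, mem_univ, true_and, subset_empty] at he
        by_contra h
        have := hu e h
        rw [he] at this; simp at this; omega
      rw [this]; positivity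
    | succ j ih =>
      intro C0 h0
      by_cases hsm : ∑ e ∈ univ.filter (fun e => e ⊆ C0), w e ≤ ε * tot w
      · exact ⟨fun _ => C0, fun I hI hI0 => ⟨hI0, hsm, ∅, by simp, by simp; positivity,
          fun _ _ _ => rfl⟩⟩
      push Not at hsm
      let w' : Finset α → ℝ := fun e => if e ⊆ C0 then w e else 0
      have hw'0 : ∀ e, 0 ≤ w' e := fun e => by simp only [w']; split_ifs <;> simp [hw]
      have hw'w : ∀ e, w' e ≤ w e := fun e => by simp only [w']; split_ifs <;> simp [hw]
      have hne : ∀ e, w' e ≠ 0 → e ⊆ C0 ∧ w e ≠ 0 := fun e => by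
        simp only [w']; split_ifs with h
        · exact fun h' => ⟨h, h'⟩
        · simp
      have ht' : tot w' = ∑ e ∈ univ.filter (fun e => e ⊆ C0), w e := by
        simp only [tot, w', sum_filter]
      have hlt : ε * tot w < tot w' := by rw [ht']; exact hsm
      obtain ⟨C1, hC1⟩ := hCL α w' q hw'0 (fun e he => hu e (hne e he).2) hq hq1
        (lt_of_le_of_lt (by positivity) hlt) (by
          intro T h1 h2
          refine (deg_mono hw'w T).trans ((hdeg T h1 h2).trans ?_)
          have : tot w / Fintype.card α ≤ 1 / ε * (tot w' / Fintype.card α) := by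
            rw [div_mul_div_comm, div_le_div_iff₀ hN' (by positivity)]
            nlinarith
          calc K * q ^ (T.card - 1) * (tot w / Fintype.card α)
              ≤ K * q ^ (T.card - 1) * (1 / ε * (tot w' / Fintype.card α)) :=
                mul_le_mul_of_nonneg_left this (by positivity)
            _ = _ := by ring)
      choose! C' hC' using ih
      refine ⟨fun U => C' (C0 ∩ C1 U) U, fun I hI hI0 => ?_⟩
      obtain ⟨h1, h2, S1, hS1, hS1c, hS1U⟩ := hC1 I (fun e he => by
        simp only [w']; split_ifs
        · exact hI e he
        · rfl)
      have hcard : ((C0 ∩ C1 I).card : ℝ) ≤ j * (δ * Fintype.card α) := by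
        have h3 : univ.filter (fun v => v ∉ C1 I ∧ deg w' {v} ≠ 0) ⊆ C0 \ C1 I := by
          intro v hv
          simp only [mem_filter, mem_univ, true_and] at hv
          obtain ⟨e, he, he'⟩ := (deg_ne_zero hw'0 _).1 hv.2
          exact mem_sdiff.2 ⟨(hne e he').1 (he (mem_singleton_self v)), hv.1⟩
        have h4 : ((univ.filter (fun v => v ∉ C1 I ∧ deg w' {v} ≠ 0)).card : ℝ) ≤ (C0 \ C1 I).card := by
          exact_mod_cast card_le_card h3
        have h5 : ((C0 \ C1 I).card : ℝ) + (C0 ∩ C1 I).card = C0.card := by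
          exact_mod_cast card_sdiff_add_card_inter C0 (C1 I)
        push_cast at h0
        linarith
      obtain ⟨g1, g2, S2, hS2, hS2c, hS2U⟩ := hC' (C0 ∩ C1 I) hcard I hI (subset_inter hI0 h1)
      refine ⟨g1, g2, S1 ∪ S2, union_subset hS1 hS2, ?_, ?_⟩
      · have : ((S1 ∪ S2).card : ℝ) ≤ S1.card + S2.card := by exact_mod_cast card_union_le _ _
        push_cast; linarith
      · intro U hU1 hU2
        show C' (C0 ∩ C1 U) U = C' (C0 ∩ C1 I) I
        rw [hS1U U (subset_union_left.trans hU1) hU2, hS2U U (subset_union_right.trans hU1) hU2]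
  obtain ⟨C, hC⟩ := key (⌈1 / δ⌉₊ + 1) univ (by
    have := Nat.le_ceil (1 / δ)
    rw [div_le_iff₀ hδ] at this
    rw [card_univ]; push_cast
    nlinarith)
  refine ⟨C, fun I hI => ?_⟩
  obtain ⟨h1, h2, S, h3, h4, h5⟩ := hC I hI (subset_univ _)
  refine ⟨h1, h2, S, h3, h4.trans (le_of_eq ?_), h5⟩
  push_cast; ring

end ORam

namespace ORam
open Finset
open scoped Classical

theorem card_fix {ι V : Type} [Fintype ι] [Fintype V] [DecidableEq ι] (A : Finset ι) (S : ι → Finset V)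
    [DecidablePred (fun h : ι → V => ∀ i ∈ A, h i ∈ S i)] :
    (univ.filter (fun h : ι → V => ∀ i ∈ A, h i ∈ S i)).card =
      (∏ i ∈ A, (S i).card) * Fintype.card V ^ (Fintype.card ι - A.card) := by
  have : univ.filter (fun h : ι → V => ∀ i ∈ A, h i ∈ S i) =
      Fintype.piFinset (fun i => if i ∈ A then S i else univ) := by
    ext h
    simp only [mem_filter, mem_univ, true_and, Fintype.mem_piFinset]
    refine forall_congr' fun i => ?_
    by_cases hi : i ∈ A <;> simp [hi]
  rw [this, Fintype.card_piFinset, ← prod_mul_prod_compl A]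
  congr 1
  · exact prod_congr rfl fun i hi => by simp [hi]
  · rw [prod_congr rfl (g := fun _ => Fintype.card V) fun i hi => by simp [mem_compl.1 hi]]
    rw [prod_const, card_compl]

/-- Ramsey-type: large semicomplete digraphs contain transitive chains. -/
theorem chain {V : Type} (D : V → V → Prop) : ∀ (t : ℕ) (X : Finset V), 2 ^ t ≤ X.card →
    (∀ u ∈ X, ∀ v ∈ X, u ≠ v → D u v ∨ D v u) →
    ∃ L : List V, L.length = t ∧ L.Pairwise D ∧ L.Nodup ∧ ∀ x ∈ L, x ∈ X := by
  intro t
  induction t with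
  | zero => intro X _ _; exact ⟨[], by simp⟩
  | succ t ih =>
    intro X hX hD
    have hne : X.Nonempty := by
      rw [← card_pos]; exact lt_of_lt_of_le (by positivity) hX
    obtain ⟨v, hv⟩ := hne
    set X1 := (X.erase v).filter (fun u => D v u) with hX1
    set X2 := (X.erase v).filter (fun u => ¬ D v u) with hX2
    have hc : X1.card + X2.card = X.card - 1 := by
      rw [hX1, hX2, card_filter_add_card_filter_not, card_erase_of_mem hv]
    rw [pow_succ] at hX
    have hp : 0 < 2 ^ t := by positivity
    by_cases h : 2 ^ t ≤ X1.card
    · obtain ⟨L, h1, h2, h3, h4⟩ := ih X1 h (fun a ha b hb => hD a (mem_of_mem_erase (mem_filter.1 ha).1)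
        b (mem_of_mem_erase (mem_filter.1 hb).1))
      refine ⟨v :: L, by simp [h1], List.pairwise_cons.2 ⟨fun a ha => (mem_filter.1 (h4 a ha)).2, h2⟩,
        List.nodup_cons.2 ⟨fun hvL => ?_, h3⟩, ?_⟩
      · exact (mem_erase.1 (mem_filter.1 (h4 v hvL)).1).1 rfl
      · intro x hx
        rcases List.mem_cons.1 hx with rfl | hx
        · exact hv
        · exact mem_of_mem_erase (mem_filter.1 (h4 x hx)).1
    · have h : 2 ^ t ≤ X2.card := by omega
      obtain ⟨L, h1, h2, h3, h4⟩ := ih X2 h (fun a ha b hb => hD a (mem_of_mem_erase (mem_filter.1 ha).1)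
        b (mem_of_mem_erase (mem_filter.1 hb).1))
      refine ⟨L ++ [v], by simp [h1], ?_, ?_, ?_⟩
      · rw [List.pairwise_append]
        refine ⟨h2, by simp, fun a ha b hb => ?_⟩
        rw [List.mem_singleton.1 hb]
        have := mem_filter.1 (h4 a ha)
        have h5 := mem_erase.1 this.1
        exact (hD a h5.2 v hv h5.1).resolve_right this.2
      · rw [List.nodup_append]
        refine ⟨h3, by simp, fun a ha b hb => ?_⟩
        rw [List.mem_singleton.1 hb]
        exact (mem_erase.1 (mem_filter.1 (h4 a ha)).1).1
      · intro x hx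
        rcases List.mem_append.1 hx with hx | hx
        · exact mem_of_mem_erase (mem_filter.1 (h4 x hx)).1
        · rw [List.mem_singleton.1 hx]; exact hv

/-- An acyclic digraph on `Fin t` has a ranking. -/
theorem exists_rank {t : ℕ} (H : Fin t → Fin t → Prop) (hac : RelAcyclic H) :
    ∃ r : Fin t → Fin t, Function.Injective r ∧ ∀ a b, H a b → r a < r b := by
  have hpo : IsPartialOrder (Fin t) (Relation.ReflTransGen H) :=
    { refl := fun a => .refl
      trans := fun a b c => .trans
      antisymm := fun a b hab hba => by
        rcases Relation.reflTransGen_iff_eq_or_transGen.1 hab with h | h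
        · exact h.symm
        · exact absurd (h.trans_left hba) (hac a) }
  obtain ⟨s, hs, hle⟩ := extend_partialOrder (Relation.ReflTransGen H)
  let down := fun a : Fin t => univ.filter (fun b => s b a ∧ b ≠ a)
  have hlt : ∀ a b, s a b → a ≠ b → down a ⊂ down b := by
    intro a b hab hne
    rw [ssubset_iff_of_subset]
    · exact ⟨a, by simp [down, hab, hne], by simp [down]⟩
    · intro x hx
      simp only [down, mem_filter, mem_univ, true_and] at hx ⊢
      refine ⟨hs.trans _ _ _ hx.1 hab, ?_⟩
      rintro rfl
      exact hne (hs.antisymm _ _ hab hx.1)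
  have hct : ∀ a, (down a).card < t := by
    intro a
    have : down a ⊆ univ.erase a := by
      intro x hx; simp only [down, mem_filter, mem_univ, true_and] at hx; simp [hx.2]
    have h2 := card_le_card this
    have h3 := a.pos
    rw [card_erase_of_mem (mem_univ _), card_univ, Fintype.card_fin] at h2
    omega
  refine ⟨fun a => ⟨(down a).card, hct a⟩, ?_, ?_⟩
  · intro a b hab
    simp only [Fin.mk.injEq] at hab
    by_contra hne
    rcases hs.total a b with h | h
    · exact absurd (card_lt_card (hlt a b h hne)) (by omega)
    · exact absurd (card_lt_card (hlt b a h (Ne.symm hne))) (by omega)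
  · intro a b hab
    have hne : a ≠ b := by rintro rfl; exact hac a (.single hab)
    exact card_lt_card (hlt a b (hle _ _ (.single hab)) hne)

theorem embed_semi {V : Type} {t : ℕ} (H : Fin t → Fin t → Prop) (hac : RelAcyclic H)
    (D : V → V → Prop) (X : Finset V) (hX : 2 ^ t ≤ X.card)
    (hD : ∀ u ∈ X, ∀ v ∈ X, u ≠ v → D u v ∨ D v u) :
    ∃ f : Fin t → V, Function.Injective f ∧ (∀ a, f a ∈ X) ∧ ∀ a b, H a b → D (f a) (f b) := by
  obtain ⟨L, h1, h2, h3, h4⟩ := chain D t X hX hD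
  obtain ⟨r, hr, hr'⟩ := exists_rank H hac
  subst h1
  refine ⟨fun a => L.get (r a), ?_, ?_, ?_⟩
  · exact (List.nodup_iff_injective_get.1 h3).comp hr
  · intro a; exact h4 _ (List.get_mem _ _)
  · intro a b hab; exact List.pairwise_iff_get.1 h2 _ _ (hr' a b hab)

noncomputable def arcs {t : ℕ} (H : Fin t → Fin t → Prop) : Finset (Fin t × Fin t) :=
  univ.filter (fun a => H a.1 a.2)

noncomputable def aim {t n : ℕ} (H : Fin t → Fin t → Prop) (f : Fin t → Fin n) :
    Finset (Fin n × Fin n) := (arcs H).image (Prod.map f f)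

/-- injective maps -/
noncomputable def inj (t n : ℕ) : Finset (Fin t → Fin n) := univ.filter Function.Injective

theorem mem_inj {t n : ℕ} (f : Fin t → Fin n) : f ∈ inj t n ↔ Function.Injective f := by simp [inj]

/-- pairs not covered by `C` in any direction, as edges -/
noncomputable def unc {n : ℕ} (C : Finset (Fin n × Fin n)) : Finset (Sym2 (Fin n)) :=
  (univ.filter (fun x : Fin n × Fin n => x.1 ≠ x.2 ∧ x ∉ C ∧ x.swap ∉ C)).image Sym2.mk.uncurry

theorem card_unc {n : ℕ} (C : Finset (Fin n × Fin n)) :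
    (univ.filter (fun x : Fin n × Fin n => x.1 ≠ x.2 ∧ x ∉ C ∧ x.swap ∉ C)).card ≤ 2 * (unc C).card := by
  unfold unc
  refine card_le_mul_card_image _ _ fun e he => ?_
  obtain ⟨⟨a, b⟩, hab, rfl⟩ := mem_image.1 he
  calc _ ≤ ({(a, b), (b, a)} : Finset (Fin n × Fin n)).card := by
        refine card_le_card fun x hx => ?_
        have := (mem_filter.1 hx).2
        obtain ⟨c, d⟩ := x
        simp only [Function.uncurry_apply_pair, Sym2.eq_iff] at this
        simp only [mem_insert, mem_singleton, Prod.mk.injEq]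
        exact this
    _ ≤ 2 := card_le_two

theorem supersat {t n : ℕ} (H : Fin t → Fin t → Prop) (hac : RelAcyclic H)
    (C : Finset (Fin n × Fin n)) (hC : ((unc C).card : ℝ) ≤ n ^ 2 / (8 * (2 ^ t) ^ 2))
    (hn : 4 * ((2 : ℝ) ^ t) ^ 2 ≤ n) (ht : 2 ≤ t) :
    (n : ℝ) ^ t / (2 * (2 ^ t) ^ t) ≤ ((inj t n).filter (fun f => aim H f ⊆ C)).card := by
  set R := 2 ^ t with hR
  have hRt : t ≤ R := (Nat.lt_two_pow_self).le
  have hR2 : 2 ≤ R := le_trans ht hRt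
  let Z := univ.filter (fun x : Fin n × Fin n => x.1 = x.2 ∨ (x ∉ C ∧ x.swap ∉ C))
  have hRpos : (0 : ℝ) < R := by positivity
  have hRr : (R : ℝ) = 2 ^ t := by simp [hR]
  have hnpos : (0 : ℝ) < n := lt_of_lt_of_le (by positivity) hn
  rw [← hRr] at hC hn ⊢
  have hZ : (Z.card : ℝ) ≤ n ^ 2 / (2 * R ^ 2) := by
    have h1 : Z ⊆ univ.filter (fun x : Fin n × Fin n => x.1 ≠ x.2 ∧ x ∉ C ∧ x.swap ∉ C) ∪
        (univ : Finset (Fin n)).image (fun a => (a, a)) := by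
      intro x hx
      simp only [Z, mem_filter, mem_univ, true_and] at hx
      simp only [mem_union, mem_filter, mem_univ, true_and, mem_image]
      by_cases h : x.1 = x.2
      · right; exact ⟨x.1, Prod.ext rfl h⟩
      · left; exact ⟨h, hx.resolve_left h⟩
    have h2 := (card_le_card h1).trans (card_union_le _ _)
    have h3 : ((univ : Finset (Fin n)).image (fun a => (a, a))).card ≤ n := by
      simpa using card_image_le (s := (univ : Finset (Fin n))) (f := fun a => (a, a))
    have h4 := card_unc C
    have h5 : (Z.card : ℝ) ≤ 2 * (unc C).card + n := by exact_mod_cast (by omega)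
    have h6 : (n : ℝ) ≤ n ^ 2 / (4 * R ^ 2) := by
      rw [le_div_iff₀ (by positivity)]; nlinarith
    have h7 : (2 : ℝ) * (n ^ 2 / (8 * R ^ 2)) + n ^ 2 / (4 * R ^ 2) = n ^ 2 / (2 * R ^ 2) := by
      field_simp; norm_num
    linarith
  let bad := fun (i j : Fin R) => univ.filter (fun h : Fin R → Fin n => (h i, h j) ∈ Z)
  let Cop := (inj t n).filter (fun f => aim H f ⊆ C)
  have hbad : ∀ i j, i ≠ j → (bad i j).card ≤ Z.card * n ^ (R - 2) := by
    intro i j hij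
    have : bad i j ⊆ Z.biUnion (fun x => univ.filter (fun h : Fin R → Fin n =>
        ∀ k ∈ ({i, j} : Finset (Fin R)), h k ∈ ({if k = i then x.1 else x.2} : Finset (Fin n)))) := by
      intro h hh
      simp only [bad, mem_filter, mem_univ, true_and] at hh
      simp only [mem_biUnion, mem_filter, mem_univ, true_and]
      refine ⟨_, hh, ?_⟩
      intro k hk
      simp only [mem_insert, mem_singleton] at hk ⊢
      rcases hk with rfl | rfl
      · simp
      · simp [Ne.symm hij]
    refine (card_le_card this).trans (card_biUnion_le.trans ?_)
    rw [← smul_eq_mul]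
    refine sum_le_card_nsmul _ _ _ fun x _ => ?_
    rw [card_fix ({i, j} : Finset (Fin R)) (fun k => ({if k = i then x.1 else x.2} : Finset (Fin n)))]
    simp [card_pair hij]
  let good := univ.filter (fun h : Fin R → Fin n => ∀ i j, i ≠ j → (h i, h j) ∉ Z)
  have hcover : n ^ R ≤ good.card + R ^ 2 * (Z.card * n ^ (R - 2)) := by
    have h1 : (univ : Finset (Fin R → Fin n)) ⊆ good ∪
        ((univ : Finset (Fin R × Fin R)).filter (fun x => x.1 ≠ x.2)).biUnion (fun x => bad x.1 x.2) := by
      intro h _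
      by_cases hg : h ∈ good
      · exact mem_union_left _ hg
      · apply mem_union_right
        simp only [good, mem_filter, mem_univ, true_and, not_forall, not_not] at hg
        obtain ⟨i, j, hij, hz⟩ := hg
        simp only [mem_biUnion, mem_filter, mem_univ, true_and, bad]
        exact ⟨(i, j), hij, hz⟩
    have h2 := (card_le_card h1).trans (card_union_le _ _)
    rw [card_univ, Fintype.card_fun, Fintype.card_fin, Fintype.card_fin] at h2
    refine h2.trans (Nat.add_le_add_left (card_biUnion_le.trans ?_) _)
    refine (sum_le_card_nsmul _ _ (Z.card * n ^ (R - 2)) fun x hx => hbad _ _ (mem_filter.1 hx).2).trans ?_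
    rw [smul_eq_mul]
    apply Nat.mul_le_mul_right
    refine (card_filter_le _ _).trans ?_
    simp [sq]
  have hgood : good.card ≤ R ^ t * Cop.card * n ^ (R - t) := by
    have h1 : good ⊆ ((inj t R) ×ˢ Cop).biUnion (fun x => univ.filter (fun h : Fin R → Fin n =>
        ∀ a, h (x.1 a) = x.2 a)) := by
      intro h hh
      simp only [good, mem_filter, mem_univ, true_and, Z, not_or] at hh
      have hinj : Function.Injective h := fun i j hij => by
        by_contra hne; exact (hh i j hne).1 hij
      obtain ⟨g, hg, _, hgD⟩ := embed_semi H hac (fun i j => (h i, h j) ∈ C) univ (by simp [hR])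
        (fun i _ j _ hij => by
          have := (hh i j hij).2
          simp only [Prod.swap_prod_mk] at this
          tauto)
      simp only [mem_biUnion, mem_product, mem_filter, mem_univ, true_and, Cop, mem_inj]
      refine ⟨(g, h ∘ g), ⟨hg, hinj.comp hg, ?_⟩, fun a => rfl⟩
      intro x hx
      obtain ⟨⟨a, b⟩, hab, rfl⟩ := mem_image.1 hx
      exact hgD a b (by simpa [arcs] using hab)
    refine (card_le_card h1).trans (card_biUnion_le.trans ?_)
    refine (sum_le_card_nsmul _ _ (n ^ (R - t)) fun x hx => ?_).trans ?_
    · have hx1 := (mem_inj _).1 (mem_product.1 hx).1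
      have : univ.filter (fun h : Fin R → Fin n => ∀ a, h (x.1 a) = x.2 a) ⊆
          univ.filter (fun h : Fin R → Fin n => ∀ k ∈ univ.image x.1, h k ∈
            (univ.filter (fun y => ∃ a, x.1 a = k ∧ x.2 a = y))) := by
        intro h hh
        simp only [mem_filter, mem_univ, true_and, mem_image, forall_exists_index] at hh ⊢
        rintro k a rfl
        exact ⟨a, rfl, (hh a).symm⟩
      refine (card_le_card this).trans ?_
      rw [card_fix (univ.image x.1) (fun k => univ.filter (fun y => ∃ a, x.1 a = k ∧ x.2 a = y)), card_image_of_injective _ hx1]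
      have h2 : ∏ k ∈ univ.image x.1, (univ.filter (fun y => ∃ a, x.1 a = k ∧ x.2 a = y)).card ≤ 1 := by
        refine prod_le_one (fun _ _ => Nat.zero_le _) fun k hk => ?_
        rw [card_le_one]
        intro y hy z hz
        simp only [mem_filter, mem_univ, true_and] at hy hz
        obtain ⟨a, ha, rfl⟩ := hy
        obtain ⟨b, hb, rfl⟩ := hz
        rw [hx1 (ha.trans hb.symm)]
      simp only [Fintype.card_fin, card_univ]
      calc _ ≤ 1 * n ^ (R - t) := Nat.mul_le_mul_right _ h2
        _ = _ := one_mul _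
    · rw [card_product, smul_eq_mul]
      apply Nat.mul_le_mul_right
      apply Nat.mul_le_mul_right
      refine (card_filter_le _ _).trans ?_
      simp
  -- conclude
  have e1 : (n : ℝ) ^ R ≤ R ^ t * Cop.card * n ^ (R - t) + R ^ 2 * (Z.card * n ^ (R - 2)) := by
    exact_mod_cast hcover.trans (Nat.add_le_add_right hgood _)
  have e2 : (n : ℝ) ^ R = n ^ t * n ^ (R - t) := by rw [← pow_add]; congr 1; omega
  have e3 : (n : ℝ) ^ R = n ^ 2 * n ^ (R - 2) := by rw [← pow_add]; congr 1; omega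
  have e4 : (R : ℝ) ^ 2 * (Z.card * n ^ (R - 2)) ≤ n ^ R / 2 := by
    rw [e3]
    calc (R : ℝ) ^ 2 * (Z.card * n ^ (R - 2)) ≤ R ^ 2 * (n ^ 2 / (2 * R ^ 2) * n ^ (R - 2)) := by gcongr
      _ = _ := by field_simp
  have e5 : (n : ℝ) ^ t * n ^ (R - t) / 2 ≤ R ^ t * Cop.card * n ^ (R - t) := by
    rw [← e2]; linarith
  have e6 : (0 : ℝ) < n ^ (R - t) := by positivity
  rw [div_le_iff₀ (by positivity)]
  have e7 : (n : ℝ) ^ t / 2 ≤ R ^ t * Cop.card := by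
    by_contra hcon
    push Not at hcon
    nlinarith
  show (n : ℝ) ^ t ≤ Cop.card * _
  linarith

end ORam

namespace ORam
open Finset
open scoped Classical

noncomputable def wH {t : ℕ} (H : Fin t → Fin t → Prop) (n : ℕ) (e : Finset (Fin n × Fin n)) : ℝ :=
  ((inj t n).filter (fun f => aim H f = e)).card

theorem sum_wH {t : ℕ} (H : Fin t → Fin t → Prop) (n : ℕ) (p : Finset (Fin n × Fin n) → Prop)
    [DecidablePred p] [DecidablePred (fun f : Fin t → Fin n => p (aim H f))] :
    ∑ e ∈ univ.filter p, wH H n e = (((inj t n).filter (fun f => p (aim H f))).card : ℝ) := by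
  have := card_eq_sum_card_fiberwise (s := (inj t n).filter (fun f => p (aim H f)))
    (t := univ.filter p) (f := aim H) (by intro f hf; simpa using (mem_filter.1 hf).2)
  rw [this]; push_cast
  refine sum_congr rfl fun e he => ?_
  unfold wH
  congr 2
  ext f
  simp only [mem_filter, mem_univ, true_and] at he ⊢
  constructor
  · rintro ⟨h1, h2⟩; exact ⟨⟨h1, h2 ▸ he⟩, h2⟩
  · rintro ⟨⟨h1, _⟩, h2⟩; exact ⟨h1, h2⟩

theorem tot_wH {t : ℕ} (H : Fin t → Fin t → Prop) (n : ℕ) : tot (wH H n) = ((inj t n).card : ℝ) := by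
  have := sum_wH H n (fun _ => True)
  simpa [tot] using this

theorem card_inj_le (t n : ℕ) : ((inj t n).card : ℝ) ≤ n ^ t := by
  have : (inj t n).card ≤ n ^ t := by
    refine (card_filter_le _ _).trans ?_
    simp
  exact_mod_cast this

theorem card_inj_ge {t n : ℕ} (H : Fin t → Fin t → Prop) (hac : RelAcyclic H)
    (hn : 4 * ((2 : ℝ) ^ t) ^ 2 ≤ n) (ht : 2 ≤ t) :
    (n : ℝ) ^ t / (2 * (2 ^ t) ^ t) ≤ (inj t n).card := by
  have := supersat H hac (univ : Finset (Fin n × Fin n)) (by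
    have : unc (univ : Finset (Fin n × Fin n)) = ∅ := by simp [unc]
    rw [this]; simp; positivity) hn ht
  simpa using this

theorem card_aim {t n : ℕ} (H : Fin t → Fin t → Prop) {f : Fin t → Fin n}
    (hf : Function.Injective f) : (aim H f).card = (arcs H).card :=
  card_image_of_injective _ (hf.prodMap hf)

theorem deg_wH {t n : ℕ} (H : Fin t → Fin t → Prop) (P Q : ℕ) (hP : 0 < P) (hQ : 0 < Q)
    (hn : 0 < n) (ht : 2 ≤ t) (hl : 1 ≤ (arcs H).card)
    (hB : ∀ J ⊆ arcs H, ∀ A : Finset (Fin t), (∀ a ∈ J, a.1 ∈ A ∧ a.2 ∈ A) → J.Nonempty →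
      Q * J.card + 2 * P ≤ P * A.card + Q)
    (T : Finset (Fin n × Fin n)) (hT : 1 ≤ T.card) (hTl : T.card ≤ (arcs H).card) :
    deg (wH H n) T ≤ 2 ^ (arcs H).card * (2 * (arcs H).card) ^ t *
      ((n : ℝ) ^ (-((Q : ℝ) / P))) ^ (T.card - 1) * (n : ℝ) ^ (t - 2) := by
  set l := (arcs H).card with hldef
  have hs : deg (wH H n) T = (((inj t n).filter (fun f => T ⊆ aim H f)).card : ℝ) := by
    unfold deg; convert sum_wH H n (fun e => T ⊆ e)
  rw [hs]
  set q := (n : ℝ) ^ (-((Q : ℝ) / P)) with hq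
  let sp := fun {m : ℕ} (J : Finset (Fin m × Fin m)) => J.image Prod.fst ∪ J.image Prod.snd
  have hsub : (inj t n).filter (fun f => T ⊆ aim H f) ⊆
      ((arcs H).powerset.filter (fun J => J.card = T.card)).biUnion (fun J =>
        univ.filter (fun f : Fin t → Fin n => ∀ i ∈ sp J, f i ∈ sp T)) := by
    intro f hf
    obtain ⟨hf1, hf2⟩ := mem_filter.1 hf
    rw [mem_inj] at hf1
    simp only [mem_biUnion, mem_filter, mem_powerset, mem_univ, true_and]
    have him : ((arcs H).filter (fun a => Prod.map f f a ∈ T)).image (Prod.map f f) = T := by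
      ext x
      simp only [mem_image, mem_filter]
      constructor
      · rintro ⟨a, ha, rfl⟩; exact ha.2
      · intro hx
        obtain ⟨a, ha, rfl⟩ := mem_image.1 (hf2 hx)
        exact ⟨a, ⟨ha, hx⟩, rfl⟩
    refine ⟨(arcs H).filter (fun a => Prod.map f f a ∈ T), ⟨filter_subset _ _, ?_⟩, ?_⟩
    · conv_rhs => rw [← him]
      exact (card_image_of_injective _ (hf1.prodMap hf1)).symm
    · intro i hi
      simp only [sp, mem_union, mem_image, mem_filter] at hi ⊢
      rcases hi with ⟨a, ⟨_, ha⟩, rfl⟩ | ⟨a, ⟨_, ha⟩, rfl⟩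
      · left; exact ⟨_, ha, rfl⟩
      · right; exact ⟨_, ha, rfl⟩
  have hnr : (1 : ℝ) ≤ n := by exact_mod_cast hn
  have hq0 : 0 < q := by positivity
  have hone : ∀ J ∈ (arcs H).powerset.filter (fun J => J.card = T.card),
      ((univ.filter (fun f : Fin t → Fin n => ∀ i ∈ sp J, f i ∈ sp T)).card : ℝ) ≤
        (2 * l) ^ t * q ^ (T.card - 1) * (n : ℝ) ^ (t - 2) := by
    intro J hJ
    obtain ⟨hJ1, hJ2⟩ := mem_filter.1 hJ
    rw [mem_powerset] at hJ1
    rw [card_fix (sp J) (fun _ => sp T)]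
    push_cast
    have hA : (sp J).card ≤ t := by simpa using card_le_univ (sp J)
    have hVT : ((sp T).card : ℝ) ≤ 2 * l := by
      have : (sp T).card ≤ T.card + T.card :=
        (card_union_le _ _).trans (Nat.add_le_add card_image_le card_image_le)
      exact_mod_cast (by omega)
    have hl' : (1 : ℝ) ≤ 2 * l := by
      have : (1 : ℝ) ≤ l := by exact_mod_cast hl
      linarith
    have h1 : ∏ i ∈ sp J, ((sp T).card : ℝ) ≤ (2 * l) ^ t := by
      rw [prod_const]
      calc ((sp T).card : ℝ) ^ (sp J).card ≤ (2 * l) ^ (sp J).card := by gcongr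
        _ ≤ _ := pow_le_pow_right₀ hl' hA
    have hb := hB J hJ1 (sp J) (fun a ha => by
      simp only [sp, mem_union, mem_image]
      exact ⟨Or.inl ⟨a, ha, rfl⟩, Or.inr ⟨a, ha, rfl⟩⟩) (by rw [← card_pos]; omega)
    have h2 : (n : ℝ) ^ (t - (sp J).card) ≤ q ^ (T.card - 1) * (n : ℝ) ^ (t - 2) := by
      rw [hq, ← Real.rpow_natCast, ← Real.rpow_natCast, ← Real.rpow_natCast, ← Real.rpow_mul (by positivity),
        ← Real.rpow_add (by positivity)]
      apply Real.rpow_le_rpow_of_exponent_le hnr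
      rw [Nat.cast_sub hA, Nat.cast_sub ht, Nat.cast_sub hT]
      have hb' : (Q : ℝ) * T.card + 2 * P ≤ P * (sp J).card + Q := by
        rw [← hJ2]; exact_mod_cast hb
      have hP' : (0 : ℝ) < P := by exact_mod_cast hP
      have : (Q : ℝ) / P * (T.card - 1) ≤ (sp J).card - 2 := by
        rw [div_mul_eq_mul_div, div_le_iff₀ hP']; linarith
      push_cast; linarith
    rw [Fintype.card_fin, Fintype.card_fin, mul_assoc]
    exact mul_le_mul h1 h2 (by positivity) (by positivity)
  calc _ ≤ ((((arcs H).powerset.filter (fun J => J.card = T.card)).biUnion (fun J =>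
        univ.filter (fun f : Fin t → Fin n => ∀ i ∈ sp J, f i ∈ sp T))).card : ℝ) := by
          exact_mod_cast card_le_card hsub
    _ ≤ ∑ J ∈ (arcs H).powerset.filter (fun J => J.card = T.card),
      ((univ.filter (fun f : Fin t → Fin n => ∀ i ∈ sp J, f i ∈ sp T)).card : ℝ) := by
        exact_mod_cast card_biUnion_le
    _ ≤ ((arcs H).powerset.filter (fun J => J.card = T.card)).card •
        ((2 * l) ^ t * q ^ (T.card - 1) * (n : ℝ) ^ (t - 2)) := sum_le_card_nsmul _ _ _ hone
    _ ≤ 2 ^ l * ((2 * l) ^ t * q ^ (T.card - 1) * (n : ℝ) ^ (t - 2)) := by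
        rw [nsmul_eq_mul]
        refine mul_le_mul_of_nonneg_right ?_ (by positivity)
        have : ((arcs H).powerset.filter (fun J => J.card = T.card)).card ≤ 2 ^ l := by
          refine (card_filter_le _ _).trans ?_
          rw [card_powerset]
        exact_mod_cast this
    _ = _ := by ring

/-- containers for H-free orientations -/
theorem containers {t : ℕ} (H : Fin t → Fin t → Prop) (hac : RelAcyclic H) (P Q : ℕ) (hQ : 0 < Q)
    (hQP : Q ≤ P) (ht : 2 ≤ t) (hl : 1 ≤ (arcs H).card)
    (hB : ∀ J ⊆ arcs H, ∀ A : Finset (Fin t), (∀ a ∈ J, a.1 ∈ A ∧ a.2 ∈ A) → J.Nonempty →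
      Q * J.card + 2 * P ≤ P * A.card + Q) :
    ∃ B > (0 : ℝ), ∃ δ > (0 : ℝ), ∀ n : ℕ, 4 * ((2 : ℝ) ^ t) ^ 2 ≤ n →
      ∃ C : Finset (Fin n × Fin n) → Finset (Fin n × Fin n), ∀ I,
        (∀ f ∈ inj t n, ¬ aim H f ⊆ I) →
        ∃ S ⊆ I, (S.card : ℝ) ≤ B * ((n : ℝ) ^ (-((Q : ℝ) / P)) * n ^ 2) ∧ I ⊆ C S ∧
          δ * n ^ 2 ≤ (unc (C S)).card := by
  set l := (arcs H).card with hldef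
  set c0 : ℝ := 1 / (2 * (2 ^ t) ^ t) with hc0
  have hc0p : 0 < c0 := by positivity
  have hl' : (1 : ℝ) ≤ l := by exact_mod_cast hl
  have hP : 0 < P := by omega
  obtain ⟨B, hBp, hit⟩ := iter l hl (2 ^ l * (2 * l) ^ t / c0) (c0 / 2) (by positivity) (by positivity)
  refine ⟨2 * B, by positivity, 1 / (8 * (2 ^ t) ^ 2), by positivity, fun n hn => ?_⟩
  have hnp : (0 : ℝ) < n := lt_of_lt_of_le (by positivity) hn
  have hn0 : 0 < n := by exact_mod_cast hnp
  have hn1 : (1 : ℝ) ≤ n := by exact_mod_cast hn0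
  set q := (n : ℝ) ^ (-((Q : ℝ) / P)) with hq
  have hq0 : 0 < q := by positivity
  have hq1 : q ≤ 1 := Real.rpow_le_one_of_one_le_of_nonpos hn1 (by
    rw [neg_nonpos]; positivity)
  have hN : (Fintype.card (Fin n × Fin n) : ℝ) = n ^ 2 := by simp [sq]
  have htot : c0 * n ^ t ≤ tot (wH H n) := by
    rw [tot_wH]; have := card_inj_ge H hac hn ht
    rw [hc0, one_div_mul_eq_div]; exact this
  have htot0 : 0 < tot (wH H n) := lt_of_lt_of_le (by positivity) htot
  obtain ⟨C, hC⟩ := hit (Fin n × Fin n) (wH H n) q (fun e => by unfold wH; positivity)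
    (fun e he => by
      unfold wH at he
      have : ((inj t n).filter (fun f => aim H f = e)).card ≠ 0 := by exact_mod_cast he
      obtain ⟨f, hf⟩ := card_pos.1 (Nat.pos_of_ne_zero this)
      obtain ⟨h1, h2⟩ := mem_filter.1 hf
      rw [← h2, card_aim H ((mem_inj _).1 h1)]) hq0 hq1 htot0 (by
      intro T h1 h2
      refine (deg_wH H P Q hP hQ hn0 ht hl hB T h1 h2).trans ?_
      rw [hN]
      have e1 : c0 * (n : ℝ) ^ (t - 2) ≤ tot (wH H n) / n ^ 2 := by
        rw [le_div_iff₀ (by positivity)]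
        refine le_trans (le_of_eq ?_) htot
        rw [mul_assoc, ← pow_add]; congr 2; omega
      calc _ = 2 ^ l * (2 * l) ^ t / c0 * q ^ (T.card - 1) * (c0 * (n : ℝ) ^ (t - 2)) := by
            rw [hldef, hq]; field_simp
        _ ≤ _ := by
            refine mul_le_mul_of_nonneg_left e1 (by positivity))
  refine ⟨C, fun I hI => ?_⟩
  obtain ⟨h1, h2, S, hS, hSc, hSU⟩ := hC I (fun e he => by
    unfold wH
    have : (inj t n).filter (fun f => aim H f = e) = ∅ := by
      refine filter_eq_empty_iff.2 fun f hf h => hI f hf (h ▸ he)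
    simp [this])
  have hCS := hSU S (Subset.refl _) hS
  refine ⟨S, hS, ?_, hCS ▸ h1, ?_⟩
  · refine hSc.trans ?_
    rw [hN]
    have : 1 ≤ q * n ^ 2 := by
      rw [hq, ← Real.rpow_natCast, ← Real.rpow_add hnp]
      apply Real.one_le_rpow hn1
      have : (Q : ℝ) / P ≤ 1 := by
        rw [div_le_one (by exact_mod_cast hP)]; exact_mod_cast hQP
      push_cast; linarith
    nlinarith
  · by_contra hcon
    push Not at hcon
    rw [hCS] at hcon
    have h3 := supersat H hac (C I) (by
      refine hcon.le.trans (le_of_eq ?_)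
      ring) hn ht
    have hs : ((((inj t n).filter (fun f => aim H f ⊆ C I)).card : ℕ) : ℝ) ≤ c0 / 2 * tot (wH H n) := by
      convert h2; symm; convert sum_wH H n (fun e => e ⊆ C I)
    have h4 : tot (wH H n) ≤ n ^ t := by rw [tot_wH]; exact card_inj_le t n
    have h5 : c0 * n ^ t ≤ c0 / 2 * tot (wH H n) := by
      refine le_trans ?_ hs
      rw [hc0, one_div_mul_eq_div]; exact h3
    have h6 : (0 : ℝ) < n ^ t := by positivity
    nlinarith

theorem unionbd {t : ℕ} (H : Fin t → Fin t → Prop) (n : ℕ) (p s δ x : ℝ) (h0 : 0 ≤ p) (h1 : p ≤ 1)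
    (hx : 0 < x) (hx1 : x ≤ 1) 
    (C : Finset (Fin n × Fin n) → Finset (Fin n × Fin n)) (hC : ∀ I,
        (∀ f ∈ inj t n, ¬ aim H f ⊆ I) →
        ∃ S ⊆ I, (S.card : ℝ) ≤ s ∧ I ⊆ C S ∧ δ * n ^ 2 ≤ (unc (C S)).card) :
    probGnp n p (fun G => ¬ Arrows G H) ≤
      Real.exp (s * Real.log (1 / x) + x * p * n ^ 2 - p * (δ * n ^ 2)) := by
  let im : Finset (Fin n × Fin n) → Finset (Sym2 (Fin n)) := fun S => S.image Sym2.mk.uncurry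
  let 𝒮 := (univ : Finset (Finset (Fin n × Fin n))).filter (fun S => (S.card : ℝ) ≤ s ∧
    δ * n ^ 2 ≤ (unc (C S)).card ∧ (im S).card = S.card)
  have hsub : ∀ G : SimpleGraph (Fin n), ¬ Arrows G H →
      ∃ S ∈ 𝒮, im S ⊆ eF G ∧ Disjoint (unc (C S)) (eF G) := by
    intro G hG
    unfold Arrows at hG
    push Not at hG
    obtain ⟨o, ho, hno⟩ := hG
    let I := univ.filter (fun a : Fin n × Fin n => o a.1 a.2)
    obtain ⟨S, hS, hSs, hIC, hunc⟩ := hC I (by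
      intro f hf hsub
      refine hno ⟨f, (mem_inj f).1 hf, fun a b hab => ?_⟩
      have : (f a, f b) ∈ I := hsub (mem_image.2 ⟨(a, b), by simpa [arcs] using hab, rfl⟩)
      simpa [I] using this)
    have hIo : ∀ a ∈ S, o a.1 a.2 := fun a ha => by simpa [I] using hS ha
    refine ⟨S, ?_, ?_, ?_⟩
    · simp only [𝒮, mem_filter, mem_univ, true_and]
      refine ⟨hSs, hunc, ?_⟩
      apply card_image_of_injOn
      rintro ⟨a, b⟩ ha ⟨c, d⟩ hc hac
      simp only [Function.uncurry_apply_pair, Sym2.eq_iff] at hac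
      rcases hac with ⟨rfl, rfl⟩ | ⟨rfl, rfl⟩
      · rfl
      · have h3 := hIo _ ha
        have h4 := hIo _ hc
        exact absurd h4 ((ho.2 _ _ (ho.1 _ _ h3)).1 h3)
    · intro e he
      obtain ⟨⟨a, b⟩, ha, rfl⟩ := mem_image.1 he
      rw [mem_eF]
      exact ho.1 _ _ (hIo _ ha)
    · rw [Finset.disjoint_left]
      intro e he heG
      obtain ⟨⟨a, b⟩, ha, rfl⟩ := mem_image.1 he
      simp only [mem_filter, mem_univ, true_and] at ha
      rw [mem_eF] at heG
      have hadj : G.Adj a b := heG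
      by_cases hab : o a b
      · exact ha.2.1 (hIC (by simpa [I] using hab))
      · have : o b a := by
          have := ho.2 _ _ hadj; tauto
        exact ha.2.2 (hIC (by simpa [I] using this))
  have huncd : ∀ S, unc (C S) ⊆ eF (⊤ : SimpleGraph (Fin n)) := by
    intro S e he
    obtain ⟨⟨a, b⟩, ha, rfl⟩ := mem_image.1 he
    simp only [mem_filter, mem_univ, true_and] at ha
    rw [mem_eF_top]; simpa using ha.1
  have hterm : ∀ S ∈ 𝒮, probGnp n p (fun G => im S ⊆ eF G ∧ Disjoint (unc (C S)) (eF G)) ≤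
      Real.exp (s * Real.log (1 / x)) * (x * p) ^ S.card * Real.exp (- (p * (δ * n ^ 2))) := by
    intro S hS
    simp only [𝒮, mem_filter, mem_univ, true_and] at hS
    refine (pr_cyl_le h0 h1 _ _ (huncd S)).trans ?_
    rw [hS.2.2]
    have e1 : p ^ S.card ≤ Real.exp (s * Real.log (1 / x)) * (x * p) ^ S.card := by
      have : Real.exp (S.card * Real.log (1 / x)) ≤ Real.exp (s * Real.log (1 / x)) := by
        apply Real.exp_le_exp.2
        apply mul_le_mul_of_nonneg_right hS.1
        apply Real.log_nonneg
        rw [le_div_iff₀ hx]; linarith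
      calc p ^ S.card = (1 / x) ^ S.card * (x * p) ^ S.card := by
            rw [← mul_pow]; congr 1; field_simp
        _ = Real.exp (S.card * Real.log (1 / x)) * (x * p) ^ S.card := by
            rw [Real.exp_nat_mul, Real.exp_log (by positivity)]
        _ ≤ _ := mul_le_mul_of_nonneg_right this (by positivity)
    have e2 : (1 - p) ^ (unc (C S)).card ≤ Real.exp (- (p * (δ * n ^ 2))) := by
      calc (1 - p) ^ (unc (C S)).card ≤ (Real.exp (-p)) ^ (unc (C S)).card := by
            apply pow_le_pow_left₀ (by linarith)
            have := Real.add_one_le_exp (-p); linarith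
        _ = Real.exp ((unc (C S)).card * (-p)) := by rw [Real.exp_nat_mul]
        _ ≤ _ := by
            apply Real.exp_le_exp.2
            have := mul_le_mul_of_nonneg_left hS.2.1 h0
            linarith
    exact mul_le_mul e1 e2 (pow_nonneg (by linarith) _) (by positivity)
  calc probGnp n p (fun G => ¬ Arrows G H)
      ≤ probGnp n p (fun G => ∃ S ∈ 𝒮, im S ⊆ eF G ∧ Disjoint (unc (C S)) (eF G)) := pr_mono h0 h1 hsub
    _ ≤ ∑ S ∈ 𝒮, probGnp n p (fun G => im S ⊆ eF G ∧ Disjoint (unc (C S)) (eF G)) :=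
        pr_union h0 h1 _ _
    _ ≤ ∑ S ∈ 𝒮, Real.exp (s * Real.log (1 / x)) * (x * p) ^ S.card * Real.exp (- (p * (δ * n ^ 2))) :=
        sum_le_sum hterm
    _ ≤ ∑ S ∈ (univ : Finset (Fin n × Fin n)).powerset,
        Real.exp (s * Real.log (1 / x)) * (x * p) ^ S.card * Real.exp (- (p * (δ * n ^ 2))) := by
        refine sum_le_sum_of_subset_of_nonneg (fun S _ => by simp) fun S _ _ => by positivity
    _ = Real.exp (s * Real.log (1 / x)) * (1 + x * p) ^ (n ^ 2) * Real.exp (- (p * (δ * n ^ 2))) := by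
        rw [← sum_mul, ← mul_sum]
        congr 2
        have := Finset.sum_pow_mul_eq_add_pow (x * p) 1 (univ : Finset (Fin n × Fin n))
        simp only [one_pow, mul_one] at this
        rw [this, add_comm]; simp [sq]
    _ ≤ Real.exp (s * Real.log (1 / x)) * Real.exp (x * p * n ^ 2) * Real.exp (- (p * (δ * n ^ 2))) := by
        refine mul_le_mul_of_nonneg_right (mul_le_mul_of_nonneg_left ?_ (by positivity)) (by positivity)
        calc (1 + x * p) ^ (n ^ 2) ≤ (Real.exp (x * p)) ^ (n ^ 2) := by
              apply pow_le_pow_left₀ (by positivity)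
              have := Real.add_one_le_exp (x * p); linarith
          _ = _ := by rw [← Real.exp_nat_mul]; push_cast; ring_nf
    _ = _ := by rw [← Real.exp_add, ← Real.exp_add]; ring_nf

open Filter in
theorem one_stmt {t : ℕ} (H : Fin t → Fin t → Prop) (hac : RelAcyclic H) (P Q : ℕ) (hQ : 0 < Q)
    (hQP : Q ≤ P) (ht : 2 ≤ t) (hl : 1 ≤ (arcs H).card)
    (hB : ∀ J ⊆ arcs H, ∀ A : Finset (Fin t), (∀ a ∈ J, a.1 ∈ A ∧ a.2 ∈ A) → J.Nonempty →
      Q * J.card + 2 * P ≤ P * A.card + Q)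
    (p : ℕ → ℝ) (hp : ∀ n, 0 ≤ p n ∧ p n ≤ 1)
    (hω : Tendsto (fun n => p n * (n : ℝ) ^ ((Q : ℝ) / P)) atTop atTop) :
    Tendsto (fun n => probGnp n (p n) (fun G => Arrows G H)) atTop (nhds 1) := by
  obtain ⟨B, hBp, δ, hδ, hcont⟩ := containers H hac P Q hQ hQP ht hl hB
  set x := min 1 (δ / 4) with hx
  have hx0 : 0 < x := by positivity
  have hx1 : x ≤ 1 := min_le_left _ _
  have hxδ : x ≤ δ / 4 := min_le_right _ _
  have hlog : 0 ≤ Real.log (1 / x) := by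
    apply Real.log_nonneg; rw [le_div_iff₀ hx0]; linarith
  have hP : (0 : ℝ) < P := by exact_mod_cast (by omega)
  have key : Tendsto (fun n => probGnp n (p n) (fun G => ¬ Arrows G H)) atTop (nhds 0) := by
    have hlim : Tendsto (fun n => Real.exp (-(δ / 4 * (p n * (n : ℝ) ^ ((Q : ℝ) / P))))) atTop (nhds 0) := by
      apply Real.tendsto_exp_neg_atTop_nhds_zero.comp
      exact hω.const_mul_atTop (by positivity)
    refine squeeze_zero' (Eventually.of_forall fun n => pr_nonneg (hp n).1 (hp n).2 _) ?_ hlim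
    filter_upwards [eventually_ge_atTop ⌈4 * ((2 : ℝ) ^ t) ^ 2⌉₊,
      hω.eventually_ge_atTop (2 * B * Real.log (1 / x) / δ + 1)] with n hn hωn
    have hn' : 4 * ((2 : ℝ) ^ t) ^ 2 ≤ n := (Nat.le_ceil _).trans (by exact_mod_cast hn)
    have hnp : (0 : ℝ) < n := lt_of_lt_of_le (by positivity) hn'
    have hn1 : (1 : ℝ) ≤ n := by exact_mod_cast (show 0 < n by exact_mod_cast hnp)
    obtain ⟨C, hC⟩ := hcont n hn'
    refine (unionbd H n (p n) _ δ x (hp n).1 (hp n).2 hx0 hx1 C hC).trans ?_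
    apply Real.exp_le_exp.2
    set ω := p n * (n : ℝ) ^ ((Q : ℝ) / P) with hωdef
    have hppos : 0 < ω := lt_of_lt_of_le (by positivity) hωn
    have hpn : 0 ≤ p n := (hp n).1
    have e1 : (n : ℝ) ^ (-((Q : ℝ) / P)) * n ^ 2 * ω = p n * n ^ 2 := by
      rw [hωdef]
      have : (n : ℝ) ^ (-((Q : ℝ) / P)) * (n : ℝ) ^ ((Q : ℝ) / P) = 1 := by
        rw [← Real.rpow_add hnp]; simp
      calc _ = ((n : ℝ) ^ (-((Q : ℝ) / P)) * (n : ℝ) ^ ((Q : ℝ) / P)) * (p n * n ^ 2) := by ring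
        _ = _ := by rw [this, one_mul]
    have e2 : ω ≤ p n * n ^ 2 := by
      rw [hωdef]
      refine mul_le_mul_of_nonneg_left ?_ hpn
      rw [← Real.rpow_natCast]
      apply Real.rpow_le_rpow_of_exponent_le hn1
      rw [div_le_iff₀ hP]
      have : (Q : ℝ) ≤ P := by exact_mod_cast hQP
      push_cast; linarith
    set y := (n : ℝ) ^ (-((Q : ℝ) / P)) * n ^ 2 with hy
    have hy0 : 0 ≤ y := by positivity
    have e3 : B * y * Real.log (1 / x) ≤ δ / 2 * (p n * n ^ 2) := by
      rw [← e1]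
      have : 2 * B * Real.log (1 / x) ≤ δ * ω := by
        have : 2 * B * Real.log (1 / x) / δ ≤ ω := by linarith
        rw [div_le_iff₀ hδ] at this; linarith
      nlinarith
    have e4 : x * p n * n ^ 2 ≤ δ / 4 * (p n * n ^ 2) := by
      rw [mul_assoc]; exact mul_le_mul_of_nonneg_right hxδ (by positivity)
    nlinarith
  have := key.const_sub 1
  simp only [sub_zero] at this
  refine this.congr fun n => (pr_compl n (p n) _).symm

end ORam

namespace ORam
open Finset
open scoped Classical

/-- minimal arrowing graph -/
def MinArr {V β : Type} (G : SimpleGraph V) (H : β → β → Prop) : Prop :=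
  Arrows G H ∧ ∀ G' < G, ¬ Arrows G' H

theorem exists_min {V β : Type} [Finite V] (G : SimpleGraph V) (H : β → β → Prop) (h : Arrows G H) :
    ∃ G' ≤ G, MinArr G' H := by
  obtain ⟨G', hle, hmin⟩ := exists_minimal_le_of_wellFoundedLT (fun G : SimpleGraph V => Arrows G H) G h
  exact ⟨G', hle, hmin.prop, fun G'' hlt harr => hlt.not_ge (hmin.le_of_le harr hlt.le)⟩

/-- `f` is a copy of the underlying graph of `H` inside `G` -/
def UCopy {V β : Type} (G : SimpleGraph V) (H : β → β → Prop) (f : β → V) : Prop :=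
  Function.Injective f ∧ ∀ a b, H a b → G.Adj (f a) (f b)

theorem ext_tool {V β : Type} {G : SimpleGraph V} {H : β → β → Prop} (hm : MinArr G H)
    (R : Set (Sym2 V)) (hR : ∃ e ∈ R, e ∈ G.edgeSet) :
    ∃ o1 : V → V → Prop, IsOrientation (G.deleteEdges R) o1 ∧ ¬ HasCopy o1 H ∧
      ∀ c : V → V → Prop, (∀ u v, G.Adj u v → s(u, v) ∈ R → (c u v ↔ ¬ c v u)) →
        ∃ f : β → V, UCopy G H f ∧
          (∀ a b, H a b → s(f a, f b) ∈ R → c (f a) (f b)) ∧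
          (∀ a b, H a b → s(f a, f b) ∉ R → o1 (f a) (f b)) ∧
          ∃ a b, H a b ∧ s(f a, f b) ∈ R := by
  have hlt : G.deleteEdges R < G := by
    refine lt_of_le_of_ne (G.deleteEdges_le R) fun h => ?_
    obtain ⟨e, he, heG⟩ := hR
    rw [← h, SimpleGraph.edgeSet_deleteEdges] at heG
    exact heG.2 he
  have := hm.2 _ hlt
  unfold Arrows at this
  push Not at this
  obtain ⟨o1, ho1, hno⟩ := this
  refine ⟨o1, ho1, hno, fun c hc => ?_⟩
  obtain ⟨f, hf, hfc⟩ := hm.1 (fun u v => if s(u, v) ∈ R then G.Adj u v ∧ c u v else o1 u v) (by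
    constructor
    · intro u v huv
      split_ifs at huv with h
      · exact huv.1
      · exact G.deleteEdges_le R (ho1.1 _ _ huv)
    · intro u v huv
      have hs : s(v, u) = s(u, v) := Sym2.eq_swap
      beta_reduce
      rw [hs]
      split_ifs with h
      · have := hc u v huv h
        simp only [huv, huv.symm, true_and]; exact this
      · exact ho1.2 u v (by rw [SimpleGraph.deleteEdges_adj]; exact ⟨huv, h⟩))
  refine ⟨f, ⟨hf, fun a b hab => ?_⟩, fun a b hab h => ?_, fun a b hab h => ?_, ?_⟩
  · have := hfc a b hab; beta_reduce at this
    split_ifs at this with h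
    · exact this.1
    · exact G.deleteEdges_le R (ho1.1 _ _ this)
  · have := hfc a b hab; beta_reduce at this
    rw [if_pos h] at this; exact this.2
  · have := hfc a b hab; beta_reduce at this
    rw [if_neg h] at this; exact this
  · by_contra hcon
    push Not at hcon
    refine hno ⟨f, hf, fun a b hab => ?_⟩
    have := hfc a b hab; beta_reduce at this
    rw [if_neg (hcon a b hab)] at this; exact this

theorem separation {V β : Type} {G : SimpleGraph V} {H : β → β → Prop} (hm : MinArr G H)
    (R : Set (Sym2 V)) (hR : ∃ e ∈ R, e ∈ G.edgeSet) (hR' : ∃ e ∉ R, e ∈ G.edgeSet)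
    (hsep : ∀ f, UCopy G H f → ∀ a b, H a b → s(f a, f b) ∈ R → ∀ a' b', H a' b' → s(f a', f b') ∈ R) :
    False := by
  obtain ⟨o1, ho1, hno1, h1⟩ := ext_tool hm R hR
  obtain ⟨o2, ho2, hno2, h2⟩ := ext_tool hm Rᶜ hR'
  obtain ⟨f, hf, hf1, hf2, a, b, hab, habR⟩ := h1 o2 (fun u v huv hR =>
    ho2.2 u v (by rw [SimpleGraph.deleteEdges_adj]; exact ⟨huv, fun h => h hR⟩))
  exact hno2 ⟨f, hf.1, fun a' b' hab' => hf1 _ _ hab' (hsep f hf a b hab habR a' b' hab')⟩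

noncomputable def eS {n : ℕ} (U : Finset (Fin n)) : Finset (Sym2 (Fin n)) :=
  (eF (⊤ : SimpleGraph (Fin n))).filter (fun e => ∀ x ∈ e, x ∈ U)

theorem mk_mem_eS {n : ℕ} (U : Finset (Fin n)) (a b : Fin n) :
    s(a, b) ∈ eS U ↔ a ≠ b ∧ a ∈ U ∧ b ∈ U := by
  simp [eS, mem_eF_top]

theorem card_eS {n : ℕ} (U : Finset (Fin n)) : (eS U).card = U.card.choose 2 := by
  rw [← Sym2.card_image_offDiag]
  congr 1
  ext e
  induction e with
  | _ a b =>
  rw [mk_mem_eS]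
  simp only [mem_image, mem_offDiag, Prod.exists]
  constructor
  · rintro ⟨h1, h2, h3⟩; exact ⟨a, b, ⟨h2, h3, h1⟩, rfl⟩
  · rintro ⟨c, d, ⟨h1, h2, h3⟩, h⟩
    have h : s(c, d) = s(a, b) := h
    rw [Sym2.eq_iff] at h
    rcases h with ⟨rfl, rfl⟩ | ⟨rfl, rfl⟩
    · exact ⟨h3, h1, h2⟩
    · exact ⟨Ne.symm h3, h2, h1⟩

theorem eS_inter {n : ℕ} (U U' : Finset (Fin n)) : eS U ∩ eS U' = eS (U ∩ U') := by
  ext e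
  induction e with
  | _ a b =>
  simp only [mem_inter, mk_mem_eS]; tauto

theorem eS_sub_top {n : ℕ} (U : Finset (Fin n)) : eS U ⊆ eF (⊤ : SimpleGraph (Fin n)) :=
  filter_subset _ _

theorem eS_mono {n : ℕ} {U U' : Finset (Fin n)} (h : U ⊆ U') : eS U ⊆ eS U' := by
  intro e he; simp only [eS, mem_filter] at he ⊢; exact ⟨he.1, fun x hx => h (he.2 x hx)⟩

/-- first moment -/
theorem first_moment {n : ℕ} {p : ℝ} (h0 : 0 ≤ p) (h1 : p ≤ 1) (v e : ℕ) :
    probGnp n p (fun G => ∃ W : Finset (Fin n), W.card = v ∧ e ≤ (eF G ∩ eS W).card) ≤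
      2 ^ (v.choose 2) * (n : ℝ) ^ v * p ^ e := by
  calc _ ≤ probGnp n p (fun G => ∃ x ∈ (powersetCard v univ).sigma (fun W : Finset (Fin n) =>
          powersetCard e (eS W)), x.2 ⊆ eF G) := by
        apply pr_mono h0 h1
        rintro G ⟨W, hW, he⟩
        obtain ⟨S, hS, hSc⟩ := exists_subset_card_eq he
        refine ⟨⟨W, S⟩, ?_, hS.trans inter_subset_left⟩
        simp only [mem_sigma, mem_powersetCard]
        exact ⟨⟨subset_univ _, hW⟩, hS.trans inter_subset_right, hSc⟩
    _ ≤ ∑ x ∈ (powersetCard v univ).sigma (fun W : Finset (Fin n) =>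
          powersetCard e (eS W)), probGnp n p (fun G => x.2 ⊆ eF G) := pr_union h0 h1 _ _
    _ ≤ ∑ x ∈ (powersetCard v univ).sigma (fun W : Finset (Fin n) =>
          powersetCard e (eS W)), p ^ e := by
        refine sum_le_sum fun x hx => ?_
        simp only [mem_sigma, mem_powersetCard] at hx
        rw [← hx.2.2]; exact pr_sub_le h0 _
    _ ≤ _ := by
        rw [sum_const, nsmul_eq_mul]
        refine mul_le_mul_of_nonneg_right ?_ (by positivity)
        have : ((powersetCard v univ).sigma (fun W : Finset (Fin n) => powersetCard e (eS W))).card ≤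
            2 ^ (v.choose 2) * n ^ v := by
          rw [card_sigma]
          calc _ ≤ (powersetCard v (univ : Finset (Fin n))).card • 2 ^ (v.choose 2) := by
                refine sum_le_card_nsmul _ _ _ fun W hW => ?_
                refine (card_le_card (fun x hx => mem_powerset.2 (mem_powersetCard.1 hx).1)).trans ?_
                rw [card_powerset, card_eS, (mem_powersetCard.1 hW).2]
            _ ≤ _ := by
                rw [card_powersetCard, smul_eq_mul, mul_comm, card_univ, Fintype.card_fin]
                exact Nat.mul_le_mul_left _ (Nat.choose_le_pow n v)
        exact_mod_cast this

/-- structure of acyclic orientations of complete graphs -/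
theorem rank_complete {t : ℕ} {H : Fin t → Fin t → Prop} (hac : RelAcyclic H)
    (hor : IsOrientation (⊤ : SimpleGraph (Fin t)) H) :
    ∃ r : Fin t ≃ Fin t, ∀ a b, H a b ↔ r a < r b := by
  obtain ⟨r, hr, hr'⟩ := exists_rank H hac
  refine ⟨Equiv.ofBijective r (Finite.injective_iff_bijective.1 hr), fun a b => ⟨hr' a b, fun h => ?_⟩⟩
  have hne : a ≠ b := by rintro rfl; exact lt_irrefl _ h
  by_contra hab
  have h2 : H b a := by
    have := hor.2 a b (by simpa using hne); tauto
  exact absurd (hr' b a h2) (not_lt.2 (le_of_lt h))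

theorem degree_sum {n : ℕ} (G : SimpleGraph (Fin n)) : ∑ v, G.degree v = 2 * (eF G).card := by
  rw [G.sum_degrees_eq_twice_card_edges]
  congr 2
  ext e; simp [mem_eF]

end ORam

namespace ORam
open Finset
open scoped Classical

theorem ucopy_complete {V : Type} {t : ℕ} {G : SimpleGraph V} {H : Fin t → Fin t → Prop}
    (hor : IsOrientation (⊤ : SimpleGraph (Fin t)) H) {f : Fin t → V} (hf : UCopy G H f)
    (i j : Fin t) (h : i ≠ j) : G.Adj (f i) (f j) := by
  by_cases hij : H i j
  · exact hf.2 i j hij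
  · have : H j i := by have := hor.2 i j (by simpa using h); tauto
    exact (hf.2 j i this).symm

theorem deg3 {n : ℕ} {G : SimpleGraph (Fin n)} {H : Fin 3 → Fin 3 → Prop} (hac : RelAcyclic H)
    (hor : IsOrientation (⊤ : SimpleGraph (Fin 3)) H) (hm : MinArr G H) (v w : Fin n) (hvw : G.Adj v w) :
    3 ≤ G.degree v := by
  by_contra hdeg
  obtain ⟨r, hr⟩ := rank_complete hac hor
  obtain ⟨b, hb⟩ : ∃ b, ∀ u, G.Adj v u → u = w ∨ u = b := by
    have h1 : ((G.neighborFinset v).erase w).card ≤ 1 := by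
      rw [card_erase_of_mem (by simpa using hvw), SimpleGraph.card_neighborFinset_eq_degree]; omega
    haveI : Nonempty (Fin n) := ⟨v⟩
    obtain ⟨b, hb⟩ := card_le_one_iff_subset_singleton.1 h1
    refine ⟨b, fun u hu => ?_⟩
    by_cases h : u = w
    · exact Or.inl h
    · right; simpa using hb (mem_erase.2 ⟨h, by simpa using hu⟩)
  obtain ⟨o1, ho1, hno, hext⟩ := ext_tool hm {e | v ∈ e} ⟨s(v, w), by simp, hvw⟩
  have hcopy : ∀ c : Fin n → Fin n → Prop, (∀ u v', G.Adj u v' → (v = u ∨ v = v') → (c u v' ↔ ¬ c v' u)) →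
      ∃ X Y Z, G.Adj X Y ∧ G.Adj X Z ∧ G.Adj Y Z ∧ ((v = X ∧ c X Y ∧ c X Z ∧ o1 Y Z) ∨
        (v = Y ∧ c X Y ∧ o1 X Z ∧ c Y Z) ∨ (v = Z ∧ o1 X Y ∧ c X Z ∧ c Y Z)) := by
    intro c hc
    obtain ⟨f, hf, h1, h2, a, b, hab, habv⟩ := hext c (by simpa using hc)
    have h01 : H (r.symm 0) (r.symm 1) := by rw [hr]; simp
    have h02 : H (r.symm 0) (r.symm 2) := by rw [hr]; simp
    have h12 : H (r.symm 1) (r.symm 2) := by rw [hr]; simp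
    have a01 := hf.2 _ _ h01
    have a02 := hf.2 _ _ h02
    have a12 := hf.2 _ _ h12
    have hv : ∃ i, v = f i := by
      simp only [Set.mem_setOf_eq, Sym2.mem_iff] at habv
      rcases habv with h | h
      · exact ⟨_, h⟩
      · exact ⟨_, h⟩
    obtain ⟨i, hi⟩ := hv
    obtain ⟨k, rfl⟩ := r.symm.surjective i
    refine ⟨_, _, _, a01, a02, a12, ?_⟩
    have n01 := a01.ne
    have n02 := a02.ne
    have n12 := a12.ne
    simp only [Set.mem_setOf_eq, Sym2.mem_iff] at h1 h2
    fin_cases k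
    · left
      simp only [Fin.zero_eta] at hi
      exact ⟨hi, h1 _ _ h01 (Or.inl hi), h1 _ _ h02 (Or.inl hi), h2 _ _ h12 (by rw [hi]; tauto)⟩
    · right; left
      simp only [Fin.mk_one] at hi
      exact ⟨hi, h1 _ _ h01 (Or.inr hi), h2 _ _ h02 (by rw [hi]; simp only [not_or]; exact ⟨n01.symm, n12⟩),
        h1 _ _ h12 (Or.inl hi)⟩
    · right; right
      simp only [Fin.reduceFinMk] at hi
      exact ⟨hi, h2 _ _ h01 (by rw [hi]; simp only [not_or]; exact ⟨n02.symm, n12.symm⟩),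
        h1 _ _ h02 (Or.inr hi), h1 _ _ h12 (Or.inr hi)⟩
  have hoo : ∀ x y, o1 x y → ¬ o1 y x := fun x y h => (ho1.2 x y (ho1.1 x y h)).1 h
  have hcase : ∀ a b, (∀ u, G.Adj v u → u = a ∨ u = b) → G.Adj a b → o1 a b → False := by
    intro a b hab hadj ho
    have hne := hadj.ne
    obtain ⟨X, Y, Z, aXY, aXZ, aYZ, h⟩ := hcopy (fun x y => y = a ∨ x = b) (by
      intro x y hxy hv
      have := hxy.ne
      rcases hv with rfl | rfl
      · have := hab y hxy
        grind
      · have := hab x hxy.symm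
        grind)
    have n1 := aXY.ne
    have n2 := aXZ.ne
    have n3 := aYZ.ne
    have := hoo a b ho
    rcases h with ⟨rfl, h1, h2, h3⟩ | ⟨rfl, h1, h2, h3⟩ | ⟨rfl, h1, h2, h3⟩
    · have := hab _ aXY; have := hab _ aXZ; grind
    · have := hab _ aXY.symm; have := hab _ aYZ; grind
    · have := hab _ aXZ.symm; have := hab _ aYZ.symm; grind
  by_cases hadj : G.Adj w b
  · have hv1 : v ≠ w := hvw.ne
    by_cases hvb : v = b
    · subst hvb
      obtain ⟨X, Y, Z, aXY, aXZ, aYZ, h⟩ := hcopy (fun x y => x < y) (by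
        intro x y hxy _; have := hxy.ne; simp only [not_lt]; constructor
        · exact le_of_lt
        · intro h; exact lt_of_le_of_ne h this)
      have n1 := aXY.ne
      have n2 := aXZ.ne
      have n3 := aYZ.ne
      rcases h with ⟨rfl, h1, h2, h3⟩ | ⟨rfl, h1, h2, h3⟩ | ⟨rfl, h1, h2, h3⟩
      · have := hb _ aXY; have := hb _ aXZ; grind
      · have := hb _ aXY.symm; have := hb _ aYZ; grind
      · have := hb _ aXZ.symm; have := hb _ aYZ.symm; grind
    have hd : (G.deleteEdges {e | v ∈ e}).Adj w b := by
      rw [SimpleGraph.deleteEdges_adj]; exact ⟨hadj, by simp [hv1, hvb]⟩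
    by_cases ho : o1 w b
    · exact hcase w b hb hadj ho
    · exact hcase b w (fun u hu => (hb u hu).symm) hadj.symm (by have := ho1.2 w b hd; tauto)
  · obtain ⟨X, Y, Z, aXY, aXZ, aYZ, h⟩ := hcopy (fun x y => x < y) (by
      intro x y hxy _; have := hxy.ne; simp only [not_lt]; constructor
      · exact le_of_lt
      · intro h; exact lt_of_le_of_ne h this)
    have n1 := aXY.ne
    have n2 := aXZ.ne
    have n3 := aYZ.ne
    have hadj' : ¬ G.Adj b w := fun h => hadj h.symm
    have key : ∀ x y, G.Adj v x → G.Adj v y → G.Adj x y → False := by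
      intro x y hx hy hxy
      have hne := hxy.ne
      rcases hb x hx with rfl | rfl <;> rcases hb y hy with rfl | rfl <;> tauto
    rcases h with ⟨rfl, h1, h2, h3⟩ | ⟨rfl, h1, h2, h3⟩ | ⟨rfl, h1, h2, h3⟩
    · exact key _ _ aXY aXZ aYZ
    · exact key _ _ aXY.symm aYZ aXZ
    · exact key _ _ aXZ.symm aYZ.symm aXY

theorem zero3_det {n : ℕ} (G0 : SimpleGraph (Fin n)) {H : Fin 3 → Fin 3 → Prop} (hac : RelAcyclic H)
    (hor : IsOrientation (⊤ : SimpleGraph (Fin 3)) H) (harr : Arrows G0 H) :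
    (∃ W : Finset (Fin n), W.card = 4 ∧ 6 ≤ (eF G0 ∩ eS W).card) ∨
    (∃ W : Finset (Fin n), W.card = 5 ∧ 8 ≤ (eF G0 ∩ eS W).card) ∨
    (∃ W : Finset (Fin n), W.card = 6 ∧ 9 ≤ (eF G0 ∩ eS W).card) := by
  obtain ⟨G, hG, hm⟩ := exists_min G0 H harr
  by_contra hcon
  have hno : ∀ W : Finset (Fin n), (W.card = 4 → (eF G ∩ eS W).card ≤ 5) ∧
      (W.card = 5 → (eF G ∩ eS W).card ≤ 7) ∧ (W.card = 6 → (eF G ∩ eS W).card ≤ 8) := by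
    intro W
    have hle : (eF G ∩ eS W).card ≤ (eF G0 ∩ eS W).card :=
      card_le_card (inter_subset_inter_right (eF_mono hG))
    push Not at hcon
    have h1 := hcon.1 W; have h2 := hcon.2.1 W; have h3 := hcon.2.2 W
    refine ⟨fun h => ?_, fun h => ?_, fun h => ?_⟩
    · have := h1 h; omega
    · have := h2 h; omega
    · have := h3 h; omega
  -- a triangle
  obtain ⟨f, hf, hfc⟩ := hm.1 (fun u v => G.Adj u v ∧ u < v) ⟨fun u v h => h.1, fun u v h => by
    have := h.ne
    simp only [h, h.symm, true_and, not_lt]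
    exact ⟨le_of_lt, fun h => lt_of_le_of_ne h this⟩⟩
  have hfU : UCopy G H f := ⟨hf, fun a b hab => (hfc a b hab).1⟩
  let good := fun (W : Finset (Fin n)) (k : ℕ) => W.card = k ∧ 2 * k - 3 ≤ (eF G ∩ eS W).card ∧
    ∀ v ∈ W, ∃ w, G.Adj v w
  let closed := fun (W : Finset (Fin n)) => ∀ v ∉ W, ∀ a ∈ W, ∀ b ∈ W, G.Adj a b → ¬ (G.Adj v a ∧ G.Adj v b)
  have hstep : ∀ W k, 3 ≤ k → good W k → ¬ closed W → ∃ W', good W' (k + 1) := by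
    intro W k hk3 ⟨h1, h2, h3⟩ hcl
    simp only [closed] at hcl
    push Not at hcl
    obtain ⟨v, hv, a, ha, b, hb, hab, hva, hvb⟩ := hcl
    refine ⟨insert v W, by rw [card_insert_of_notMem hv, h1], ?_, ?_⟩
    · have hsub : (eF G ∩ eS W) ∪ {s(v, a), s(v, b)} ⊆ eF G ∩ eS (insert v W) := by
        intro e he
        rcases mem_union.1 he with he | he
        · obtain ⟨h4, h5⟩ := mem_inter.1 he
          exact mem_inter.2 ⟨h4, eS_mono (subset_insert _ _) h5⟩
        · simp only [mem_insert, mem_singleton] at he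
          rcases he with rfl | rfl
          · rw [mem_inter, mem_eF, mk_mem_eS]
            exact ⟨hva, hva.ne, mem_insert_self _ _, mem_insert_of_mem ha⟩
          · rw [mem_inter, mem_eF, mk_mem_eS]
            exact ⟨hvb, hvb.ne, mem_insert_self _ _, mem_insert_of_mem hb⟩
      have hdis : Disjoint (eF G ∩ eS W) {s(v, a), s(v, b)} := by
        rw [Finset.disjoint_left]
        intro e he he'
        have h5 := (mem_inter.1 he).2
        simp only [mem_insert, mem_singleton] at he'
        rcases he' with rfl | rfl
        · exact hv ((mk_mem_eS _ _ _).1 h5).2.1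
        · exact hv ((mk_mem_eS _ _ _).1 h5).2.1
      have := card_le_card hsub
      rw [card_union_of_disjoint hdis, card_pair] at this
      · omega
      · intro h; rw [Sym2.eq_iff] at h
        have := hab.ne; have := hva.ne; grind
    · intro u hu
      rcases mem_insert.1 hu with rfl | hu
      · exact ⟨a, hva⟩
      · exact h3 u hu
  have h3 : good (univ.image f) 3 := by
    have hc : (univ.image f).card = 3 := by rw [card_image_of_injective _ hf]; simp
    refine ⟨hc, ?_, ?_⟩
    · have : eS (univ.image f) ⊆ eF G ∩ eS (univ.image f) := by
        intro e he
        refine mem_inter.2 ⟨?_, he⟩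
        induction e with
        | _ x y =>
        rw [mk_mem_eS] at he
        obtain ⟨hne, hx, hy⟩ := he
        obtain ⟨i, _, rfl⟩ := mem_image.1 hx
        obtain ⟨j, _, rfl⟩ := mem_image.1 hy
        rw [mem_eF]
        exact ucopy_complete hor hfU i j (fun h => hne (by rw [h]))
      have := card_le_card this
      rw [card_eS, hc] at this
      simpa using this
    · intro v hv
      obtain ⟨i, _, rfl⟩ := mem_image.1 hv
      obtain ⟨j, hj⟩ := exists_ne i
      exact ⟨f j, ucopy_complete hor hfU i j (Ne.symm hj)⟩
  have hW : ∃ W k, 3 ≤ k ∧ k ≤ 5 ∧ good W k ∧ closed W := by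
    by_contra hnone
    push Not at hnone
    obtain ⟨W4, h4⟩ := hstep _ 3 le_rfl h3 (hnone _ 3 (by norm_num) (by norm_num) h3)
    obtain ⟨W5, h5⟩ := hstep _ 4 (by norm_num) h4 (hnone _ 4 (by norm_num) (by norm_num) h4)
    obtain ⟨W6, h6⟩ := hstep _ 5 (by norm_num) h5 (hnone _ 5 (by norm_num) (by norm_num) h5)
    have := (hno W6).2.2 h6.1
    have := h6.2.1
    omega
  obtain ⟨W, k, hk3, hk5, ⟨hWk, hWe, hWn⟩, hcl⟩ := hW
  have hall : eF G ⊆ eS W := by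
    by_contra hns
    obtain ⟨e, he, heW⟩ := not_subset.1 hns
    have hne : (eF G ∩ eS W).Nonempty := by rw [← card_pos]; omega
    obtain ⟨e', he'⟩ := hne
    obtain ⟨he1, he2⟩ := mem_inter.1 he'
    refine separation hm {e | e ∈ eS W} ⟨e', he2, (mem_eF _ _).1 he1⟩ ⟨e, heW, (mem_eF _ _).1 he⟩ ?_
    intro g hg a b hab habW a' b' hab'
    simp only [Set.mem_setOf_eq, mk_mem_eS] at habW ⊢
    have hin : ∀ c, g c ∈ W := by
      intro c
      by_contra hc
      have hca : c ≠ a := fun h => hc (h ▸ habW.2.1)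
      have hcb : c ≠ b := fun h => hc (h ▸ habW.2.2)
      exact hcl _ hc _ habW.2.1 _ habW.2.2 (hg.2 a b hab)
        ⟨ucopy_complete hor hg c a hca, ucopy_complete hor hg c b hcb⟩
    exact ⟨(hg.2 a' b' hab').ne, hin _, hin _⟩
  have hsum : 3 * k ≤ 2 * (eF G).card := by
    rw [← degree_sum]
    calc 3 * k = ∑ v ∈ W, 3 := by rw [sum_const, hWk, smul_eq_mul, mul_comm]
      _ ≤ ∑ v ∈ W, G.degree v := sum_le_sum fun v hv => by
          obtain ⟨w, hw⟩ := hWn v hv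
          exact deg3 hac hor hm v w hw
      _ ≤ _ := sum_le_sum_of_subset (subset_univ _)
  have hle : (eF G).card ≤ k.choose 2 := by rw [← hWk, ← card_eS]; exact card_le_card hall
  have hInter : eF G ∩ eS W = eF G := inter_eq_left.2 hall
  have := hno W
  rw [hInter] at this
  interval_cases k
  · simp [Nat.choose] at hle; omega
  · have := this.1 hWk; omega
  · have := this.2.1 hWk; omega

open Filter in
theorem zero3 {H : Fin 3 → Fin 3 → Prop} (hac : RelAcyclic H)
    (hor : IsOrientation (⊤ : SimpleGraph (Fin 3)) H) (p : ℕ → ℝ) (hp : ∀ n, 0 ≤ p n ∧ p n ≤ 1)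
    (h : Tendsto (fun n => p n * (n : ℝ) ^ ((2 : ℝ) / 3)) atTop (nhds 0)) :
    Tendsto (fun n => probGnp n (p n) (fun G => Arrows G H)) atTop (nhds 0) := by
  have hlim : Tendsto (fun n => (2 : ℝ) ^ 16 * (p n * (n : ℝ) ^ ((2 : ℝ) / 3))) atTop (nhds 0) := by
    simpa using h.const_mul ((2 : ℝ) ^ 16)
  refine squeeze_zero' (Eventually.of_forall fun n => pr_nonneg (hp n).1 (hp n).2 _) ?_ hlim
  filter_upwards [eventually_ge_atTop 1, h.eventually_le_const (zero_lt_one)] with n hn hη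
  obtain ⟨h0, h1⟩ := hp n
  have hn1 : (1 : ℝ) ≤ n := by exact_mod_cast hn
  set η := p n * (n : ℝ) ^ ((2 : ℝ) / 3) with hηd
  have hη0 : 0 ≤ η := by positivity
  have hpow : ∀ v e : ℕ, 1 ≤ e → 3 * v ≤ 2 * e → (n : ℝ) ^ v * p n ^ e ≤ η := by
    intro v e he1 hve
    have h3 : (n : ℝ) ^ v ≤ ((n : ℝ) ^ ((2 : ℝ) / 3)) ^ e := by
      rw [← Real.rpow_natCast, ← Real.rpow_natCast, ← Real.rpow_mul (by positivity)]
      apply Real.rpow_le_rpow_of_exponent_le hn1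
      have : (3 : ℝ) * v ≤ 2 * e := by exact_mod_cast hve
      linarith
    calc (n : ℝ) ^ v * p n ^ e ≤ ((n : ℝ) ^ ((2 : ℝ) / 3)) ^ e * p n ^ e := by gcongr
      _ = η ^ e := by rw [← mul_pow, mul_comm]
      _ ≤ η := pow_le_of_le_one hη0 hη (by omega)
  calc probGnp n (p n) (fun G => Arrows G H) ≤ probGnp n (p n) (fun G =>
        (∃ W : Finset (Fin n), W.card = 4 ∧ 6 ≤ (eF G ∩ eS W).card) ∨
        (∃ W : Finset (Fin n), W.card = 5 ∧ 8 ≤ (eF G ∩ eS W).card) ∨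
        (∃ W : Finset (Fin n), W.card = 6 ∧ 9 ≤ (eF G ∩ eS W).card)) :=
        pr_mono h0 h1 fun G hG => zero3_det G hac hor hG
    _ ≤ 2 ^ (Nat.choose 4 2) * (n : ℝ) ^ 4 * p n ^ 6 + (2 ^ (Nat.choose 5 2) * (n : ℝ) ^ 5 * p n ^ 8 +
        2 ^ (Nat.choose 6 2) * (n : ℝ) ^ 6 * p n ^ 9) :=
        (pr_or h0 h1 _ _).trans (add_le_add (first_moment h0 h1 4 6)
          ((pr_or h0 h1 _ _).trans (add_le_add (first_moment h0 h1 5 8) (first_moment h0 h1 6 9))))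
    _ ≤ _ := by
        have e1 := hpow 4 6 (by norm_num) (by norm_num)
        have e2 := hpow 5 8 (by norm_num) (by norm_num)
        have e3 := hpow 6 9 (by norm_num) (by norm_num)
        norm_num [Nat.choose]
        simp only [mul_assoc]
        linarith

end ORam

namespace ORam
open Finset
open scoped Classical

theorem second_moment {n : ℕ} {p : ℝ} (h0 : 0 ≤ p) (h1 : p ≤ 1) {ι : Type} (I : Finset ι)
    (S : ι → Finset (Sym2 (Fin n))) (hS : ∀ i ∈ I, S i ⊆ eF (⊤ : SimpleGraph (Fin n))) (m : ℝ)
    (hm : m = ∑ i ∈ I, p ^ (S i).card) :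
    m ^ 2 * probGnp n p (fun G => ∀ i ∈ I, ¬ S i ⊆ eF G) ≤
      ∑ i ∈ I, ∑ j ∈ I, (p ^ (S i ∪ S j).card - p ^ (S i).card * p ^ (S j).card) := by
  let X : SimpleGraph (Fin n) → ℝ := fun G => ∑ i ∈ I, if S i ⊆ eF G then 1 else 0
  have hw : ∑ G, wt n p G = 1 := by
    have := pr_true n p
    rw [pr_def] at this; simpa using this
  have e1 : ∑ G, wt n p G * X G = m := by
    simp only [X, mul_sum]
    rw [sum_comm, hm]
    refine sum_congr rfl fun i hi => ?_
    rw [← pr_sub n p (S i) (hS i hi), pr_def]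
    exact sum_congr rfl fun G _ => by simp
  have e2 : ∑ G, wt n p G * X G ^ 2 = ∑ i ∈ I, ∑ j ∈ I, p ^ (S i ∪ S j).card := by
    have hX : ∀ G, wt n p G * X G ^ 2 = ∑ i ∈ I, ∑ j ∈ I, wt n p G *
        ((if S i ⊆ eF G then 1 else 0) * if S j ⊆ eF G then 1 else 0) := by
      intro G; simp only [X]; rw [pow_two, sum_mul_sum]; simp only [mul_sum]
    simp only [hX]
    rw [sum_comm]
    refine sum_congr rfl fun i hi => ?_
    rw [sum_comm]
    refine sum_congr rfl fun j hj => ?_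
    rw [← pr_sub n p (S i ∪ S j) (union_subset (hS i hi) (hS j hj)), pr_def]
    refine sum_congr rfl fun G _ => ?_
    by_cases a : S i ⊆ eF G <;> by_cases b : S j ⊆ eF G <;> simp [a, b, union_subset_iff]
  have e3 : ∑ G, wt n p G * (X G - m) ^ 2 =
      ∑ i ∈ I, ∑ j ∈ I, (p ^ (S i ∪ S j).card - p ^ (S i).card * p ^ (S j).card) := by
    have : ∀ G, wt n p G * (X G - m) ^ 2 = wt n p G * X G ^ 2 - 2 * m * (wt n p G * X G) + m ^ 2 * wt n p G := by
      intro G; ring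
    simp only [this, sum_add_distrib, sum_sub_distrib, ← mul_sum]
    rw [e1, e2, hw]
    have : ∑ i ∈ I, p ^ (S i).card * ∑ j ∈ I, p ^ (S j).card = m * m := by
      rw [← sum_mul, ← hm]
    rw [this]; ring
  rw [← e3, pr_def, mul_sum]
  refine sum_le_sum fun G _ => ?_
  have hwn := wt_nonneg h0 h1 G
  split_ifs with h
  · have : X G = 0 := sum_eq_zero fun i hi => by simp [h i hi]
    rw [this]; nlinarith
  · rw [mul_zero]; positivity

theorem card_fiber {n : ℕ} (U A : Finset (Fin n)) :
    ((powersetCard 4 univ).filter (fun U' : Finset (Fin n) => U ∩ U' = A)).card ≤ n ^ (4 - A.card) := by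
  calc _ ≤ (powersetCard (4 - A.card) (univ : Finset (Fin n))).card := by
        refine card_le_card_of_injOn (fun U' => U' \ A) ?_ ?_
        · intro U' hU'
          simp only [coe_filter, mem_powersetCard, Set.mem_setOf_eq, subset_univ, true_and] at hU'
          simp only [subset_univ, true_and, mem_coe, mem_powersetCard]
          have : A ⊆ U' := hU'.2 ▸ inter_subset_right
          rw [card_sdiff_of_subset this, hU'.1]
        · intro U' hU' U'' hU'' h
          simp only [coe_filter, mem_powersetCard, Set.mem_setOf_eq] at hU' hU''
          have a : A ⊆ U' := hU'.2 ▸ inter_subset_right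
          have b : A ⊆ U'' := hU''.2 ▸ inter_subset_right
          have h : U' \ A = U'' \ A := h
          rw [← sdiff_union_of_subset a, h, sdiff_union_of_subset b]
    _ ≤ _ := by
        rw [card_powersetCard, card_univ, Fintype.card_fin]; exact Nat.choose_le_pow n _

theorem no_k4 {n : ℕ} {p : ℝ} (h0 : 0 ≤ p) (h1 : p ≤ 1) (ω : ℝ) (hω : 0 < ω) (hn : 6 ≤ n)
    (hb : ∀ s, 2 ≤ s → s ≤ 4 → ω ≤ (n : ℝ) ^ s * p ^ (s.choose 2)) :
    probGnp n p (fun G => ∀ U ∈ powersetCard 4 (univ : Finset (Fin n)), ¬ eS U ⊆ eF G) ≤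
      6144 / ω := by
  set I := powersetCard 4 (univ : Finset (Fin n)) with hI
  set N : ℝ := (I.card : ℝ) with hN
  have hIc : ∀ U ∈ I, (eS U).card = 6 := by
    intro U hU
    rw [card_eS, (mem_powersetCard.1 hU).2]; rfl
  have hm := second_moment h0 h1 I eS (fun i _ => eS_sub_top i) (N * p ^ 6) (by
    rw [sum_congr rfl (g := fun _ => p ^ 6) (fun U hU => by rw [hIc U hU])]
    rw [sum_const, nsmul_eq_mul])
  have hNn : (n : ℝ) ^ 4 ≤ 384 * N := by
    have h2 := Nat.pow_sub_le_descFactorial n 4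
    rw [Nat.descFactorial_eq_factorial_mul_choose] at h2
    have h3 : I.card = n.choose 4 := by simp [hI]
    have h4 : n ≤ 2 * (n + 1 - 4) := by omega
    have h5 := Nat.pow_le_pow_left h4 4
    rw [mul_pow] at h5
    have : n ^ 4 ≤ 384 * I.card := by
      rw [h3]; have : Nat.factorial 4 = 24 := rfl
      rw [this] at h2; omega
    rw [hN]; exact_mod_cast this
  have hn0 : (0 : ℝ) < n := by exact_mod_cast (by omega : 0 < n)
  have hNpos : 0 < N := by have : (0 : ℝ) < (n : ℝ) ^ 4 := by positivity
                           linarith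
  have hpp : 0 < p := by
    rcases h0.eq_or_lt with h | h
    · have := hb 2 le_rfl (by norm_num); rw [← h] at this; norm_num at this; linarith
    · exact h
  have hvar : ∑ i ∈ I, ∑ j ∈ I, (p ^ (eS i ∪ eS j).card - p ^ (eS i).card * p ^ (eS j).card) ≤
      N * (16 * (384 * N * p ^ 12 / ω)) := by
    rw [hN, ← nsmul_eq_mul]
    refine sum_le_card_nsmul _ _ _ fun U hU => ?_
    have hUc := (mem_powersetCard.1 hU).2
    rw [← sum_fiberwise_of_maps_to (s := I) (t := U.powerset) (g := fun U' => U ∩ U')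
      (fun U' _ => mem_powerset.2 inter_subset_left)]
    have h16 : (16 : ℝ) = (U.powerset.card : ℝ) := by rw [card_powerset, hUc]; norm_num
    rw [h16, ← nsmul_eq_mul]
    refine sum_le_card_nsmul _ _ _ fun A hA => ?_
    have hA4 : A.card ≤ 4 := hUc ▸ card_le_card (mem_powerset.1 hA)
    have hpos : 0 ≤ 384 * (I.card : ℝ) * p ^ 12 / ω := by positivity
    have hterm : ∀ U' ∈ I.filter (fun U' => U ∩ U' = A),
        p ^ (eS U ∪ eS U').card - p ^ (eS U).card * p ^ (eS U').card =
          p ^ (12 - A.card.choose 2) - p ^ 12 := by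
      intro U' hU'
      obtain ⟨h3, h4⟩ := mem_filter.1 hU'
      have := card_union_add_card_inter (eS U) (eS U')
      rw [eS_inter, h4, card_eS A, hIc U hU, hIc U' h3] at this
      rw [hIc U hU, hIc U' h3, ← pow_add]
      congr 2; omega
    rw [sum_congr rfl hterm, sum_const, nsmul_eq_mul]
    by_cases hA2 : 2 ≤ A.card
    · have hch : A.card.choose 2 ≤ 6 := (Nat.choose_le_choose 2 hA4).trans (by norm_num [Nat.choose])
      have hfib : (((I.filter (fun U' => U ∩ U' = A)).card : ℕ) : ℝ) ≤ (n : ℝ) ^ (4 - A.card) := by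
        exact_mod_cast card_fiber U A
      have hbA := hb A.card hA2 hA4
      calc _ ≤ (n : ℝ) ^ (4 - A.card) * p ^ (12 - A.card.choose 2) := by
            apply mul_le_mul hfib _ _ (by positivity)
            · have : 0 ≤ p ^ 12 := by positivity
              linarith
            · rw [sub_nonneg]; exact pow_le_pow_of_le_one h0 h1 (by omega)
        _ ≤ (n : ℝ) ^ 4 * p ^ 12 / ω := by
            rw [le_div_iff₀ hω]
            calc _ ≤ (n : ℝ) ^ (4 - A.card) * p ^ (12 - A.card.choose 2) *
                  ((n : ℝ) ^ A.card * p ^ (A.card.choose 2)) := by gcongr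
              _ = (n : ℝ) ^ (4 - A.card + A.card) * p ^ (12 - A.card.choose 2 + A.card.choose 2) := by
                  rw [pow_add, pow_add]; ring
              _ = _ := by congr 2 <;> omega
        _ ≤ _ := by gcongr
    · have : A.card.choose 2 = 0 := Nat.choose_eq_zero_of_lt (by omega)
      rw [this]; simpa using hpos
  have := hm.trans hvar
  have hpos : 0 < (N * p ^ 6) ^ 2 := by positivity
  rw [← le_div_iff₀' hpos] at this
  refine this.trans (le_of_eq ?_)
  field_simp; ring

theorem k4_arrows {n : ℕ} {G : SimpleGraph (Fin n)} {H : Fin 3 → Fin 3 → Prop} (hac : RelAcyclic H)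
    (hor : IsOrientation (⊤ : SimpleGraph (Fin 3)) H) (U : Finset (Fin n)) (hU : U.card = 4)
    (hG : eS U ⊆ eF G) : Arrows G H := by
  intro o ho
  obtain ⟨r, hr⟩ := rank_complete hac hor
  have hadj : ∀ x ∈ U, ∀ y ∈ U, x ≠ y → G.Adj x y := by
    intro x hx y hy hxy
    exact (mem_eF G _).1 (hG ((mk_mem_eS U x y).2 ⟨hxy, hx, hy⟩))
  have htr : ∀ x y z, o x y → o x z → o y z → HasCopy o H := by
    intro x y z h1 h2 h3
    have n1 := (ho.1 _ _ h1).ne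
    have n2 := (ho.1 _ _ h2).ne
    have n3 := (ho.1 _ _ h3).ne
    refine ⟨![x, y, z] ∘ r, ?_, ?_⟩
    · refine Function.Injective.comp ?_ r.injective
      intro i j hij
      fin_cases i <;> fin_cases j <;> simp_all
    · intro a b hab
      rw [hr] at hab
      simp only [Function.comp]
      generalize r a = i at *
      generalize r b = j at *
      fin_cases i <;> fin_cases j <;> simp_all
  obtain ⟨v, a, b, c, hva, hvb, hvc, hab, hac', hbc, rfl⟩ := card_eq_four.1 hU
  have A : ∀ x y, x ∈ ({v, a, b, c} : Finset (Fin n)) → y ∈ ({v, a, b, c} : Finset (Fin n)) → x ≠ y →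
      o x y ∨ o y x := by
    intro x y hx hy hxy
    have := ho.2 x y (hadj x hx y hy hxy)
    tauto
  have o1 := A v a (by simp) (by simp) hva
  have o2 := A v b (by simp) (by simp) hvb
  have o3 := A v c (by simp) (by simp) hvc
  have o4 := A a b (by simp) (by simp) hab
  have o5 := A a c (by simp) (by simp) hac'
  have o6 := A b c (by simp) (by simp) hbc
  rcases o1 with o1 | o1 <;> rcases o2 with o2 | o2 <;> rcases o3 with o3 | o3 <;>
    rcases o4 with o4 | o4 <;> rcases o5 with o5 | o5 <;> rcases o6 with o6 | o6 <;>
    first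
    | exact htr _ _ _ o1 o2 o4
    | exact htr _ _ _ o2 o1 o4
    | exact htr _ _ _ o1 o3 o5
    | exact htr _ _ _ o3 o1 o5
    | exact htr _ _ _ o2 o3 o6
    | exact htr _ _ _ o3 o2 o6
    | exact htr _ _ _ o4 o1 o2
    | exact htr _ _ _ o4 o2 o1
    | exact htr _ _ _ o5 o1 o3
    | exact htr _ _ _ o5 o3 o1
    | exact htr _ _ _ o6 o2 o3
    | exact htr _ _ _ o6 o3 o2

open Filter in
theorem one3 {H : Fin 3 → Fin 3 → Prop} (hac : RelAcyclic H)
    (hor : IsOrientation (⊤ : SimpleGraph (Fin 3)) H) (p : ℕ → ℝ) (hp : ∀ n, 0 ≤ p n ∧ p n ≤ 1)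
    (h : Tendsto (fun n => p n * (n : ℝ) ^ ((2 : ℝ) / 3)) atTop atTop) :
    Tendsto (fun n => probGnp n (p n) (fun G => Arrows G H)) atTop (nhds 1) := by
  have hlim : Tendsto (fun n => 1 - (6144 : ℝ) / (p n * (n : ℝ) ^ ((2 : ℝ) / 3))) atTop (nhds 1) := by
    simpa using (h.const_div_atTop (6144 : ℝ)).const_sub 1
  refine tendsto_of_tendsto_of_tendsto_of_le_of_le' hlim tendsto_const_nhds ?_
    (Eventually.of_forall fun n => by
      have := pr_compl n (p n) (fun G => Arrows G H)
      have := pr_nonneg (hp n).1 (hp n).2 (fun G : SimpleGraph (Fin n) => ¬ Arrows G H)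
      linarith)
  filter_upwards [eventually_ge_atTop 6, h.eventually_ge_atTop 1] with n hn hω
  obtain ⟨h0, h1⟩ := hp n
  have hn1 : (1 : ℝ) ≤ n := by exact_mod_cast (by omega : 1 ≤ n)
  set ω := p n * (n : ℝ) ^ ((2 : ℝ) / 3) with hωd
  have hk := no_k4 h0 h1 ω (by linarith) hn (by
    intro s hs2 hs4
    have h3 : ((n : ℝ) ^ ((2 : ℝ) / 3)) ^ (s.choose 2) ≤ (n : ℝ) ^ s := by
      rw [← Real.rpow_natCast, ← Real.rpow_natCast, ← Real.rpow_mul (by positivity)]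
      apply Real.rpow_le_rpow_of_exponent_le hn1
      interval_cases s <;> norm_num [Nat.choose]
    calc ω ≤ ω ^ (s.choose 2) := le_self_pow₀ hω (by
          have := Nat.choose_pos hs2; omega)
      _ = ((n : ℝ) ^ ((2 : ℝ) / 3)) ^ (s.choose 2) * p n ^ (s.choose 2) := by rw [← mul_pow, mul_comm]
      _ ≤ _ := by gcongr)
  rw [pr_compl]
  have : probGnp n (p n) (fun G => ¬ Arrows G H) ≤
      probGnp n (p n) (fun G => ∀ U ∈ powersetCard 4 (univ : Finset (Fin n)), ¬ eS U ⊆ eF G) := by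
    refine pr_mono h0 h1 fun G hG U hU hUG => hG (k4_arrows hac hor U (mem_powersetCard.1 hU).2 hUG)
  linarith

end ORam

namespace ORam
open Finset
open scoped Classical

/-- exploration state -/
structure St (n : ℕ) where
  W : Finset (Sym2 (Fin n))
  V : Finset (Fin n)
  T : Option (Finset (Fin n))

/-- edge map -/
def ev {t n : ℕ} (φ : Fin t → Fin n) (a : Fin t × Fin t) : Sym2 (Fin n) := s(φ a.1, φ a.2)

/-- edges of a copy -/
noncomputable def em {t n : ℕ} (H : Fin t → Fin t → Prop) (φ : Fin t → Fin n) : Finset (Sym2 (Fin n)) :=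
  (arcs H).image (ev φ)

/-- positions inside a vertex set -/
noncomputable def pos {t n : ℕ} (φ : Fin t → Fin n) (V : Finset (Fin n)) : Finset (Fin t) :=
  univ.filter (fun a => φ a ∈ V)

/-- arcs inside an edge set -/
noncomputable def jn {t n : ℕ} (H : Fin t → Fin t → Prop) (φ : Fin t → Fin n) (W : Finset (Sym2 (Fin n))) :
    Finset (Fin t × Fin t) := (arcs H).filter (fun a => ev φ a ∈ W)

theorem mem_em {t n : ℕ} {H : Fin t → Fin t → Prop} {φ : Fin t → Fin n} {e : Sym2 (Fin n)} :
    e ∈ em H φ ↔ ∃ a b, H a b ∧ s(φ a, φ b) = e := by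
  simp [em, arcs, ev]

theorem ev_inj {t n : ℕ} {H : Fin t → Fin t → Prop} (hor : ∀ a b, H a b → ¬ H b a)
    {φ : Fin t → Fin n} (hφ : Function.Injective φ) :
    Set.InjOn (ev φ) (arcs H : Set (Fin t × Fin t)) := by
  rintro ⟨a, b⟩ h ⟨c, d⟩ h' he
  have h1 : H a b := by simpa [arcs] using h
  have h2 : H c d := by simpa [arcs] using h'
  simp only [ev, Sym2.eq_iff, hφ.eq_iff] at he
  rcases he with ⟨rfl, rfl⟩ | ⟨rfl, rfl⟩
  · rfl
  · exact absurd h2 (hor _ _ h1)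

theorem card_em {t n : ℕ} {H : Fin t → Fin t → Prop} (hor : ∀ a b, H a b → ¬ H b a)
    {φ : Fin t → Fin n} (hφ : Function.Injective φ) : (em H φ).card = (arcs H).card :=
  card_image_of_injOn (ev_inj hor hφ)

theorem card_jn {t n : ℕ} {H : Fin t → Fin t → Prop} (hor : ∀ a b, H a b → ¬ H b a)
    {φ : Fin t → Fin n} (hφ : Function.Injective φ) (W) : (em H φ ∩ W).card = (jn H φ W).card := by
  rw [← card_image_of_injOn (s := jn H φ W) (f := ev φ) ((ev_inj hor hφ).mono (by
    intro x hx; exact (mem_filter.1 hx).1))]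
  congr 1
  ext e
  simp only [em, jn, mem_inter, mem_image, mem_filter]
  constructor
  · rintro ⟨⟨a, ha, rfl⟩, h⟩; exact ⟨a, ⟨ha, h⟩, rfl⟩
  · rintro ⟨a, ⟨ha, h⟩, rfl⟩; exact ⟨⟨a, ha, rfl⟩, h⟩

theorem card_pos_im {t n : ℕ} {φ : Fin t → Fin n} (hφ : Function.Injective φ) (V : Finset (Fin n)) :
    (univ.image φ ∩ V).card = (pos φ V).card := by
  rw [← card_image_of_injective (pos φ V) hφ]
  congr 1
  ext e
  simp only [pos, mem_inter, mem_image, mem_filter, mem_univ, true_and]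
  constructor
  · rintro ⟨⟨a, rfl⟩, h⟩; exact ⟨a, h, rfl⟩
  · rintro ⟨a, h, rfl⟩; exact ⟨⟨a, rfl⟩, h⟩

/-- admissible next copies -/
noncomputable def nxt {t n : ℕ} (H : Fin t → Fin t → Prop) (st : St n) : Finset (Fin t → Fin n) :=
  univ.filter (fun φ => Function.Injective φ ∧ ¬ em H φ ⊆ st.W ∧ 2 ≤ (pos φ st.V).card ∧
    ∀ T, st.T = some T → 2 ≤ (pos φ T).card)

/-- updated state -/
noncomputable def upd {t n : ℕ} (H : Fin t → Fin t → Prop) (st : St n) (φ : Fin t → Fin n) : St n :=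
  ⟨st.W ∪ em H φ, st.V ∪ univ.image φ,
    if (pos φ st.V).card = 2 ∧ (jn H φ st.W).card = 1 then some (univ.image φ) else none⟩

/-- potential -/
def mst {n : ℕ} (P Q : ℕ) (st : St n) : ℤ := P * st.V.card - Q * st.W.card

/-- bad event -/
def Bad {t : ℕ} (H : Fin t → Fin t → Prop) (P Q n : ℕ) : ℕ → St n → Finset (Sym2 (Fin n)) → Prop
  | 0, st, X => st.W ⊆ X
  | k + 1, st, X => (mst P Q st ≤ 0 ∧ st.W ⊆ X) ∨
      (0 < mst P Q st ∧ ∃ φ ∈ nxt H st, Bad H P Q n k (upd H st φ) X)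

/-- state invariants -/
def Inv {n : ℕ} (t : ℕ) (st : St n) : Prop :=
  (∀ e ∈ st.W, ∀ x ∈ e, x ∈ st.V) ∧ ∀ T, st.T = some T → T ⊆ st.V ∧ T.card ≤ t

theorem inv_upd {t n : ℕ} (H : Fin t → Fin t → Prop) {st : St n} (h : Inv t st) (φ : Fin t → Fin n) :
    Inv t (upd H st φ) := by
  constructor
  · intro e he x hx
    simp only [upd, mem_union] at he ⊢
    rcases he with he | he
    · exact Or.inl (h.1 e he x hx)
    · right
      obtain ⟨a, b, _, rfl⟩ := mem_em.1 he
      rw [Sym2.mem_iff] at hx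
      rcases hx with rfl | rfl <;> simp
  · intro T hT
    simp only [upd] at hT
    split_ifs at hT with h
    · simp only [Option.some.injEq] at hT
      subst hT
      refine ⟨subset_union_right, card_image_le.trans (by simp)⟩

theorem upd_V_card {t n : ℕ} (H : Fin t → Fin t → Prop) (st : St n) {φ : Fin t → Fin n}
    (hφ : Function.Injective φ) : (upd H st φ).V.card + (pos φ st.V).card = st.V.card + t := by
  have := card_union_add_card_inter st.V (univ.image φ)
  rw [inter_comm, card_pos_im hφ, card_image_of_injective _ hφ] at this
  simpa [upd] using this

theorem upd_W_card {t n : ℕ} {H : Fin t → Fin t → Prop} (hor : ∀ a b, H a b → ¬ H b a) (st : St n)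
    {φ : Fin t → Fin n} (hφ : Function.Injective φ) :
    (upd H st φ).W.card + (jn H φ st.W).card = st.W.card + (arcs H).card := by
  have := card_union_add_card_inter st.W (em H φ)
  rw [inter_comm, card_jn hor hφ, card_em hor hφ] at this
  simpa [upd] using this

theorem jn_ne {t n : ℕ} {H : Fin t → Fin t → Prop} {φ : Fin t → Fin n} {W : Finset (Sym2 (Fin n))}
    (h : ¬ em H φ ⊆ W) : jn H φ W ≠ arcs H := by
  intro h'
  apply h
  intro e he
  obtain ⟨a, ha, rfl⟩ := mem_image.1 he
  rw [← h'] at ha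
  exact (mem_filter.1 ha).2

theorem jn_pos {t n : ℕ} {H : Fin t → Fin t → Prop} {φ : Fin t → Fin n} {W : Finset (Sym2 (Fin n))}
    {V : Finset (Fin n)} (h : ∀ e ∈ W, ∀ x ∈ e, x ∈ V) :
    ∀ a ∈ jn H φ W, a.1 ∈ pos φ V ∧ a.2 ∈ pos φ V := by
  intro a ha
  have := (mem_filter.1 ha).2
  simp only [pos, mem_filter, mem_univ, true_and]
  exact ⟨h _ this _ (by simp [ev]), h _ this _ (by simp [ev])⟩

theorem mst_upd {t n : ℕ} {H : Fin t → Fin t → Prop} (hor : ∀ a b, H a b → ¬ H b a) {P Q : ℕ}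
    (hQ : 0 < Q) (hB1 : P * t + Q = Q * (arcs H).card + 2 * P)
    (hS : ∀ J ⊆ arcs H, ∀ A : Finset (Fin t), (∀ a ∈ J, a.1 ∈ A ∧ a.2 ∈ A) → J ≠ arcs H → 3 ≤ A.card →
      Q * J.card + 2 * P < P * A.card + Q)
    (hW : ∀ J ⊆ arcs H, ∀ A : Finset (Fin t), (∀ a ∈ J, a.1 ∈ A ∧ a.2 ∈ A) → J.Nonempty →
      Q * J.card + 2 * P ≤ P * A.card + Q)
    {st : St n} (hI : ∀ e ∈ st.W, ∀ x ∈ e, x ∈ st.V) {φ : Fin t → Fin n} (hφ : Function.Injective φ)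
    (hne : ¬ em H φ ⊆ st.W) (h2 : 2 ≤ (pos φ st.V).card) :
    mst P Q (upd H st φ) ≤ mst P Q st ∧
      ((upd H st φ).T = none → mst P Q (upd H st φ) ≤ mst P Q st - 1) := by
  have e1 := upd_V_card H st hφ
  have e2 := upd_W_card hor st hφ
  have hJ := jn_ne hne
  have hA := jn_pos (H := H) (φ := φ) hI
  have hSI := hS _ (filter_subset _ _) _ hA hJ
  have hWI := hW _ (filter_subset _ _) _ hA
  change 3 ≤ (pos φ st.V).card → Q * (jn H φ st.W).card + 2 * P < P * (pos φ st.V).card + Q at hSI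
  change (jn H φ st.W).Nonempty → Q * (jn H φ st.W).card + 2 * P ≤ P * (pos φ st.V).card + Q at hWI
  have hT : (upd H st φ).T = none → ¬ ((pos φ st.V).card = 2 ∧ (jn H φ st.W).card = 1) := by
    intro h h'; simp [upd, h'] at h
  rw [← card_pos] at hWI
  simp only [mst]
  generalize (pos φ st.V).card = A at *
  generalize (jn H φ st.W).card = J at *
  generalize (upd H st φ).V.card = V' at *
  generalize (upd H st φ).W.card = W' at *
  generalize st.V.card = V0 at *
  generalize st.W.card = W0 at *
  generalize (arcs H).card = E at *
  have e1 : (V' : ℤ) = V0 + t - A := by omega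
  have e2 : (W' : ℤ) = W0 + E - J := by omega
  have hB1 : (P : ℤ) * t + Q = Q * E + 2 * P := by exact_mod_cast hB1
  have hQ : (0 : ℤ) < Q := by exact_mod_cast hQ
  rw [e1, e2]
  have hexp : (P : ℤ) * (V0 + t - A) - Q * (W0 + E - J) = P * V0 - Q * W0 + (Q * J + 2 * P - P * A - Q) := by
    linear_combination hB1
  rw [hexp]
  by_cases hA3 : 3 ≤ A
  · have : (Q : ℤ) * J + 2 * P < P * A + Q := by exact_mod_cast hSI hA3
    constructor
    · linarith
    · intro _; linarith
  · have hA2 : A = 2 := by omega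
    subst hA2
    rcases Nat.eq_zero_or_pos J with h0 | h0
    · subst h0
      constructor
      · push_cast; linarith
      · intro _; push_cast; linarith
    · have h3 : (Q : ℤ) * J + 2 * P ≤ P * 2 + Q := by exact_mod_cast hWI h0
      refine ⟨by push_cast; linarith, fun h => ?_⟩
      have : J ≠ 1 := fun h' => hT h ⟨rfl, h'⟩
      have : (2 : ℤ) ≤ J := by omega
      nlinarith

end ORam

namespace ORam
open Finset
open scoped Classical

theorem sum_phi (t n : ℕ) (U : Finset (Fin n)) :
    ∑ φ : Fin t → Fin n, ((n : ℝ)⁻¹) ^ (t - (pos φ U).card) ≤ ((U.card : ℝ) + 1) ^ t := by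
  have h1 : ∀ φ : Fin t → Fin n, ((n : ℝ)⁻¹) ^ (t - (pos φ U).card) =
      ∏ a, (if φ a ∈ U then (1 : ℝ) else (n : ℝ)⁻¹) := by
    intro φ
    rw [prod_ite, prod_const_one, one_mul, prod_const]
    congr 1
    have := card_filter_add_card_filter_not (s := (univ : Finset (Fin t))) (fun a => φ a ∈ U)
    rw [card_univ, Fintype.card_fin] at this
    have h2 : (pos φ U).card = (univ.filter (fun a => φ a ∈ U)).card := rfl
    omega
  rw [sum_congr rfl fun φ _ => h1 φ]
  have h2 := Finset.prod_univ_sum (fun _ : Fin t => (univ : Finset (Fin n)))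
    (fun _ x => if x ∈ U then (1 : ℝ) else (n : ℝ)⁻¹)
  rw [Fintype.piFinset_univ] at h2
  rw [← h2, prod_const, card_univ, Fintype.card_fin]
  apply pow_le_pow_left₀ (sum_nonneg fun x _ => by split_ifs <;> positivity)
  rw [sum_ite, sum_const, sum_const, nsmul_eq_mul, nsmul_eq_mul, mul_one]
  have h3 : univ.filter (fun x => x ∈ U) = U := by ext; simp
  rw [h3]
  have h4 : ((univ.filter (fun x => x ∉ U)).card : ℝ) ≤ n := by
    exact_mod_cast (card_le_univ _).trans (by simp)
  have : ((univ.filter (fun x => x ∉ U)).card : ℝ) * (n : ℝ)⁻¹ ≤ 1 := by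
    rw [← div_eq_mul_inv]; exact div_le_one_of_le₀ h4 (by positivity)
  linarith

theorem poly_le (t x : ℕ) : ((x : ℝ) + 1) ^ t ≤ (t.factorial * 2 ^ t : ℕ) * 2 ^ x := by
  have h1 := Nat.pow_succ_le_ascFactorial (x + 1) t
  rw [Nat.ascFactorial_eq_factorial_mul_choose] at h1
  have h2 := Nat.choose_le_two_pow (x + t) t
  have h3 : (x + 1) ^ t ≤ t.factorial * 2 ^ t * 2 ^ x := by
    refine h1.trans ((Nat.mul_le_mul_left _ h2).trans (le_of_eq ?_))
    rw [pow_add]; ring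
  exact_mod_cast h3

/-- counter of a state -/
noncomputable def bst {n : ℕ} (P Q : ℕ) (st : St n) : ℕ :=
  2 * (mst P Q st).toNat + if st.T = none then 1 else 0

theorem bad_bound {t n : ℕ} {H : Fin t → Fin t → Prop} (hor : ∀ a b, H a b → ¬ H b a) {P Q : ℕ}
    (hQ : 0 < Q) (hB1 : P * t + Q = Q * (arcs H).card + 2 * P)
    (hS : ∀ J ⊆ arcs H, ∀ A : Finset (Fin t), (∀ a ∈ J, a.1 ∈ A ∧ a.2 ∈ A) → J ≠ arcs H → 3 ≤ A.card →
      Q * J.card + 2 * P < P * A.card + Q)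
    (hW : ∀ J ⊆ arcs H, ∀ A : Finset (Fin t), (∀ a ∈ J, a.1 ∈ A ∧ a.2 ∈ A) → J.Nonempty →
      Q * J.card + 2 * P ≤ P * A.card + Q)
    {p η : ℝ} (h0 : 0 ≤ p) (h1 : p ≤ 1) (hη0 : 0 ≤ η) (hη1 : η ≤ 1)
    (hp0 : ∀ w v : ℕ, P * v ≤ Q * w → p ^ w ≤ η ^ w * ((n : ℝ)⁻¹) ^ v)
    (hp2 : ∀ w v : ℕ, P * v ≤ Q * w + 2 * P → p ^ w ≤ η ^ w * ((n : ℝ)⁻¹) ^ v * (n : ℝ) ^ 2)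
    {K A : ℝ} (hK : K = 2 ^ (t * (4 * P + 1))) (hA : A = K * (t.factorial * 2 ^ t : ℕ))
    (hη : η * (1 + K * ((t : ℝ) + 1) ^ t) ≤ 1 / 4) (k : ℕ) :
    ∀ st : St n, Inv t st → mst P Q st ≤ 2 * P →
      probGnp n p (fun G => Bad H P Q n k st (eF G)) ≤
        η ^ st.W.card * ((n : ℝ)⁻¹) ^ st.V.card * (A * 2 ^ st.V.card) ^ (bst P Q st) *
          (1 + (n : ℝ) ^ 2 / 4 ^ k) := by
  have hK1 : 1 ≤ K := by rw [hK]; exact one_le_pow₀ (by norm_num)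
  have hA1 : 1 ≤ A := by
    have : (1 : ℝ) ≤ (t.factorial * 2 ^ t : ℕ) := by
      exact_mod_cast Nat.mul_pos (Nat.factorial_pos _) (by positivity)
    rw [hA]; nlinarith
  have hA2 : ∀ x : ℕ, 1 ≤ A * 2 ^ x := fun x => by
    have : (1 : ℝ) ≤ 2 ^ x := one_le_pow₀ (by norm_num)
    nlinarith
  have hbase : ∀ (st : St n) (c : ℝ), 0 ≤ c → p ^ st.W.card ≤ η ^ st.W.card * ((n : ℝ)⁻¹) ^ st.V.card * c →
      probGnp n p (fun G => st.W ⊆ eF G) ≤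
      η ^ st.W.card * ((n : ℝ)⁻¹) ^ st.V.card * (A * 2 ^ st.V.card) ^ (bst P Q st) * c := by
    intro st c hc h
    refine (pr_sub_le h0 _).trans (h.trans ?_)
    have := one_le_pow₀ (n := bst P Q st) (hA2 st.V.card)
    refine mul_le_mul_of_nonneg_right ?_ hc
    exact le_mul_of_one_le_right (by positivity) this
  induction k with
  | zero =>
    intro st hI hM
    simp only [Bad, pow_zero, div_one]
    apply hbase _ _ (by positivity)
    have hM' : P * st.V.card ≤ Q * st.W.card + 2 * P := by
      simp only [mst] at hM; zify; linarith
    refine (hp2 _ _ hM').trans ?_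
    refine mul_le_mul_of_nonneg_left (by linarith) (by positivity)
  | succ k ih =>
    intro st hI hM
    by_cases hM0 : mst P Q st ≤ 0
    · have e : (fun G : SimpleGraph (Fin n) => Bad H P Q n (k + 1) st (eF G)) = fun G => st.W ⊆ eF G := by
        funext G; simp only [Bad, hM0, true_and, not_lt.2 hM0, false_and, or_false]
      rw [e]
      apply hbase _ _ (by positivity)
      have hM' : P * st.V.card ≤ Q * st.W.card := by
        simp only [mst] at hM0; zify; linarith
      refine (hp0 _ _ hM').trans ?_
      apply le_mul_of_one_le_right (by positivity)
      have : 0 ≤ (n : ℝ) ^ 2 / 4 ^ (k + 1) := by positivity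
      linarith
    · have e : (fun G : SimpleGraph (Fin n) => Bad H P Q n (k + 1) st (eF G)) =
          fun G => ∃ φ ∈ nxt H st, Bad H P Q n k (upd H st φ) (eF G) := by
        funext G; simp only [Bad, hM0, false_and, not_le.1 hM0, true_and, false_or]
      rw [e]
      set g := 1 + (n : ℝ) ^ 2 / 4 ^ k with hg
      have hg0 : 0 ≤ g := by positivity
      set x := st.V.card with hx
      set B := η ^ st.W.card * ((n : ℝ)⁻¹) ^ x * (A * 2 ^ x) ^ (bst P Q st) * g with hB
      have hB0 : 0 ≤ B := by positivity
      have hAx := hA2 x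
      set T0 := st.T.getD ∅ with hT0
      have hterm : ∀ φ ∈ nxt H st, probGnp n p (fun G => Bad H P Q n k (upd H st φ) (eF G)) ≤
          η * B * (K / (A * 2 ^ x) * ((n : ℝ)⁻¹) ^ (t - (pos φ st.V).card) +
            K * ((n : ℝ)⁻¹) ^ (t - (pos φ T0).card)) := by
        intro φ hφ
        obtain ⟨hinj, hns, hp2', hTT⟩ := (mem_filter.1 hφ).2
        obtain ⟨m1, m2⟩ := mst_upd hor hQ hB1 hS hW hI.1 hinj hns hp2'
        have hih := ih _ (inv_upd H hI φ) (m1.trans hM)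
        refine hih.trans ?_
        have hV := upd_V_card H st hinj
        have hpt : (pos φ st.V).card ≤ t := (card_le_univ _).trans (by simp)
        have hV' : (upd H st φ).V.card = x + (t - (pos φ st.V).card) := by omega
        have hWc := upd_W_card hor st hinj
        have hJl : (jn H φ st.W).card < (arcs H).card :=
          card_lt_card ((filter_subset _ _).ssubset_of_ne (jn_ne hns))
        have hηW : η ^ (upd H st φ).W.card ≤ η ^ st.W.card * η := by
          rw [← pow_succ]; exact pow_le_pow_of_le_one hη0 hη1 (by omega)
        have hnn : (0 : ℝ) ≤ (n : ℝ)⁻¹ := by positivity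
        have hb' : bst P Q (upd H st φ) ≤ 4 * P + 1 := by
          unfold bst
          have : mst P Q (upd H st φ) ≤ 2 * P := m1.trans hM
          split_ifs <;> omega
        set b' := bst P Q (upd H st φ) with hb'd
        have hpw : (A * 2 ^ (upd H st φ).V.card) ^ b' ≤ (A * 2 ^ x) ^ b' * K := by
          rw [hV', hK, pow_add, ← mul_assoc, mul_pow]
          refine mul_le_mul_of_nonneg_left ?_ (by positivity)
          rw [← pow_mul]
          refine pow_le_pow_right₀ (by norm_num) ?_
          exact Nat.mul_le_mul (by omega) hb'
        have hmain : η ^ (upd H st φ).W.card * ((n : ℝ)⁻¹) ^ (upd H st φ).V.card *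
            (A * 2 ^ (upd H st φ).V.card) ^ b' * g ≤
            (η ^ st.W.card * η) * (((n : ℝ)⁻¹) ^ x * ((n : ℝ)⁻¹) ^ (t - (pos φ st.V).card)) *
              ((A * 2 ^ x) ^ b' * K) * g := by
          rw [hV', ← pow_add] at *
          gcongr
        refine hmain.trans ?_
        by_cases hcase : b' + 1 ≤ bst P Q st
        · have hle : (A * 2 ^ x) ^ b' * (A * 2 ^ x) ≤ (A * 2 ^ x) ^ (bst P Q st) := by
            rw [← pow_succ]; exact pow_le_pow_right₀ hAx hcase
          have hle' : (A * 2 ^ x) ^ b' ≤ (A * 2 ^ x) ^ (bst P Q st) / (A * 2 ^ x) := by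
            rwa [le_div_iff₀ (by linarith)]
          calc _ ≤ (η ^ st.W.card * η) * (((n : ℝ)⁻¹) ^ x * ((n : ℝ)⁻¹) ^ (t - (pos φ st.V).card)) *
              ((A * 2 ^ x) ^ (bst P Q st) / (A * 2 ^ x) * K) * g := by gcongr
            _ = η * B * (K / (A * 2 ^ x) * ((n : ℝ)⁻¹) ^ (t - (pos φ st.V).card)) := by
                rw [hB]; ring
            _ ≤ _ := by
                refine mul_le_mul_of_nonneg_left ?_ (by positivity)
                have : 0 ≤ K * ((n : ℝ)⁻¹) ^ (t - (pos φ T0).card) := by positivity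
                linarith
        · have hM1 : 1 ≤ mst P Q st := by omega
          have hboth : st.T ≠ none ∧ (upd H st φ).T ≠ none ∧ b' ≤ bst P Q st := by
            unfold bst at hcase hb'd ⊢
            rw [hb'd] at hcase ⊢
            by_cases c1 : st.T = none <;> by_cases c2 : (upd H st φ).T = none
            · have := m2 c2; simp only [c1, c2, if_true] at hcase; omega
            · simp only [c1, c2, if_true, if_false] at hcase; omega
            · have := m2 c2; simp only [c1, c2, if_true, if_false] at hcase; omega
            · refine ⟨c1, c2, ?_⟩
              simp only [c1, c2, if_false]; omega
          obtain ⟨c1, c2, c3⟩ := hboth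
          obtain ⟨T, hT⟩ := Option.ne_none_iff_exists'.1 c1
          have hTT0 : T0 = T := by rw [hT0, hT]; rfl
          have hcard2 : (pos φ st.V).card = 2 := by
            by_contra hcon
            apply c2
            simp [upd, hcon]
          have hposT : (pos φ T0).card = (pos φ st.V).card := by
            apply le_antisymm
            · apply card_le_card
              intro a ha
              simp only [pos, mem_filter, mem_univ, true_and] at ha ⊢
              exact (hI.2 T hT).1 (hTT0 ▸ ha)
            · rw [hcard2, hTT0]; exact hTT T hT
          rw [hposT]
          have hle : (A * 2 ^ x) ^ b' ≤ (A * 2 ^ x) ^ (bst P Q st) := pow_le_pow_right₀ hAx c3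
          calc _ ≤ (η ^ st.W.card * η) * (((n : ℝ)⁻¹) ^ x * ((n : ℝ)⁻¹) ^ (t - (pos φ st.V).card)) *
              ((A * 2 ^ x) ^ (bst P Q st) * K) * g := by gcongr
            _ = η * B * (K * ((n : ℝ)⁻¹) ^ (t - (pos φ st.V).card)) := by
                rw [hB]; ring
            _ ≤ _ := by
                refine mul_le_mul_of_nonneg_left ?_ (by positivity)
                have : 0 ≤ K / (A * 2 ^ x) * ((n : ℝ)⁻¹) ^ (t - (pos φ st.V).card) := by positivity
                linarith
      have hT0c : T0.card ≤ t := by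
        rcases hc : st.T with _ | T
        · simp [hT0, hc]
        · rw [hT0, hc]; exact (hI.2 T hc).2
      calc _ ≤ ∑ φ ∈ nxt H st, probGnp n p (fun G => Bad H P Q n k (upd H st φ) (eF G)) := pr_union h0 h1 _ _
        _ ≤ ∑ φ ∈ nxt H st, η * B * (K / (A * 2 ^ x) * ((n : ℝ)⁻¹) ^ (t - (pos φ st.V).card) +
            K * ((n : ℝ)⁻¹) ^ (t - (pos φ T0).card)) := sum_le_sum hterm
        _ ≤ ∑ φ : Fin t → Fin n, η * B * (K / (A * 2 ^ x) * ((n : ℝ)⁻¹) ^ (t - (pos φ st.V).card) +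
            K * ((n : ℝ)⁻¹) ^ (t - (pos φ T0).card)) :=
            sum_le_sum_of_subset_of_nonneg (subset_univ _) fun _ _ _ => by positivity
        _ = η * B * (K / (A * 2 ^ x) * (∑ φ : Fin t → Fin n, ((n : ℝ)⁻¹) ^ (t - (pos φ st.V).card)) +
            K * ∑ φ : Fin t → Fin n, ((n : ℝ)⁻¹) ^ (t - (pos φ T0).card)) := by
            rw [← mul_sum, sum_add_distrib, ← mul_sum, ← mul_sum]
        _ ≤ η * B * (1 + K * ((t : ℝ) + 1) ^ t) := by
            refine mul_le_mul_of_nonneg_left ?_ (by positivity)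
            apply add_le_add
            · calc _ ≤ K / (A * 2 ^ x) * ((x : ℝ) + 1) ^ t := by
                    refine mul_le_mul_of_nonneg_left (sum_phi t n st.V) (by positivity)
                _ ≤ K / (A * 2 ^ x) * ((t.factorial * 2 ^ t : ℕ) * 2 ^ x) := by
                    refine mul_le_mul_of_nonneg_left (poly_le t x) (by positivity)
                _ = 1 := by
                    rw [div_mul_eq_mul_div, div_eq_one_iff_eq (by positivity), hA]; ring
            · refine mul_le_mul_of_nonneg_left ((sum_phi t n T0).trans ?_) (by positivity)
              have : (T0.card : ℝ) ≤ t := by exact_mod_cast hT0c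
              gcongr
        _ = B * (η * (1 + K * ((t : ℝ) + 1) ^ t)) := by ring
        _ ≤ B * (1 / 4) := mul_le_mul_of_nonneg_left hη hB0
        _ = η ^ st.W.card * ((n : ℝ)⁻¹) ^ x * (A * 2 ^ x) ^ (bst P Q st) * (g / 4) := by rw [hB]; ring
        _ ≤ _ := by
            refine mul_le_mul_of_nonneg_left ?_ (by positivity)
            rw [hg, pow_succ (4 : ℝ) k, ← div_div]
            linarith

end ORam

namespace ORam
open Finset
open scoped Classical

/-- support of a graph -/
noncomputable def supp {n : ℕ} (G : SimpleGraph (Fin n)) : Finset (Fin n) := univ.filter (fun v => ∃ w, G.Adj v w)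

theorem em_sub {t n : ℕ} {H : Fin t → Fin t → Prop} {G : SimpleGraph (Fin n)} {f : Fin t → Fin n}
    (hf : UCopy G H f) : em H f ⊆ eF G := by
  intro e he
  obtain ⟨a, b, hab, rfl⟩ := mem_em.1 he
  rw [mem_eF]; exact hf.2 a b hab

theorem next_copy {t n : ℕ} {H : Fin t → Fin t → Prop} {G : SimpleGraph (Fin n)} (hm : MinArr G H)
    {W : Finset (Sym2 (Fin n))} (hW : W ⊆ eF G) (hne : W.Nonempty) (hWG : W ≠ eF G) :
    ∃ f, UCopy G H f ∧ ¬ em H f ⊆ W ∧ ∃ a b, H a b ∧ s(f a, f b) ∈ W := by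
  by_contra hcon
  push Not at hcon
  obtain ⟨e, he⟩ := hne
  obtain ⟨e', he', hn'⟩ := exists_of_ssubset (hW.ssubset_of_ne hWG)
  refine separation hm {e | e ∈ W} ⟨e, he, (mem_eF _ _).1 (hW he)⟩ ⟨e', hn', (mem_eF _ _).1 he'⟩ ?_
  intro f hf a b hab hR a' b' hab'
  by_contra hn
  refine hcon f hf (fun h => hn (h (mem_em.2 ⟨a', b', hab', rfl⟩))) a b hab hR

theorem two_pos {t n : ℕ} {H : Fin t → Fin t → Prop} {G : SimpleGraph (Fin n)} {f : Fin t → Fin n}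
    (hf : UCopy G H f) {V : Finset (Fin n)} {a b : Fin t} (hab : H a b) (ha : f a ∈ V) (hb : f b ∈ V) :
    2 ≤ (pos f V).card := by
  have hne : a ≠ b := fun h => (hf.2 a b hab).ne (by rw [h])
  rw [← card_pair hne]
  apply card_le_card
  intro x hx
  simp only [mem_insert, mem_singleton] at hx
  rcases hx with rfl | rfl <;> simp [pos, ha, hb]

theorem mono_M {t n : ℕ} {H : Fin t → Fin t → Prop} (hor : ∀ a b, H a b → ¬ H b a) {P Q : ℕ}
    (hQ : 0 < Q) (hB1 : P * t + Q = Q * (arcs H).card + 2 * P)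
    (hS : ∀ J ⊆ arcs H, ∀ A : Finset (Fin t), (∀ a ∈ J, a.1 ∈ A ∧ a.2 ∈ A) → J ≠ arcs H → 3 ≤ A.card →
      Q * J.card + 2 * P < P * A.card + Q)
    (hW : ∀ J ⊆ arcs H, ∀ A : Finset (Fin t), (∀ a ∈ J, a.1 ∈ A ∧ a.2 ∈ A) → J.Nonempty →
      Q * J.card + 2 * P ≤ P * A.card + Q)
    {G : SimpleGraph (Fin n)} (hm : MinArr G H) :
    ∀ (m : ℕ) (W : Finset (Sym2 (Fin n))) (V : Finset (Fin n)), W ⊆ eF G → W.Nonempty →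
      (∀ e ∈ W, ∀ x ∈ e, x ∈ V) → (eF G).card ≤ W.card + m →
      (P : ℤ) * (supp G).card - Q * (eF G).card ≤ P * V.card - Q * W.card := by
  intro m
  induction m with
  | zero =>
    intro W V hWG hne hV hc
    have : W = eF G := eq_of_subset_of_card_le hWG (by omega)
    subst this
    have : supp G ⊆ V := by
      intro v hv
      obtain ⟨w, hw⟩ := (mem_filter.1 hv).2
      exact hV s(v, w) ((mem_eF _ _).2 hw) v (by simp)
    have := card_le_card this
    have : (P : ℤ) * (supp G).card ≤ P * V.card := by
      apply mul_le_mul_of_nonneg_left _ (by positivity); exact_mod_cast this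
    linarith
  | succ m ih =>
    intro W V hWG hne hV hc
    by_cases hWe : W = eF G
    · exact ih W V hWG hne hV (by rw [hWe]; omega)
    obtain ⟨f, hf, hns, a, b, hab, habW⟩ := next_copy hm hWG hne hWe
    have h2 : 2 ≤ (pos f V).card := two_pos hf hab (hV _ habW _ (by simp)) (hV _ habW _ (by simp))
    let st : St n := ⟨W, V, none⟩
    have hmu := (mst_upd (st := st) hor hQ hB1 hS hW hV hf.1 hns h2).1
    have hlt : W.card < (upd H st f).W.card := by
      apply card_lt_card
      refine ssubset_of_subset_of_ne subset_union_left fun h => hns ?_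
      change W = W ∪ em H f at h
      rw [h]; exact subset_union_right
    have := ih (upd H st f).W (upd H st f).V (union_subset hWG (em_sub hf)) (hne.mono subset_union_left)
      (inv_upd H (st := st) (t := t) ⟨hV, by simp [st]⟩ f).1 (by omega)
    refine this.trans ?_
    simpa [mst, st] using hmu

theorem reg_copy {t n : ℕ} {H : Fin t → Fin t → Prop} (hac : RelAcyclic H)
    (hor : ∀ a b, H a b → ¬ H b a) (h2 : 2 ≤ (arcs H).card)
    (hNC : ∀ a0 b0, H a0 b0 → ∃ c : Fin t → Fin t → Prop, (∀ a b, H a b ∨ H b a → (c a b ↔ ¬ c b a)) ∧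
      (∀ a b, c a b → H a b ∨ H b a) ∧ c a0 b0 ∧ ∃ x, Relation.TransGen c x x)
    {G : SimpleGraph (Fin n)} (hm : MinArr G H) {φ : Fin t → Fin n} (hφ : UCopy G H φ)
    {W0 : Finset (Sym2 (Fin n))} {a0 b0 : Fin t} (hab0 : H a0 b0)
    (hW0 : em H φ ∩ W0 = {s(φ a0, φ b0)}) :
    ∃ φ', UCopy G H φ' ∧ em H φ' ≠ em H φ ∧ ∃ e ∈ em H φ', e ∈ em H φ ∧ e ∉ W0 := by
  by_contra hcon
  push Not at hcon
  have hcon' : ∀ f, UCopy G H f → ∀ e ∈ em H f, e ∈ em H φ → e ∉ W0 → em H f = em H φ := by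
    intro f hf e he1 he2 he3
    by_contra h
    exact he3 (hcon f hf h e he1 he2)
  have hN : ∃ e ∈ em H φ, e ∉ W0 := by
    by_contra h
    push Not at h
    have : em H φ ∩ W0 = em H φ := inter_eq_left.2 h
    rw [this] at hW0
    have := card_em hor hφ.1
    rw [hW0, card_singleton] at this
    omega
  obtain ⟨e, he1, he2⟩ := hN
  obtain ⟨o1, ho1, hno, hext⟩ := ext_tool hm {e | e ∈ em H φ ∧ e ∉ W0}
    ⟨e, ⟨he1, he2⟩, (mem_eF _ _).1 (em_sub hφ he1)⟩
  have he0 : s(φ a0, φ b0) ∈ em H φ ∩ W0 := by rw [hW0]; simp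
  have hadj0 : (G.deleteEdges {e | e ∈ em H φ ∧ e ∉ W0}).Adj (φ a0) (φ b0) := by
    rw [SimpleGraph.deleteEdges_adj]
    exact ⟨hφ.2 _ _ hab0, fun h => h.2 (mem_inter.1 he0).2⟩
  -- choose the orientation
  obtain ⟨c, hc1, hc2, hc3, x, hx⟩ : ∃ c : Fin t → Fin t → Prop,
      (∀ a b, H a b ∨ H b a → (c a b ↔ ¬ c b a)) ∧ (∀ a b, c a b → H a b ∨ H b a) ∧
      (c a0 b0 ↔ o1 (φ a0) (φ b0)) ∧ ∃ x, Relation.TransGen c x x := by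
    obtain ⟨c, hc1, hc2, hc3, x, hx⟩ := hNC a0 b0 hab0
    by_cases ho : o1 (φ a0) (φ b0)
    · exact ⟨c, hc1, hc2, by simp [ho, hc3], x, hx⟩
    · refine ⟨Function.swap c, fun a b h => hc1 b a h.symm, fun a b h => (hc2 b a h).symm, ?_, x, ?_⟩
      · have := (hc1 a0 b0 (Or.inl hab0)).1 hc3
        simp [Function.swap, ho, this]
      · rwa [Relation.transGen_swap]
  have hcs : ∀ a b, c a b → ¬ c b a := fun a b h => (hc1 a b (hc2 a b h)).1 h
  obtain ⟨f, hf, h3, h4, a, b, hab, habR⟩ := hext (fun x y => ∃ a b, φ a = x ∧ φ b = y ∧ c a b) (by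
    intro u v _ huv
    obtain ⟨a, b, hab, habe⟩ := mem_em.1 huv.1
    have key : ∀ a b, H a b ∨ H b a → ((∃ a' b', φ a' = φ a ∧ φ b' = φ b ∧ c a' b') ↔
        ¬ ∃ a' b', φ a' = φ b ∧ φ b' = φ a ∧ c a' b') := by
      intro a b hab
      have e1 : ∀ a b, (∃ a' b', φ a' = φ a ∧ φ b' = φ b ∧ c a' b') ↔ c a b := by
        intro a b
        constructor
        · rintro ⟨a', b', h1, h2, h3⟩
          rw [hφ.1 h1, hφ.1 h2] at h3; exact h3
        · intro h; exact ⟨a, b, rfl, rfl, h⟩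
      rw [e1, e1]; exact hc1 a b hab
    rw [Sym2.eq_iff] at habe
    rcases habe with ⟨rfl, rfl⟩ | ⟨rfl, rfl⟩
    · exact key a b (Or.inl hab)
    · exact key b a (Or.inr hab))
  have hfe : em H f = em H φ := hcon' f hf _ (mem_em.2 ⟨a, b, hab, rfl⟩) habR.1 habR.2
  have hall : ∀ a b, H a b → ∃ a' b', φ a' = f a ∧ φ b' = f b ∧ c a' b' := by
    intro a b hab
    have hmem : s(f a, f b) ∈ em H φ := hfe ▸ mem_em.2 ⟨a, b, hab, rfl⟩
    by_cases hw : s(f a, f b) ∈ W0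
    · have ho := h4 a b hab (fun h => h.2 hw)
      have : s(f a, f b) ∈ em H φ ∩ W0 := mem_inter.2 ⟨hmem, hw⟩
      rw [hW0, mem_singleton, Sym2.eq_iff] at this
      rcases this with ⟨h5, h6⟩ | ⟨h5, h6⟩
      · rw [h5, h6] at ho ⊢
        exact ⟨a0, b0, rfl, rfl, hc3.2 ho⟩
      · rw [h5, h6] at ho ⊢
        refine ⟨b0, a0, rfl, rfl, ?_⟩
        have : ¬ o1 (φ a0) (φ b0) := fun h => (ho1.2 _ _ hadj0).1 h ho
        rw [← hc3] at this
        have := hc1 a0 b0 (Or.inl hab0)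
        tauto
    · exact h3 a b hab ⟨hmem, hw⟩
  have hback : ∀ a b, c a b → ∃ a' b', f a' = φ a ∧ f b' = φ b ∧ H a' b' := by
    intro a b hab
    have : s(φ a, φ b) ∈ em H f := by
      rw [hfe, mem_em]
      rcases hc2 a b hab with h | h
      · exact ⟨a, b, h, rfl⟩
      · exact ⟨b, a, h, Sym2.eq_swap⟩
    obtain ⟨a', b', hab', he⟩ := mem_em.1 this
    rw [Sym2.eq_iff] at he
    rcases he with ⟨h5, h6⟩ | ⟨h5, h6⟩
    · exact ⟨a', b', h5, h6, hab'⟩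
    · exfalso
      obtain ⟨a2, b2, h7, h8, h9⟩ := hall a' b' hab'
      rw [h5] at h7; rw [h6] at h8
      rw [hφ.1 h7, hφ.1 h8] at h9
      exact hcs _ _ hab h9
  have htr : ∀ x y, Relation.TransGen c x y → ∃ x' y', f x' = φ x ∧ f y' = φ y ∧ Relation.TransGen H x' y' := by
    intro x y hxy
    induction hxy with
    | single h =>
      obtain ⟨a', b', h5, h6, h7⟩ := hback _ _ h
      exact ⟨a', b', h5, h6, .single h7⟩
    | tail _ h ih =>
      obtain ⟨x', y', h5, h6, h7⟩ := ih
      obtain ⟨a', b', h8, h9, h10⟩ := hback _ _ h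
      have : a' = y' := hf.1 (h8.trans h6.symm)
      subst this
      exact ⟨x', b', h5, h9, h7.tail h10⟩
  obtain ⟨x', y', h5, h6, h7⟩ := htr x x hx
  have : x' = y' := hf.1 (h5.trans h6.symm)
  subst this
  exact hac _ h7

theorem count2 {t n : ℕ} {H : Fin t → Fin t → Prop} (hor : ∀ a b, H a b → ¬ H b a) {P Q : ℕ}
    (hQ : 0 < Q) (hPQ : Q < P) (h2 : 2 ≤ (arcs H).card) (hB1 : P * t + Q = Q * (arcs H).card + 2 * P)
    (hS : ∀ J ⊆ arcs H, ∀ A : Finset (Fin t), (∀ a ∈ J, a.1 ∈ A ∧ a.2 ∈ A) → J ≠ arcs H → 3 ≤ A.card →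
      Q * J.card + 2 * P < P * A.card + Q)
    (hW : ∀ J ⊆ arcs H, ∀ A : Finset (Fin t), (∀ a ∈ J, a.1 ∈ A ∧ a.2 ∈ A) → J.Nonempty →
      Q * J.card + 2 * P ≤ P * A.card + Q)
    {φ φ' : Fin t → Fin n} (hφ : Function.Injective φ) (hφ' : Function.Injective φ')
    {W0 : Finset (Sym2 (Fin n))} {V0 : Finset (Fin n)} (hV0 : ∀ e ∈ W0, ∀ x ∈ e, x ∈ V0)
    (hpos : (pos φ V0).card = 2) {a0 b0 : Fin t} (hab0 : H a0 b0)
    (hW0 : em H φ ∩ W0 = {s(φ a0, φ b0)}) (hne : em H φ' ≠ em H φ)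
    {e : Sym2 (Fin n)} (he1 : e ∈ em H φ') (he2 : e ∈ em H φ) (he3 : e ∉ W0)
    (hsub : em H φ' ⊆ W0 ∪ em H φ) : False := by
  have hemV : ∀ e ∈ em H φ, ∀ x ∈ e, x ∈ univ.image φ := by
    intro e he x hx
    obtain ⟨a, b, _, rfl⟩ := mem_em.1 he
    rw [Sym2.mem_iff] at hx
    rcases hx with rfl | rfl <;> simp
  have he0 : s(φ a0, φ b0) ∈ em H φ ∩ W0 := by rw [hW0]; simp
  have hn0 : a0 ≠ b0 := by rintro rfl; exact hor _ _ hab0 hab0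
  have hpair : univ.image φ ∩ V0 = {φ a0, φ b0} := by
    symm
    apply eq_of_subset_of_card_le
    · intro x hx
      simp only [mem_insert, mem_singleton] at hx
      have h3 := hV0 _ (mem_inter.1 he0).2
      rcases hx with rfl | rfl
      · exact mem_inter.2 ⟨by simp, h3 _ (by simp)⟩
      · exact mem_inter.2 ⟨by simp, h3 _ (by simp)⟩
    · rw [card_pos_im hφ, hpos, card_pair (fun h => hn0 (hφ h))]
  set J1 := jn H φ' (em H φ) with hJ1
  set J2 := jn H φ' W0 with hJ2
  set A1 := pos φ' (univ.image φ) with hA1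
  set A2 := pos φ' V0 with hA2
  have hE : J1 ∪ J2 = arcs H := by
    apply Subset.antisymm (union_subset (filter_subset _ _) (filter_subset _ _))
    intro a ha
    have : ev φ' a ∈ em H φ' := mem_image_of_mem _ ha
    rcases mem_union.1 (hsub this) with h | h
    · exact mem_union_right _ (mem_filter.2 ⟨ha, h⟩)
    · exact mem_union_left _ (mem_filter.2 ⟨ha, h⟩)
  have hcJ := card_union_add_card_inter J1 J2
  rw [hE] at hcJ
  have hJi : J1 ∩ J2 = jn H φ' {s(φ a0, φ b0)} := by
    rw [← hW0]; ext a; simp only [hJ1, hJ2, jn, mem_inter, mem_filter]; tauto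
  have hd : (J1 ∩ J2).card = if s(φ a0, φ b0) ∈ em H φ' then 1 else 0 := by
    rw [hJi, ← card_jn hor hφ']
    split_ifs with h
    · rw [inter_singleton_of_mem h, card_singleton]
    · rw [inter_singleton_of_notMem h, card_empty]
  have hcA := card_union_add_card_inter A1 A2
  have hAt : (A1 ∪ A2).card ≤ t := (card_le_univ _).trans (by simp)
  have hAi : A1 ∩ A2 = pos φ' {φ a0, φ b0} := by
    rw [← hpair]; ext a; simp only [hA1, hA2, pos, mem_inter, mem_filter]; tauto
  have hs : (A1 ∩ A2).card = (univ.image φ' ∩ {φ a0, φ b0}).card := by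
    rw [hAi, ← card_pos_im hφ']
  have hs2 : (A1 ∩ A2).card ≤ 2 := by
    rw [hs]; exact (card_le_card inter_subset_right).trans card_le_two
  have hj1 : J1.Nonempty := by
    obtain ⟨a, ha, rfl⟩ := mem_image.1 he1
    exact ⟨a, mem_filter.2 ⟨ha, he2⟩⟩
  have hj2 : J2.Nonempty := by
    by_contra h
    rw [not_nonempty_iff_eq_empty] at h
    rw [h, union_empty] at hE
    apply hne
    apply eq_of_subset_of_card_le
    · by_contra hc
      exact jn_ne hc hE
    · rw [card_em hor hφ, card_em hor hφ']
  have hJ1n : J1 ≠ arcs H := by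
    apply jn_ne
    intro h
    exact hne (eq_of_subset_of_card_le h (by rw [card_em hor hφ, card_em hor hφ']))
  have hJ2n : J2 ≠ arcs H := jn_ne fun h => he3 (h he1)
  have w1 := hW J1 (filter_subset _ _) A1 (jn_pos hemV) hj1
  have w2 := hW J2 (filter_subset _ _) A2 (jn_pos hV0) hj2
  have s1 := hS J1 (filter_subset _ _) A1 (jn_pos hemV) hJ1n
  have s2 := hS J2 (filter_subset _ _) A2 (jn_pos hV0) hJ2n
  have hj1c := card_pos.2 hj1
  have hj2c := card_pos.2 hj2
  have hsum : P * A1.card + P * A2.card ≤ P * t + P * (A1 ∩ A2).card := by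
    rw [← mul_add, ← mul_add]; exact Nat.mul_le_mul_left _ (by omega)
  have hsumJ : Q * J1.card + Q * J2.card = Q * (arcs H).card + Q * (J1 ∩ J2).card := by
    rw [← mul_add, ← mul_add]; congr 1; omega
  by_cases hc : s(φ a0, φ b0) ∈ em H φ'
  · rw [if_pos hc] at hd
    rw [hd] at hsumJ hcJ
    have hss : P * (A1 ∩ A2).card ≤ P * 2 := Nat.mul_le_mul_left _ hs2
    by_cases h3 : 3 ≤ A1.card
    · have := s1 h3; omega
    by_cases h4 : 3 ≤ A2.card
    · have := s2 h4; omega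
    have hx1 : P * A1.card ≤ P * 2 := Nat.mul_le_mul_left _ (by omega)
    have hx2 : P * A2.card ≤ P * 2 := Nat.mul_le_mul_left _ (by omega)
    have hy1 : J1.card ≤ 1 := by
      have : Q * J1.card ≤ Q * 1 := by omega
      exact Nat.le_of_mul_le_mul_left this hQ
    have hy2 : J2.card ≤ 1 := by
      have : Q * J2.card ≤ Q * 1 := by omega
      exact Nat.le_of_mul_le_mul_left this hQ
    omega
  · rw [if_neg hc] at hd
    rw [hd] at hsumJ hcJ
    by_cases hs1 : (A1 ∩ A2).card ≤ 1
    · have hss : P * (A1 ∩ A2).card ≤ P * 1 := Nat.mul_le_mul_left _ hs1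
      omega
    have hs2' : (A1 ∩ A2).card = 2 := by omega
    have hin : ({φ a0, φ b0} : Finset (Fin n)) ⊆ univ.image φ' := by
      rw [hs] at hs2'
      have : univ.image φ' ∩ {φ a0, φ b0} = {φ a0, φ b0} :=
        eq_of_subset_of_card_le inter_subset_right (by rw [hs2']; exact card_le_two)
      rw [← this]; exact inter_subset_left
    by_cases h4 : 3 ≤ A2.card
    · have s2' := s2 h4
      have hcJ1 : (jn H φ (em H φ' ∪ {s(φ a0, φ b0)})).card = J1.card + 1 := by
        rw [← card_jn hor hφ, inter_union_distrib_left, card_union_of_disjoint, inter_comm,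
          card_jn hor hφ', inter_singleton_of_mem (mem_inter.1 he0).1, card_singleton]
        rw [inter_singleton_of_mem (mem_inter.1 he0).1, disjoint_singleton_right]
        exact fun h => hc (mem_inter.1 h).2
      have hcA1 : (pos φ (univ.image φ')).card = A1.card := by
        rw [← card_pos_im hφ, inter_comm, card_pos_im hφ']
      have w3 := hW (jn H φ (em H φ' ∪ {s(φ a0, φ b0)})) (filter_subset _ _) (pos φ (univ.image φ'))
        (jn_pos (by
          intro e he x hx
          rcases mem_union.1 he with he | he
          · obtain ⟨a, b, _, rfl⟩ := mem_em.1 he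
            rw [Sym2.mem_iff] at hx
            rcases hx with rfl | rfl <;> simp
          · rw [mem_singleton] at he
            subst he
            apply hin
            simpa using hx)) (card_pos.1 (by omega))
      rw [hcJ1, hcA1] at w3
      have hss : P * (A1 ∩ A2).card ≤ P * 2 := Nat.mul_le_mul_left _ hs2
      have : Q * (J1.card + 1) = Q * J1.card + Q := by ring
      omega
    · have hAA : A1 ∩ A2 = A2 := eq_of_subset_of_card_le inter_subset_right (by omega)
      obtain ⟨⟨a, b⟩, ha⟩ := hj2
      have hp := jn_pos hV0 _ ha
      have hav := (mem_filter.1 ha).1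
      rw [← hA2, ← hAA, hAi] at hp
      simp only [pos, mem_filter, mem_univ, true_and, mem_insert, mem_singleton] at hp
      have hab : H a b := by simpa [arcs] using hav
      have hnab : a ≠ b := by rintro rfl; exact hor _ _ hab hab
      apply hc
      refine mem_em.2 ⟨a, b, hab, ?_⟩
      rw [Sym2.eq_iff]
      have hnab' : φ' a ≠ φ' b := fun h => hnab (hφ' h)
      rcases hp with ⟨h1 | h1, h2 | h2⟩
      · exact absurd (h1.trans h2.symm) hnab'
      · exact Or.inl ⟨h1, h2⟩
      · exact Or.inr ⟨h1, h2⟩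
      · exact absurd (h1.trans h2.symm) hnab'

end ORam

namespace ORam
open Finset
open scoped Classical

/-- deterministic invariant of the exploration -/
def DInv {t n : ℕ} (H : Fin t → Fin t → Prop) (G : SimpleGraph (Fin n)) (st : St n) : Prop :=
  st.W ⊆ eF G ∧ st.W.Nonempty ∧ (∀ e ∈ st.W, ∀ x ∈ e, x ∈ st.V) ∧ st.V ⊆ supp G ∧
  ∀ T, st.T = some T → ∃ (W0 : Finset (Sym2 (Fin n))) (V0 : Finset (Fin n)) (φ : Fin t → Fin n) (a0 b0 : Fin t),
    UCopy G H φ ∧ st.W = W0 ∪ em H φ ∧ st.V = V0 ∪ univ.image φ ∧ T = univ.image φ ∧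
    (pos φ V0).card = 2 ∧ H a0 b0 ∧ em H φ ∩ W0 = {s(φ a0, φ b0)} ∧ ∀ e ∈ W0, ∀ x ∈ e, x ∈ V0

theorem im_supp {t n : ℕ} {H : Fin t → Fin t → Prop} (hcov : ∀ a, ∃ b, H a b ∨ H b a)
    {G : SimpleGraph (Fin n)} {φ : Fin t → Fin n} (hφ : UCopy G H φ) : univ.image φ ⊆ supp G := by
  intro x hx
  obtain ⟨a, _, rfl⟩ := mem_image.1 hx
  obtain ⟨b, hb⟩ := hcov a
  refine mem_filter.2 ⟨mem_univ _, φ b, ?_⟩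
  rcases hb with h | h
  · exact hφ.2 _ _ h
  · exact (hφ.2 _ _ h).symm

theorem dinv_upd {t n : ℕ} {H : Fin t → Fin t → Prop} (hor : ∀ a b, H a b → ¬ H b a)
    (hcov : ∀ a, ∃ b, H a b ∨ H b a)
    {G : SimpleGraph (Fin n)} {st : St n} (hD : DInv H G st) {φ : Fin t → Fin n} (hφ : UCopy G H φ) :
    DInv H G (upd H st φ) := by
  obtain ⟨d1, d2, d3, d4, d5⟩ := hD
  refine ⟨union_subset d1 (em_sub hφ), d2.mono subset_union_left, ?_, union_subset d4 (im_supp hcov hφ), ?_⟩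
  · intro e he x hx
    simp only [upd, mem_union] at he ⊢
    rcases he with he | he
    · exact Or.inl (d3 e he x hx)
    · right
      obtain ⟨a, b, _, rfl⟩ := mem_em.1 he
      rw [Sym2.mem_iff] at hx
      rcases hx with rfl | rfl <;> simp
  · intro T hT
    simp only [upd] at hT
    split_ifs at hT with h
    simp only [Option.some.injEq] at hT
    obtain ⟨h2, h1⟩ := h
    have h1' := h1
    rw [← card_jn hor hφ.1] at h1
    obtain ⟨e, he⟩ := card_eq_one.1 h1
    have he' : e ∈ em H φ ∩ st.W := by rw [he]; simp
    obtain ⟨a, b, hab, rfl⟩ := mem_em.1 (mem_inter.1 he').1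
    exact ⟨st.W, st.V, φ, a, b, hφ, rfl, rfl, hT.symm, h2, hab, he, d3⟩

theorem det_main {t : ℕ} {H : Fin t → Fin t → Prop} (hac : RelAcyclic H) (hor : ∀ a b, H a b → ¬ H b a)
    (hcov : ∀ a, ∃ b, H a b ∨ H b a) {P Q : ℕ}
    (hQ : 0 < Q) (hPQ : Q < P) (h2 : 2 ≤ (arcs H).card) (hB1 : P * t + Q = Q * (arcs H).card + 2 * P)
    (hS : ∀ J ⊆ arcs H, ∀ A : Finset (Fin t), (∀ a ∈ J, a.1 ∈ A ∧ a.2 ∈ A) → J ≠ arcs H → 3 ≤ A.card →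
      Q * J.card + 2 * P < P * A.card + Q)
    (hW : ∀ J ⊆ arcs H, ∀ A : Finset (Fin t), (∀ a ∈ J, a.1 ∈ A ∧ a.2 ∈ A) → J.Nonempty →
      Q * J.card + 2 * P ≤ P * A.card + Q)
    (hNC : ∀ a0 b0, H a0 b0 → ∃ c : Fin t → Fin t → Prop, (∀ a b, H a b ∨ H b a → (c a b ↔ ¬ c b a)) ∧
      (∀ a b, c a b → H a b ∨ H b a) ∧ c a0 b0 ∧ ∃ x, Relation.TransGen c x x)
    (hDL : ∀ (n : ℕ) (G : SimpleGraph (Fin n)), MinArr G H → ∃ (W : Finset (Sym2 (Fin n))) (V : Finset (Fin n)),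
      W ⊆ eF G ∧ W.Nonempty ∧ (∀ e ∈ W, ∀ x ∈ e, x ∈ V) ∧ P * V.card ≤ Q * W.card)
    {n : ℕ} {G0 : SimpleGraph (Fin n)} (harr : Arrows G0 H) (k : ℕ) :
    ∃ φ : Fin t → Fin n, Function.Injective φ ∧ Bad H P Q n k ⟨em H φ, univ.image φ, none⟩ (eF G0) := by
  obtain ⟨G, hG, hm⟩ := exists_min G0 H harr
  obtain ⟨W1, V1, hW1, hW1n, hV1, hd⟩ := hDL n G hm
  have hMG : (P : ℤ) * (supp G).card - Q * (eF G).card ≤ 0 := by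
    have := mono_M hor hQ hB1 hS hW hm (eF G).card W1 V1 hW1 hW1n hV1 (by omega)
    have : (P : ℤ) * V1.card ≤ Q * W1.card := by exact_mod_cast hd
    linarith
  have key : ∀ k (st : St n), DInv H G st → Bad H P Q n k st (eF G0) := by
    intro k
    induction k with
    | zero => intro st hD; exact hD.1.trans (eF_mono hG)
    | succ k ih =>
      intro st hD
      simp only [Bad]
      by_cases hM : mst P Q st ≤ 0
      · exact Or.inl ⟨hM, hD.1.trans (eF_mono hG)⟩
      right
      refine ⟨by omega, ?_⟩
      obtain ⟨f, hf, hmem⟩ : ∃ f, UCopy G H f ∧ f ∈ nxt H st := by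
        rcases hT : st.T with _ | T
        · have hWe : st.W ≠ eF G := by
            intro h
            apply hM
            have := card_le_card hD.2.2.2.1
            have : (P : ℤ) * st.V.card ≤ P * (supp G).card := by
              apply mul_le_mul_of_nonneg_left _ (by positivity); exact_mod_cast this
            simp only [mst, h]; linarith
          obtain ⟨f, hf, hns, a, b, hab, habW⟩ := next_copy hm hD.1 hD.2.1 hWe
          refine ⟨f, hf, mem_filter.2 ⟨mem_univ _, hf.1, hns,
            two_pos hf hab (hD.2.2.1 _ habW _ (by simp)) (hD.2.2.1 _ habW _ (by simp)), by simp [hT]⟩⟩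
        · obtain ⟨W0, V0, φ, a0, b0, hφ, hW', hV', hTe, hp, hab0, hW0, hV0⟩ := hD.2.2.2.2 T hT
          obtain ⟨f, hf, hne, e, he1, he2, he3⟩ := reg_copy hac hor h2 hNC hm hφ hab0 hW0
          have hns : ¬ em H f ⊆ st.W := by
            intro h
            rw [hW'] at h
            exact count2 hor hQ hPQ h2 hB1 hS hW hφ.1 hf.1 hV0 hp hab0 hW0 hne he1 he2 he3 h
          obtain ⟨a, b, hab, rfl⟩ := mem_em.1 he1
          have hin : f a ∈ univ.image φ ∧ f b ∈ univ.image φ := by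
            obtain ⟨c, d, _, hcd⟩ := mem_em.1 he2
            rw [Sym2.eq_iff] at hcd
            rcases hcd with ⟨h3, h4⟩ | ⟨h3, h4⟩ <;> simp [← h3, ← h4]
          refine ⟨f, hf, mem_filter.2 ⟨mem_univ _, hf.1, hns, ?_, ?_⟩⟩
          · rw [hV']
            exact two_pos hf hab (mem_union_right _ hin.1) (mem_union_right _ hin.2)
          · intro T' hT'
            rw [hT, Option.some.injEq] at hT'
            rw [← hT', hTe]
            exact two_pos hf hab hin.1 hin.2
      exact ⟨f, hmem, ih _ (dinv_upd hor hcov hD hf)⟩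
  obtain ⟨f, hf, hfc⟩ := hm.1 (fun u v => G.Adj u v ∧ u < v) ⟨fun u v h => h.1, fun u v h => by
    have := h.ne
    simp only [h, h.symm, true_and, not_lt]
    exact ⟨le_of_lt, fun h => lt_of_le_of_ne h this⟩⟩
  have hfU : UCopy G H f := ⟨hf, fun a b hab => (hfc a b hab).1⟩
  refine ⟨f, hf, key k _ ⟨em_sub hfU, ?_, ?_, im_supp hcov hfU, by simp⟩⟩
  · rw [← card_pos]; simp only; rw [card_em hor hf]; omega
  · intro e he x hx
    obtain ⟨a, b, _, rfl⟩ := mem_em.1 he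
    rw [Sym2.mem_iff] at hx
    rcases hx with rfl | rfl <;> simp

open Filter in
theorem zero_abs {t : ℕ} {H : Fin t → Fin t → Prop} (hac : RelAcyclic H) (hor : ∀ a b, H a b → ¬ H b a)
    (hcov : ∀ a, ∃ b, H a b ∨ H b a) {P Q : ℕ}
    (hQ : 0 < Q) (hPQ : Q < P) (h2 : 2 ≤ (arcs H).card) (hB1 : P * t + Q = Q * (arcs H).card + 2 * P)
    (hS : ∀ J ⊆ arcs H, ∀ A : Finset (Fin t), (∀ a ∈ J, a.1 ∈ A ∧ a.2 ∈ A) → J ≠ arcs H → 3 ≤ A.card →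
      Q * J.card + 2 * P < P * A.card + Q)
    (hW : ∀ J ⊆ arcs H, ∀ A : Finset (Fin t), (∀ a ∈ J, a.1 ∈ A ∧ a.2 ∈ A) → J.Nonempty →
      Q * J.card + 2 * P ≤ P * A.card + Q)
    (hNC : ∀ a0 b0, H a0 b0 → ∃ c : Fin t → Fin t → Prop, (∀ a b, H a b ∨ H b a → (c a b ↔ ¬ c b a)) ∧
      (∀ a b, c a b → H a b ∨ H b a) ∧ c a0 b0 ∧ ∃ x, Relation.TransGen c x x)
    (hDL : ∀ (n : ℕ) (G : SimpleGraph (Fin n)), MinArr G H → ∃ (W : Finset (Sym2 (Fin n))) (V : Finset (Fin n)),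
      W ⊆ eF G ∧ W.Nonempty ∧ (∀ e ∈ W, ∀ x ∈ e, x ∈ V) ∧ P * V.card ≤ Q * W.card)
    (p : ℕ → ℝ) (hp : ∀ n, 0 ≤ p n ∧ p n ≤ 1)
    (h : Tendsto (fun n => p n * (n : ℝ) ^ ((Q : ℝ) / P)) atTop (nhds 0)) :
    Tendsto (fun n => probGnp n (p n) (fun G => Arrows G H)) atTop (nhds 0) := by
  obtain ⟨K, hK⟩ : ∃ K : ℝ, K = 2 ^ (t * (4 * P + 1)) := ⟨_, rfl⟩
  obtain ⟨A, hA⟩ : ∃ A : ℝ, A = K * (t.factorial * 2 ^ t : ℕ) := ⟨_, rfl⟩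
  have hK1 : 1 ≤ K := by rw [hK]; exact one_le_pow₀ (by norm_num)
  have hA0 : 0 ≤ A := by rw [hA]; positivity
  set b0 : ℕ := 2 * ((2 * P : ℤ) - Q).toNat + 1 with hb0
  set C := (A * 2 ^ t) ^ b0 * 2 with hC
  have hC0 : 0 ≤ C := by positivity
  have hlim : Tendsto (fun n => C * (p n * (n : ℝ) ^ ((Q : ℝ) / P))) atTop (nhds 0) := by
    simpa using h.const_mul C
  refine squeeze_zero' (Eventually.of_forall fun n => pr_nonneg (hp n).1 (hp n).2 _) ?_ hlim
  have hD : 0 < 1 + K * ((t : ℝ) + 1) ^ t := by positivity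
  have hev := h.eventually_le_const (show (0 : ℝ) < (1 / 4) / (1 + K * ((t : ℝ) + 1) ^ t) by positivity)
  filter_upwards [eventually_ge_atTop 1, hev] with n hn hη
  obtain ⟨h0, h1⟩ := hp n
  have hn1 : (1 : ℝ) ≤ n := by exact_mod_cast hn
  have hn0 : (0 : ℝ) < n := by linarith
  set η := p n * (n : ℝ) ^ ((Q : ℝ) / P) with hηd
  have hη0 : 0 ≤ η := by positivity
  rw [le_div_iff₀ hD] at hη
  have hη1 : η ≤ 1 := by
    have h3 : 1 ≤ 1 + K * ((t : ℝ) + 1) ^ t := by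
      have : 0 ≤ K * ((t : ℝ) + 1) ^ t := by positivity
      linarith
    nlinarith
  have hPpos : (0 : ℝ) < P := by exact_mod_cast (by omega : 0 < P)
  have hpn : p n = η * (n : ℝ) ^ (-((Q : ℝ) / P)) := by
    rw [hηd, mul_assoc, ← Real.rpow_add hn0]; simp
  have hpp : ∀ w v z : ℕ, P * v ≤ Q * w + z * P → p n ^ w ≤ η ^ w * ((n : ℝ)⁻¹) ^ v * (n : ℝ) ^ z := by
    intro w v z hv
    rw [hpn, mul_pow, mul_assoc]
    refine mul_le_mul_of_nonneg_left ?_ (by positivity)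
    rw [← Real.rpow_natCast, ← Real.rpow_mul hn0.le, inv_pow, ← Real.rpow_natCast, ← Real.rpow_neg hn0.le,
      ← Real.rpow_natCast, ← Real.rpow_add hn0]
    apply Real.rpow_le_rpow_of_exponent_le hn1
    have hv' : (P : ℝ) * v ≤ Q * w + z * P := by exact_mod_cast hv
    have : (v : ℝ) ≤ (Q : ℝ) / P * w + z := by
      rw [div_mul_eq_mul_div, ← sub_le_iff_le_add, le_div_iff₀ hPpos]; linarith
    linarith
  have hbad := bad_bound hor hQ hB1 hS hW h0 h1 hη0 hη1
    (fun w v hv => by simpa using hpp w v 0 (by simpa using hv)) (fun w v hv => hpp w v 2 hv) hK hA hη n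
  calc probGnp n (p n) (fun G => Arrows G H)
      ≤ probGnp n (p n) (fun G => ∃ φ ∈ univ.filter (fun φ : Fin t → Fin n => Function.Injective φ),
          Bad H P Q n n ⟨em H φ, univ.image φ, none⟩ (eF G)) := by
        refine pr_mono h0 h1 fun G hG => ?_
        obtain ⟨φ, hφ, hb⟩ := det_main hac hor hcov hQ hPQ h2 hB1 hS hW hNC hDL hG n
        exact ⟨φ, by simpa using hφ, hb⟩
    _ ≤ ∑ φ ∈ univ.filter (fun φ : Fin t → Fin n => Function.Injective φ),
          probGnp n (p n) (fun G => Bad H P Q n n ⟨em H φ, univ.image φ, none⟩ (eF G)) := pr_union h0 h1 _ _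
    _ ≤ ∑ φ ∈ univ.filter (fun φ : Fin t → Fin n => Function.Injective φ), η * ((n : ℝ)⁻¹) ^ t * C := by
        refine sum_le_sum fun φ hφ => ?_
        have hφ : Function.Injective φ := (mem_filter.1 hφ).2
        have hcW : (em H φ).card = (arcs H).card := card_em hor hφ
        have hcV : (univ.image φ).card = t := by rw [card_image_of_injective _ hφ]; simp
        have hmst : mst P Q (⟨em H φ, univ.image φ, none⟩ : St n) = 2 * P - Q := by
          simp only [mst, hcW, hcV]
          have : (P : ℤ) * t + Q = Q * (arcs H).card + 2 * P := by exact_mod_cast hB1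
          linarith
        have hI : Inv t (⟨em H φ, univ.image φ, none⟩ : St n) := by
          refine ⟨?_, by simp⟩
          intro e he x hx
          obtain ⟨a, b, _, rfl⟩ := mem_em.1 he
          rw [Sym2.mem_iff] at hx
          rcases hx with rfl | rfl <;> simp
        refine (hbad _ hI (by rw [hmst]; omega)).trans ?_
        have hb : bst P Q (⟨em H φ, univ.image φ, none⟩ : St n) = b0 := by
          simp only [bst, hmst, hb0, if_true]
        rw [hb]
        simp only [hcW, hcV]
        have hg : 1 + (n : ℝ) ^ 2 / 4 ^ n ≤ 2 := by
          have : (n : ℝ) ^ 2 ≤ 4 ^ n := by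
            have h3 : n < 2 ^ n := Nat.lt_two_pow_self
            have h4 : n ^ 2 ≤ (2 ^ n) ^ 2 := Nat.pow_le_pow_left h3.le 2
            rw [← pow_mul, mul_comm, pow_mul] at h4
            exact_mod_cast h4
          have := div_le_one_of_le₀ this (by positivity)
          linarith
        have hηe : η ^ (arcs H).card ≤ η := pow_le_of_le_one hη0 hη1 (by omega)
        calc _ ≤ η * ((n : ℝ)⁻¹) ^ t * (A * 2 ^ t) ^ b0 * 2 := by gcongr
          _ = _ := by rw [hC]; ring
    _ ≤ _ := by
        rw [sum_const, nsmul_eq_mul]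
        have h3 : ((univ.filter (fun φ : Fin t → Fin n => Function.Injective φ)).card : ℝ) ≤ (n : ℝ) ^ t := by
          have := card_le_univ (univ.filter (fun φ : Fin t → Fin n => Function.Injective φ))
          rw [Fintype.card_fun, Fintype.card_fin, Fintype.card_fin] at this
          exact_mod_cast this
        calc _ ≤ (n : ℝ) ^ t * (η * ((n : ℝ)⁻¹) ^ t * C) := by gcongr
          _ = C * η * ((n : ℝ) ^ t * ((n : ℝ)⁻¹) ^ t) := by ring
          _ = C * η := by rw [← mul_pow, mul_inv_cancel₀ hn0.ne']; simp

end ORam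

namespace ORam
open Finset
open scoped Classical

theorem vert_tool {V β : Type} {G : SimpleGraph V} {H : β → β → Prop} (hm : MinArr G H)
    (v w : V) (hvw : G.Adj v w) :
    ∃ o1 : V → V → Prop, (∀ x y, o1 x y → ¬ o1 y x) ∧ (∀ x y, o1 x y → G.Adj x y) ∧
      (∀ x y, G.Adj x y → x ≠ v → y ≠ v → (o1 x y ↔ ¬ o1 y x)) ∧
      ∀ S : V → Prop, ∃ f, UCopy G H f ∧ ∃ i, f i = v ∧ (∀ b, H i b → S (f b)) ∧
        (∀ a, H a i → ¬ S (f a)) ∧ (∀ a b, H a b → a ≠ i → b ≠ i → o1 (f a) (f b)) := by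
  obtain ⟨o1, ho1, hno, hext⟩ := ext_tool hm {e | v ∈ e} ⟨s(v, w), by simp, hvw⟩
  refine ⟨o1, fun x y h => (ho1.2 x y (ho1.1 x y h)).1 h,
    fun x y h => ((SimpleGraph.deleteEdges_adj).1 (ho1.1 x y h)).1, ?_, ?_⟩
  · intro x y hxy hx hy
    refine ho1.2 x y ?_
    rw [SimpleGraph.deleteEdges_adj]
    refine ⟨hxy, ?_⟩
    simp [Ne.symm hx, Ne.symm hy]
  · intro S
    obtain ⟨f, hf, h1, h2, a, b, hab, habv⟩ := hext (fun x y => (x = v ∧ S y) ∨ (y = v ∧ ¬ S x)) (by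
      intro x y hxy hv
      have := hxy.ne
      simp only [Set.mem_setOf_eq, Sym2.mem_iff] at hv
      grind)
    simp only [Set.mem_setOf_eq, Sym2.mem_iff] at h1 h2 habv
    have hi : ∃ i, f i = v := by
      rcases habv with h | h
      · exact ⟨_, h.symm⟩
      · exact ⟨_, h.symm⟩
    obtain ⟨i, rfl⟩ := hi
    refine ⟨f, hf, i, rfl, ?_, ?_, ?_⟩
    · intro b hb
      have := h1 i b hb (Or.inl rfl)
      have := (hf.2 i b hb).ne
      grind
    · intro a ha
      have := h1 a i ha (Or.inr rfl)
      have := (hf.2 a i ha).ne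
      grind
    · intro a b hab ha hb
      refine h2 a b hab ?_
      rintro (h | h)
      · exact ha (hf.1 h).symm
      · exact hb (hf.1 h).symm

theorem degK {n t : ℕ} (ht : 4 ≤ t) {G : SimpleGraph (Fin n)} {H : Fin t → Fin t → Prop} (hac : RelAcyclic H)
    (hor : IsOrientation (⊤ : SimpleGraph (Fin t)) H) (hm : MinArr G H) (v w : Fin n) (hvw : G.Adj v w) :
    t + 1 ≤ G.degree v := by
  by_contra hdeg
  obtain ⟨r, hr⟩ := rank_complete hac hor
  obtain ⟨o1, hasym, hadj, htot, htool⟩ := vert_tool hm v w hvw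
  let N := G.neighborFinset v
  have hN : N.card ≤ t := by
    rw [SimpleGraph.card_neighborFinset_eq_degree]; omega
  -- the abstract consequence
  have key : ∀ S : Fin n → Prop, ∃ B ⊆ N, B.card = t - 1 ∧ (∀ x ∈ B, ∀ y ∈ B, x ≠ y → o1 x y ∨ o1 y x) ∧
      ∀ x ∈ B, ∀ y ∈ B, o1 x y → S x → S y := by
    intro S
    obtain ⟨f, hf, i, rfl, h1, h2, h3⟩ := htool S
    have hH : ∀ a b, a ≠ b → H a b ∨ H b a := by
      intro a b hab
      have := hor.2 a b (by simpa using hab); tauto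
    refine ⟨(univ.erase i).image f, ?_, ?_, ?_, ?_⟩
    · intro x hx
      obtain ⟨j, hj, rfl⟩ := mem_image.1 hx
      rw [SimpleGraph.mem_neighborFinset]
      exact ucopy_complete hor hf i j (Ne.symm (ne_of_mem_erase hj))
    · rw [card_image_of_injective _ hf.1, card_erase_of_mem (mem_univ _)]; simp
    · intro x hx y hy hxy
      obtain ⟨j, hj, rfl⟩ := mem_image.1 hx
      obtain ⟨k, hk, rfl⟩ := mem_image.1 hy
      have hjk : j ≠ k := fun h => hxy (by rw [h])
      rcases hH j k hjk with h | h
      · exact Or.inl (h3 _ _ h (ne_of_mem_erase hj) (ne_of_mem_erase hk))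
      · exact Or.inr (h3 _ _ h (ne_of_mem_erase hk) (ne_of_mem_erase hj))
    · intro x hx y hy hxy hS
      obtain ⟨j, hj, rfl⟩ := mem_image.1 hx
      obtain ⟨k, hk, rfl⟩ := mem_image.1 hy
      have hjk : j ≠ k := fun h => (hadj _ _ hxy).ne (by rw [h])
      have hjk' : H j k := by
        rcases hH j k hjk with h | h
        · exact h
        · exact absurd hxy (hasym _ _ (h3 _ _ h (ne_of_mem_erase hk) (ne_of_mem_erase hj)))
      have hij : H i j := by
        rcases hH i j (ne_of_mem_erase hj).symm with h | h
        · exact h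
        · exact absurd hS (h2 _ h)
      apply h1
      rw [hr] at *
      exact hij.trans hjk'
  obtain ⟨B0, hB0N, hB0c, hB0t, -⟩ := key (fun _ => True)
  have h3 : 3 ≤ B0.card := by omega
  obtain ⟨a, ha, b, hb, hab⟩ := one_lt_card.1 (show 1 < B0.card by omega)
  -- two disjoint arcs suffice
  have hdis : ∀ a b c d, a ∈ N → b ∈ N → c ∈ N → d ∈ N → a ≠ c → a ≠ d → b ≠ c → b ≠ d → o1 a b → o1 c d → False := by
    intro a b c d ha hb hc hd h1 h2 h3 h4 hab hcd
    obtain ⟨B, hBN, hBc, -, hB⟩ := key (fun x => x = a ∨ x = c)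
    have n1 := (hadj _ _ hab).ne
    have n2 := (hadj _ _ hcd).ne
    have hmiss : (N \ B).card ≤ 1 := by
      rw [card_sdiff_of_subset hBN]; omega
    rw [card_le_one] at hmiss
    have hm2 : ∀ x ∈ N, ∀ y ∈ N, x ≠ y → x ∈ B ∨ y ∈ B := by
      intro x hx y hy hxy
      by_contra hh
      push Not at hh
      exact hxy (hmiss x (by simp [hx, hh.1]) y (by simp [hy, hh.2]))
    have e1 : ¬ (a ∈ B ∧ b ∈ B) := fun h => by
      have := hB a h.1 b h.2 hab (Or.inl rfl); grind
    have e2 : ¬ (c ∈ B ∧ d ∈ B) := fun h => by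
      have := hB c h.1 d h.2 hcd (Or.inr rfl); grind
    have := hm2 a ha c hc h1
    have := hm2 a ha d hd h2
    have := hm2 b hb c hc h3
    have := hm2 b hb d hd h4
    tauto
  have hdis' : ∀ a b c d, a ∈ N → b ∈ N → c ∈ N → d ∈ N → a ≠ c → a ≠ d → b ≠ c → b ≠ d → (o1 a b ∨ o1 b a) →
      (o1 c d ∨ o1 d c) → False := by
    intro a b c d ha hb hc hd h1 h2 h3 h4 hab hcd
    rcases hab with h | h <;> rcases hcd with h' | h'
    · exact hdis a b c d ha hb hc hd h1 h2 h3 h4 h h'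
    · exact hdis a b d c ha hb hd hc h2 h1 h4 h3 h h'
    · exact hdis b a c d hb ha hc hd h3 h4 h1 h2 h h'
    · exact hdis b a d c hb ha hd hc h4 h3 h2 h1 h h'
  have harc : ∀ z1 z2, z1 ∈ B0 → z2 ∈ B0 → o1 z1 z2 → False := by
    intro z1 z2 hz1 hz2 hz
    have hzn := (hadj _ _ hz).ne
    obtain ⟨B, hBN, hBc, hBt, hB⟩ := key (fun x => x = z1)
    have hne : B ≠ B0 := by
      rintro rfl
      have := hB z1 hz1 z2 hz2 hz rfl
      exact hzn this.symm
    obtain ⟨x, hx, hx0⟩ : ∃ x ∈ B, x ∉ B0 := by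
      by_contra hh
      push Not at hh
      exact hne (eq_of_subset_of_card_le hh (by omega))
    obtain ⟨y, hy, hyx⟩ : ∃ y ∈ B, y ≠ x := by
      have : (B.erase x).Nonempty := by
        rw [← card_pos, card_erase_of_mem hx]; omega
      obtain ⟨y, hy⟩ := this
      exact ⟨y, mem_of_mem_erase hy, ne_of_mem_erase hy⟩
    have hxy := hBt x hx y hy hyx.symm
    have : 1 < (B0.erase y).card := by
      have := pred_card_le_card_erase (s := B0) (a := y); omega
    obtain ⟨c, hc, d, hd, hcd⟩ := one_lt_card.1 this
    have hc0 := mem_of_mem_erase hc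
    have hd0 := mem_of_mem_erase hd
    exact hdis' x y c d (hBN hx) (hBN hy) (hB0N hc0) (hB0N hd0) (fun h => hx0 (h ▸ hc0)) (fun h => hx0 (h ▸ hd0))
      (ne_of_mem_erase hc).symm (ne_of_mem_erase hd).symm hxy (hB0t c hc0 d hd0 hcd)
  rcases hB0t a ha b hb hab with h | h
  · exact harc _ _ ha hb h
  · exact harc _ _ hb ha h

/-- A minimal arrowing graph has an edge. -/
theorem minarr_edge {n t : ℕ} {G : SimpleGraph (Fin n)} {H : Fin t → Fin t → Prop}
    (hl : 1 ≤ (arcs H).card) (hm : MinArr G H) : (eF G).Nonempty := by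
  obtain ⟨f, hf, hfc⟩ := hm.1 (fun u v => G.Adj u v ∧ u < v) ⟨fun u v h => h.1, fun u v h => by
    have := h.ne
    simp only [h, h.symm, true_and, not_lt]
    exact ⟨le_of_lt, fun h => lt_of_le_of_ne h this⟩⟩
  obtain ⟨a, ha⟩ := card_pos.1 hl
  have : H a.1 a.2 := by simpa [arcs] using ha
  exact ⟨s(f a.1, f a.2), by rw [mem_eF]; exact (hfc _ _ this).1⟩

theorem mem_supp' {n : ℕ} (G : SimpleGraph (Fin n)) (v : Fin n) : v ∈ supp G ↔ ∃ w, G.Adj v w := by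
  simp [supp]

theorem dlK {n t : ℕ} (ht : 4 ≤ t) {G : SimpleGraph (Fin n)} {H : Fin t → Fin t → Prop} (hac : RelAcyclic H)
    (hor : IsOrientation (⊤ : SimpleGraph (Fin t)) H) (hl : 1 ≤ (arcs H).card) (hm : MinArr G H) :
    ∃ W : Finset (Sym2 (Fin n)), ∃ V : Finset (Fin n), W ⊆ eF G ∧ W.Nonempty ∧ (∀ e ∈ W, ∀ x ∈ e, x ∈ V) ∧
      (t + 1) * V.card ≤ 2 * W.card := by
  refine ⟨eF G, supp G, subset_rfl, minarr_edge hl hm, ?_, ?_⟩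
  · intro e
    induction e with | _ x y => ?_
    intro he z hz
    have hadj : G.Adj x y := by rw [mem_eF] at he; exact he
    rw [mem_supp']
    rcases Sym2.mem_iff.1 hz with rfl | rfl
    · exact ⟨_, hadj⟩
    · exact ⟨_, hadj.symm⟩
  · rw [← degree_sum]
    calc (t + 1) * (supp G).card = ∑ v ∈ supp G, (t + 1) := by simp [mul_comm]
      _ ≤ ∑ v ∈ supp G, G.degree v := by
        apply sum_le_sum
        intro v hv
        obtain ⟨w, hw⟩ := (mem_supp' G v).1 hv
        have := degK ht hac hor hm v w hw
        convert this
      _ ≤ ∑ v, G.degree v := sum_le_sum_of_subset (subset_univ _)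
end ORam

namespace ORam
open Finset
open scoped Classical

/-- basic facts on orientations of a cycle -/
structure CycO {t : ℕ} [NeZero t] (H : Fin t → Fin t → Prop) : Prop where
  arc : ∀ a b, H a b → b = a + 1 ∨ a = b + 1
  alt : ∀ i, H i (i + 1) ↔ ¬ H (i + 1) i
  n2 : (1 : Fin t) + 1 ≠ 0
  n3 : (1 : Fin t) + 1 + 1 ≠ 0

theorem fin_val_one {t : ℕ} [NeZero t] (ht : 2 ≤ t) : ((1 : Fin t) : ℕ) = 1 := by
  rw [Fin.val_one']; exact Nat.mod_eq_of_lt (by omega)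

theorem fin_val_11 {t : ℕ} [NeZero t] (ht : 3 ≤ t) : ((1 + 1 : Fin t) : ℕ) = 2 := by
  rw [Fin.val_add, fin_val_one (by omega)]; exact Nat.mod_eq_of_lt (by omega)

theorem fin_val_111 {t : ℕ} [NeZero t] (ht : 4 ≤ t) : ((1 + 1 + 1 : Fin t) : ℕ) = 3 := by
  rw [Fin.val_add, fin_val_11 (by omega), fin_val_one (by omega)]; exact Nat.mod_eq_of_lt (by omega)

theorem cyc_adj {t : ℕ} [NeZero t] (ht : 4 ≤ t) (a b : Fin t) :
    (SimpleGraph.cycleGraph t).Adj a b ↔ b = a + 1 ∨ a = b + 1 := by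
  rw [SimpleGraph.cycleGraph_adj']
  have h : ∀ c : Fin t, (c : ℕ) = 1 ↔ c = 1 := fun c => by
    rw [Fin.ext_iff, fin_val_one (by omega)]
  rw [h, h, sub_eq_iff_eq_add', sub_eq_iff_eq_add']
  tauto

theorem cycO_of {t : ℕ} [NeZero t] (ht : 4 ≤ t) {H : Fin t → Fin t → Prop}
    (h : IsOrientation (SimpleGraph.cycleGraph t) H) : CycO H := by
  refine ⟨fun a b hab => (cyc_adj ht a b).1 (h.1 a b hab), fun i => h.2 _ _ ((cyc_adj ht _ _).2 (Or.inl rfl)), ?_, ?_⟩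
  · intro h; rw [Fin.ext_iff, fin_val_11 (by omega)] at h; simp at h
  · intro h; rw [Fin.ext_iff, fin_val_111 (by omega)] at h; simp at h

variable {t n : ℕ} [NeZero t] {H : Fin t → Fin t → Prop} {G : SimpleGraph (Fin n)}

theorem cyc_tool (hH : CycO H) (hm : MinArr G H) (X : Fin n → Prop) (hX : ∃ x w, X x ∧ G.Adj x w) :
    ∃ o1 : Fin n → Fin n → Prop, (∀ x y, o1 x y → ¬ o1 y x) ∧
      ∀ c : Fin n → Fin n → Prop, (∀ u v, G.Adj u v → X u ∨ X v → (c u v ↔ ¬ c v u)) →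
      ∃ f : Fin t → Fin n, Function.Injective f ∧ (∀ i, G.Adj (f i) (f (i + 1))) ∧ (∃ i, X (f i)) ∧
        (∀ i, X (f i) ∨ X (f (i + 1)) → (H i (i + 1) ↔ c (f i) (f (i + 1)))) ∧
        (∀ i, ¬ X (f i) → ¬ X (f (i + 1)) → (H i (i + 1) → o1 (f i) (f (i + 1))) ∧
          (¬ H i (i + 1) → o1 (f (i + 1)) (f i))) := by
  obtain ⟨x, w, hx, hxw⟩ := hX
  obtain ⟨o1, ho1, -, hext⟩ := ext_tool hm {e | ∃ x, X x ∧ x ∈ e} ⟨s(x, w), ⟨x, hx, by simp⟩, hxw⟩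
  refine ⟨o1, fun x y h => (ho1.2 x y (ho1.1 x y h)).1 h, ?_⟩
  have hR : ∀ u v, s(u, v) ∈ ({e | ∃ x, X x ∧ x ∈ e} : Set (Sym2 (Fin n))) ↔ X u ∨ X v := by
    intro u v
    simp only [Set.mem_setOf_eq, Sym2.mem_iff]
    constructor
    · rintro ⟨x, hx, rfl | rfl⟩ <;> tauto
    · rintro (h | h)
      · exact ⟨u, h, Or.inl rfl⟩
      · exact ⟨v, h, Or.inr rfl⟩
  intro c hc
  obtain ⟨f, hf, h1, h2, a, b, hab, habX⟩ := hext c (by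
    intro u v huv h; exact hc u v huv ((hR _ _).1 h))
  have hadj : ∀ i, G.Adj (f i) (f (i + 1)) := by
    intro i
    by_cases h : H i (i + 1)
    · exact hf.2 _ _ h
    · exact (hf.2 _ _ (by have := hH.alt i; tauto)).symm
  refine ⟨f, hf.1, hadj, ?_, ?_, ?_⟩
  · rcases (hR _ _).1 habX with h | h
    · exact ⟨_, h⟩
    · exact ⟨_, h⟩
  · intro i hi
    constructor
    · intro h; exact h1 _ _ h ((hR _ _).2 hi)
    · intro h
      by_contra hn
      have h' : H (i + 1) i := by have := hH.alt i; tauto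
      have := h1 _ _ h' ((hR _ _).2 hi.symm)
      have := hc _ _ (hadj i) hi
      tauto
  · intro i hi hi'
    constructor
    · intro h; exact h2 _ _ h (fun h => by have := (hR _ _).1 h; tauto)
    · intro hn
      have h' : H (i + 1) i := by have := hH.alt i; tauto
      exact h2 _ _ h' (fun h => by have := (hR _ _).1 h; tauto)

/-- neighbours of a degree two vertex on a cycle -/
theorem nb2 (hH : CycO H) {f : Fin t → Fin n} (hf : Function.Injective f) (hadj : ∀ i, G.Adj (f i) (f (i + 1)))
    (i : Fin t) (h2 : G.degree (f i) = 2) (y : Fin n) (hy : G.Adj (f i) y) : y = f (i + 1) ∨ y = f (i - 1) := by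
  have h1 := hadj i
  have h3 := (hadj (i - 1)).symm
  rw [sub_add_cancel] at h3
  have hne : f (i + 1) ≠ f (i - 1) := by
    intro h
    have := hf h
    apply hH.n2
    have h4 : i + 1 + 1 = i := by rw [this, sub_add_cancel]
    rw [add_assoc] at h4
    simpa using h4
  have hs : ({f (i + 1), f (i - 1)} : Finset (Fin n)) ⊆ G.neighborFinset (f i) := by
    intro z hz
    simp only [mem_insert, mem_singleton] at hz
    rcases hz with rfl | rfl
    · simpa using h1
    · simpa using h3
  have := eq_of_subset_of_card_le hs (by
    rw [SimpleGraph.card_neighborFinset_eq_degree, card_pair hne, h2])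
  have hy' : y ∈ G.neighborFinset (f i) := by simpa using hy
  rw [← this] at hy'
  simpa using hy'

theorem cyc_mindeg (hH : CycO H) (hm : MinArr G H) (v w : Fin n) (hvw : G.Adj v w) : 2 ≤ G.degree v := by
  obtain ⟨o1, -, hext⟩ := cyc_tool hH hm (fun x => x = v) ⟨v, w, rfl, hvw⟩
  obtain ⟨f, hf, hadj, ⟨i, rfl⟩, -, -⟩ := hext (fun x y => x < y) (by
    intro u v huv _
    have := huv.ne
    simp only [not_lt]
    exact ⟨le_of_lt, fun h => lt_of_le_of_ne h this⟩)
  have h1 := hadj i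
  have h3 := (hadj (i - 1)).symm
  rw [sub_add_cancel] at h3
  have hne : f (i + 1) ≠ f (i - 1) := by
    intro h
    have := hf h
    apply hH.n2
    have h4 : i + 1 + 1 = i := by rw [this, sub_add_cancel]
    rw [add_assoc] at h4
    simpa using h4
  rw [← SimpleGraph.card_neighborFinset_eq_degree, ← card_pair hne]
  apply card_le_card
  intro z hz
  simp only [mem_insert, mem_singleton] at hz
  rcases hz with rfl | rfl
  · simpa using h1
  · simpa using h3

/-- number of neighbours of degree two -/
noncomputable def dtwo (G : SimpleGraph (Fin n)) (v : Fin n) : ℕ :=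
  (univ.filter (fun w => G.Adj v w ∧ G.degree w = 2)).card

theorem dtwo_le (v : Fin n) : dtwo G v ≤ G.degree v := by
  rw [← SimpleGraph.card_neighborFinset_eq_degree]
  apply card_le_card
  intro w hw
  have := (mem_filter.1 hw).2.1
  simpa using this

theorem dtwo_sum (G : SimpleGraph (Fin n)) : ∑ v, dtwo G v = ∑ v, if G.degree v = 2 then 2 else 0 := by
  have h1 : ∀ v, dtwo G v = ∑ w, if (G.Adj v w ∧ G.degree w = 2) then 1 else 0 := by
    intro v; rw [dtwo, card_filter]
  simp_rw [h1]
  rw [sum_comm]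
  apply sum_congr rfl
  intro w _
  rw [← card_filter]
  split_ifs with h
  · have : (univ.filter (fun v => G.Adj v w ∧ G.degree w = 2)) = G.neighborFinset w := by
      ext v; simp [h, SimpleGraph.adj_comm]
    rw [this, SimpleGraph.card_neighborFinset_eq_degree, h]
  · simp [h]

theorem disch (G : SimpleGraph (Fin n)) (α β : ℕ)
    (h : ∀ v ∈ supp G, β + dtwo G v ≤ α * G.degree v + if G.degree v = 2 then 2 else 0) :
    β * (supp G).card ≤ α * (2 * (eF G).card) := by
  have h0 : ∀ v ∉ supp G, G.degree v = 0 := by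
    intro v hv
    rw [mem_supp'] at hv
    rw [← SimpleGraph.card_neighborFinset_eq_degree, card_eq_zero, eq_empty_iff_forall_notMem]
    intro w hw
    exact hv ⟨w, by simpa using hw⟩
  have hs := sum_le_sum h
  rw [sum_add_distrib, sum_add_distrib, ← mul_sum] at hs
  have e1 : ∑ v ∈ supp G, dtwo G v = ∑ v, dtwo G v := by
    apply sum_subset (subset_univ _)
    intro v _ hv
    have := dtwo_le (G := G) v
    have := h0 v hv
    omega
  have e2 : ∑ v ∈ supp G, (if G.degree v = 2 then 2 else 0) = ∑ v, if G.degree v = 2 then 2 else 0 := by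
    apply sum_subset (subset_univ _)
    intro v _ hv
    rw [h0 v hv]; simp
  have e3 : ∑ v ∈ supp G, G.degree v = ∑ v, G.degree v := by
    apply sum_subset (subset_univ _)
    intro v _ hv
    exact h0 v hv
  rw [e1, e2, e3, dtwo_sum, degree_sum] at hs
  simp only [sum_const, smul_eq_mul] at hs
  have : (supp G).card * β = β * (supp G).card := mul_comm _ _
  omega
end ORam

namespace ORam
open Finset
open scoped Classical

theorem three_col {n : ℕ} {G : SimpleGraph (Fin n)}
    (h : ∀ (W : Finset (Sym2 (Fin n))) (V : Finset (Fin n)), W ⊆ eF G → W.Nonempty →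
      (∀ e ∈ W, ∀ x ∈ e, x ∈ V) → 2 * W.card < 3 * V.card) :
    ∃ c : Fin n → ZMod 3, ∀ u v, G.Adj u v → c u ≠ c v := by
  suffices hU : ∀ U : Finset (Fin n), ∃ c : Fin n → ZMod 3, ∀ u ∈ U, ∀ v ∈ U, G.Adj u v → c u ≠ c v by
    obtain ⟨c, hc⟩ := hU univ
    exact ⟨c, fun u v => hc u (mem_univ _) v (mem_univ _)⟩
  intro U
  induction U using Finset.strongInduction with | _ U ih => ?_
  rcases U.eq_empty_or_nonempty with rfl | hne
  · exact ⟨fun _ => 0, by simp⟩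
  obtain ⟨G', hG'⟩ : ∃ G' : SimpleGraph (Fin n), ∀ x y, G'.Adj x y ↔ (G.Adj x y ∧ x ∈ U ∧ y ∈ U) :=
    ⟨{ Adj := fun x y => G.Adj x y ∧ x ∈ U ∧ y ∈ U
       symm := ⟨fun x y h => ⟨h.1.symm, h.2.2, h.2.1⟩⟩
       loopless := ⟨fun x h => h.1.ne rfl⟩ }, fun x y => Iff.rfl⟩
  have hex : ∃ v ∈ U, G'.degree v ≤ 2 := by
    by_contra hcon
    push Not at hcon
    have h1 : 3 * U.card ≤ 2 * (eF G').card := by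
      rw [← degree_sum]
      calc 3 * U.card = ∑ v ∈ U, 3 := by simp [mul_comm]
        _ ≤ ∑ v ∈ U, G'.degree v := sum_le_sum fun v hv => hcon v hv
        _ ≤ _ := sum_le_sum_of_subset (subset_univ _)
    have h2 : 0 < U.card := hne.card_pos
    have := h (eF G') U (eF_mono (fun x y h => ((hG' x y).1 h).1)) (card_pos.1 (by omega)) (by
      intro e
      induction e with | _ x y => ?_
      intro he z hz
      rw [mem_eF] at he
      have he := (hG' x y).1 he
      rcases Sym2.mem_iff.1 hz with rfl | rfl
      · exact he.2.1
      · exact he.2.2)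
    omega
  obtain ⟨v, hv, hd⟩ := hex
  obtain ⟨c, hc⟩ := ih (U.erase v) (erase_ssubset hv)
  obtain ⟨x, -, hx⟩ : ∃ x ∈ (univ : Finset (ZMod 3)), x ∉ (G'.neighborFinset v).image c := by
    apply exists_mem_notMem_of_card_lt_card
    calc _ ≤ (G'.neighborFinset v).card := card_image_le
      _ < _ := by
        rw [SimpleGraph.card_neighborFinset_eq_degree, card_univ, ZMod.card]; omega
  have hx' : ∀ w ∈ U, G.Adj v w → c w ≠ x := by
    intro w hw hvw heq
    apply hx
    rw [mem_image]
    refine ⟨w, ?_, heq⟩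
    rw [SimpleGraph.mem_neighborFinset, hG']
    exact ⟨hvw, hv, hw⟩
  refine ⟨Function.update c v x, ?_⟩
  intro a ha b hb hab
  have hne := hab.ne
  by_cases h1 : a = v
  · subst h1
    rw [Function.update_self, Function.update_of_ne hne.symm]
    exact (hx' b hb hab).symm
  · by_cases h2 : b = v
    · subst h2
      rw [Function.update_self, Function.update_of_ne hne]
      exact hx' a ha hab.symm
    · rw [Function.update_of_ne h1, Function.update_of_ne h2]
      exact hc a (mem_erase.2 ⟨h1, ha⟩) b (mem_erase.2 ⟨h2, hb⟩) hab

variable {t n : ℕ} [NeZero t] {H : Fin t → Fin t → Prop} {G : SimpleGraph (Fin n)}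

/-- no three consecutive equal signs -/
def NoRun (H : Fin t → Fin t → Prop) : Prop :=
  ∀ i, ¬ ((H i (i + 1) ↔ H (i + 1) (i + 1 + 1)) ∧ (H (i + 1) (i + 1 + 1) ↔ H (i + 1 + 1) (i + 1 + 1 + 1)))

theorem col_run (hH : CycO H) (harr : Arrows G H) (c : Fin n → ZMod 3) (hc : ∀ u v, G.Adj u v → c u ≠ c v) :
    NoRun H := by
  intro i hi
  obtain ⟨f, hf, hfc⟩ := harr (fun u v => G.Adj u v ∧ (c u).val < (c v).val) ⟨fun u v h => h.1, fun u v h => by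
    have := hc u v h
    simp only [h, h.symm, true_and, not_lt]
    exact ⟨le_of_lt, fun h => lt_of_le_of_ne h (fun h => this (ZMod.val_injective 3 h))⟩⟩
  have a0 := hH.alt i
  have a1 := hH.alt (i + 1)
  have a2 := hH.alt (i + 1 + 1)
  have v0 := ZMod.val_lt (c (f i))
  have v1 := ZMod.val_lt (c (f (i + 1)))
  have v2 := ZMod.val_lt (c (f (i + 1 + 1)))
  have v3 := ZMod.val_lt (c (f (i + 1 + 1 + 1)))
  by_cases h : H i (i + 1)
  · have h1 := hfc _ _ h
    have h2 := hfc _ _ (hi.1.1 h)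
    have h3 := hfc _ _ (hi.2.1 (hi.1.1 h))
    omega
  · have h1 := hfc (i + 1) i (by tauto)
    have h2 := hfc (i + 1 + 1) (i + 1) (by tauto)
    have h3 := hfc (i + 1 + 1 + 1) (i + 1 + 1) (by tauto)
    omega

theorem col_sum (hH : CycO H) (harr : Arrows G H) (c : Fin n → ZMod 3) (hc : ∀ u v, G.Adj u v → c u ≠ c v) :
    ∑ i, (if H i (i + 1) then (1 : ZMod 3) else -1) = 0 := by
  have hz : ∀ a b : ZMod 3, a ≠ b → (b = a + 1 ↔ ¬ a = b + 1) := by decide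
  obtain ⟨f, hf, hfc⟩ := harr (fun u v => G.Adj u v ∧ c v = c u + 1) ⟨fun u v h => h.1, fun u v h => by
    have := hc u v h
    simp only [h, h.symm, true_and]
    exact hz _ _ this⟩
  have h1 : ∀ i, (if H i (i + 1) then (1 : ZMod 3) else -1) = c (f (i + 1)) - c (f i) := by
    intro i
    split_ifs with h
    · rw [(hfc _ _ h).2]; ring
    · have : H (i + 1) i := by have := hH.alt i; tauto
      rw [(hfc _ _ this).2]; ring
  rw [sum_congr rfl (fun i _ => h1 i), sum_sub_distrib, sub_eq_zero]
  exact Equiv.sum_comp (Equiv.addRight (1 : Fin t)) (fun i => c (f i))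

theorem five (H : Fin 5 → Fin 5 → Prop) (hr : NoRun H) :
    ∑ i, (if H i (i + 1) then (1 : ZMod 3) else -1) ≠ 0 := by
  have key : ∀ s : Fin 5 → Bool, (∀ i, ¬ (s i = s (i + 1) ∧ s (i + 1) = s (i + 1 + 1))) →
      ∑ i, (if s i = true then (1 : ZMod 3) else -1) ≠ 0 := by decide
  have := key (fun i => decide (H i (i + 1))) (by
    intro i
    have := hr i
    simpa using this)
  simpa using this

theorem six (H : Fin 6 → Fin 6 → Prop) (hr : NoRun H) :
    (∀ i, H i (i + 1) ↔ ¬ H (i + 1) (i + 1 + 1)) ∨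
    (∀ i, ¬ (H i (i + 1) ∧ ¬ H (i + 1) (i + 1 + 1) ∧ H (i + 1 + 1) (i + 1 + 1 + 1) ∧
      ¬ H (i + 1 + 1 + 1) (i + 1 + 1 + 1 + 1))) ∨
    (∀ i, ¬ (¬ H i (i + 1) ∧ H (i + 1) (i + 1 + 1) ∧ ¬ H (i + 1 + 1) (i + 1 + 1 + 1) ∧
      H (i + 1 + 1 + 1) (i + 1 + 1 + 1 + 1))) := by
  have key : ∀ s : Fin 6 → Bool, (∀ i, ¬ (s i = s (i + 1) ∧ s (i + 1) = s (i + 1 + 1))) →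
    ((∀ i, s i = true ↔ ¬ s (i + 1) = true) ∨
    (∀ i, ¬ (s i = true ∧ ¬ s (i + 1) = true ∧ s (i + 1 + 1) = true ∧ ¬ s (i + 1 + 1 + 1) = true)) ∨
    (∀ i, ¬ (¬ s i = true ∧ s (i + 1) = true ∧ ¬ s (i + 1 + 1) = true ∧ s (i + 1 + 1 + 1) = true))) := by decide
  have := key (fun i => decide (H i (i + 1))) (by
    intro i
    have := hr i
    simpa using this)
  simpa using this

/-- every degree-two vertex can be made a through vertex, so the pattern is not alternating -/
theorem not_alt (hH : CycO H) (hm : MinArr G H) (v : Fin n) (hd : G.degree v = 2) :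
    ¬ ∀ i, H i (i + 1) ↔ ¬ H (i + 1) (i + 1 + 1) := by
  intro halt
  have hc : (G.neighborFinset v).card = 2 := by rw [SimpleGraph.card_neighborFinset_eq_degree, hd]
  obtain ⟨a, b, hab, hN⟩ := card_eq_two.1 hc
  have hva : G.Adj v a := by
    have : a ∈ G.neighborFinset v := by rw [hN]; simp
    simpa using this
  have hvb : ∀ x, G.Adj v x → x = a ∨ x = b := by
    intro x hx
    have : x ∈ G.neighborFinset v := by simpa using hx
    rw [hN] at this; simpa using this
  obtain ⟨o1, -, hext⟩ := cyc_tool hH hm (fun x => x = v) ⟨v, a, rfl, hva⟩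
  obtain ⟨f, hf, hadj, ⟨i, hi⟩, h1, -⟩ := hext (fun x y => x = a ∨ y = b) (by
    intro x y hxy hv
    have := hxy.ne
    rcases hv with rfl | rfl
    · have := hvb y hxy; grind
    · have := hvb x hxy.symm; grind)
  obtain ⟨j, rfl⟩ : ∃ j, i = j + 1 := ⟨i - 1, by rw [sub_add_cancel]⟩
  have e1 := h1 j (Or.inr hi)
  have e2 := h1 (j + 1) (Or.inl hi)
  have e3 := halt j
  have n1 := hadj j
  have n2 := hadj (j + 1)
  rw [hi] at e1 e2 n1 n2
  have n3 := hvb _ n1.symm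
  have n4 := hvb _ n2
  have n5 : f j ≠ f (j + 1 + 1) := fun h => by
    have := hf h
    apply hH.n2
    rw [add_assoc] at this
    simpa using this.symm
  have := hva.ne
  have := n1.ne; have := n2.ne
  grind
end ORam

namespace ORam
open Finset
open scoped Classical

variable {t n : ℕ} [NeZero t] {H : Fin t → Fin t → Prop} {G : SimpleGraph (Fin n)}

/-- the second neighbour of a degree two vertex -/
theorem other_nb {v a : Fin n} (hd : G.degree v = 2) (hva : G.Adj v a) :
    ∃ b, b ≠ a ∧ G.Adj v b ∧ ∀ x, G.Adj v x → x = a ∨ x = b := by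
  have hc : ((G.neighborFinset v).erase a).card = 1 := by
    rw [card_erase_of_mem (by simpa using hva), SimpleGraph.card_neighborFinset_eq_degree, hd]
  obtain ⟨b, hb⟩ := card_eq_one.1 hc
  have hb' : b ∈ (G.neighborFinset v).erase a := by rw [hb]; simp
  refine ⟨b, ne_of_mem_erase hb', by simpa using mem_of_mem_erase hb', fun x hx => ?_⟩
  by_cases h : x = a
  · exact Or.inl h
  · right
    have : x ∈ (G.neighborFinset v).erase a := mem_erase.2 ⟨h, by simpa using hx⟩
    rw [hb] at this; simpa using this

theorem skip_ne (hH : CycO H) {f : Fin t → Fin n} (hf : Function.Injective f) (j : Fin t) :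
    f j ≠ f (j + 1 + 1) := fun h => by
  have := hf h
  apply hH.n2
  rw [add_assoc] at this
  simpa using this.symm

theorem no_adj2 (hH : CycO H) (hm : MinArr G H) (hr : NoRun H) (u v : Fin n) (huv : G.Adj u v)
    (hu : G.degree u = 2) (hv : G.degree v = 2) : False := by
  obtain ⟨a, hav, hua, hNu⟩ := other_nb hu huv
  obtain ⟨b, hbu, hvb, hNv⟩ := other_nb hv huv.symm
  have n1 := huv.ne
  have n2 := hua.ne
  have n3 := hvb.ne
  obtain ⟨o1, -, hext⟩ := cyc_tool hH hm (fun x => x = u ∨ x = v) ⟨u, v, Or.inl rfl, huv⟩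
  obtain ⟨f, hf, hadj, hi, h1, -⟩ := hext (fun x y => (x = a ∧ y = u) ∨ (x = u ∧ y = v) ∨ (x = v ∧ y = b)) (by
    intro x y hxy hX
    have := hxy.ne
    rcases hX with (rfl | rfl) | (rfl | rfl)
    · have := hNu y hxy; grind
    · have := hNv y hxy; grind
    · have := hNu x hxy.symm; grind
    · have := hNv x hxy.symm; grind)
  have hi' : ∃ i, f i = u := by
    obtain ⟨i, h | h⟩ := hi
    · exact ⟨i, h⟩
    · rcases nb2 hH hf hadj i (by rw [h]; exact hv) u (by rw [h]; exact huv.symm) with h | h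
      · exact ⟨_, h.symm⟩
      · exact ⟨_, h.symm⟩
  obtain ⟨i, hi⟩ := hi'
  obtain ⟨j, rfl⟩ : ∃ j, i = j + 1 := ⟨i - 1, by rw [sub_add_cancel]⟩
  have hnb := nb2 hH hf hadj (j + 1) (by rw [hi]; exact hu) v (by rw [hi]; exact huv)
  rw [add_sub_cancel_right] at hnb
  rcases hnb with hv' | hv'
  · have a0 := hadj j
    have a2 := hadj (j + 1 + 1)
    have s0 := skip_ne hH hf j
    have s1 := skip_ne hH hf (j + 1)
    have e0 := h1 j (by grind)
    have e1 := h1 (j + 1) (by grind)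
    have e2 := h1 (j + 1 + 1) (by grind)
    have := hr j
    rw [hi] at *
    rw [← hv'] at *
    have := hNu _ a0.symm
    have := hNv _ a2
    grind
  · obtain ⟨k, rfl⟩ : ∃ k, j = k + 1 := ⟨j - 1, by rw [sub_add_cancel]⟩
    have a0 := hadj k
    have a2 := hadj (k + 1 + 1)
    have s0 := skip_ne hH hf k
    have s1 := skip_ne hH hf (k + 1)
    have e0 := h1 k (by grind)
    have e1 := h1 (k + 1) (by grind)
    have e2 := h1 (k + 1 + 1) (by grind)
    have := hr k
    rw [hi] at *
    rw [← hv'] at *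
    have := hNv _ a0.symm
    have := hNu _ a2
    grind

/-- star of three degree-two vertices around a vertex of degree three -/
theorem star3 (hH : CycO H) (hm : MinArr G H) (u w : Fin n) (huw : G.Adj u w)
    (hall : ∀ x, G.Adj u x → G.degree x = 2 ∧ ∀ y, G.Adj x y → G.degree y ≠ 2) (σ : Prop)
    (hpat : ∀ i, ¬ ((H i (i + 1) ↔ σ) ∧ (H (i + 1) (i + 1 + 1) ↔ ¬ σ) ∧ (H (i + 1 + 1) (i + 1 + 1 + 1) ↔ σ) ∧
      (H (i + 1 + 1 + 1) (i + 1 + 1 + 1 + 1) ↔ ¬ σ))) : False := by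
  obtain ⟨o1, -, hext⟩ := cyc_tool hH hm (fun x => G.Adj u x) ⟨w, u, huw, huw.symm⟩
  -- if `σ`, all neighbours of `u` become sinks, otherwise sources
  obtain ⟨f, hf, hadj, ⟨i, hi⟩, h1, -⟩ := hext (fun x y => if G.Adj u x then ¬ σ else σ) (by
    intro x y hxy hX
    have : ¬ (G.Adj u x ∧ G.Adj u y) := fun h => (hall x h.1).2 y hxy (hall y h.2).1
    by_cases hx : G.Adj u x
    · have hy : ¬ G.Adj u y := fun h => this ⟨hx, h⟩
      simp only [hx, hy, if_true, if_false]
    · have hy : G.Adj u y := by tauto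
      simp only [hx, hy, if_true, if_false]; tauto)
  have hi' : ∃ i, f i = u := by
    rcases nb2 hH hf hadj i (hall _ hi).1 u hi.symm with h | h
    · exact ⟨_, h.symm⟩
    · exact ⟨_, h.symm⟩
  obtain ⟨k, hk⟩ := hi'
  obtain ⟨j, rfl⟩ : ∃ j, k = j + 1 + 1 := ⟨k - 1 - 1, by rw [sub_add_cancel, sub_add_cancel]⟩
  have b1 : G.Adj u (f (j + 1)) := by rw [← hk]; exact (hadj (j + 1)).symm
  have b3 : G.Adj u (f (j + 1 + 1 + 1)) := by rw [← hk]; exact hadj (j + 1 + 1)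
  have b0 : ¬ G.Adj u (f j) := fun h => (hall _ b1).2 (f j) (hadj j).symm (hall _ h).1
  have b4 : ¬ G.Adj u (f (j + 1 + 1 + 1 + 1)) := fun h => (hall _ b3).2 _ (hadj (j + 1 + 1 + 1)) (hall _ h).1
  have b2 : ¬ G.Adj u (f (j + 1 + 1)) := by rw [hk]; exact SimpleGraph.irrefl G
  have e0 := h1 j (Or.inr b1)
  have e1 := h1 (j + 1) (Or.inl b1)
  have e2 := h1 (j + 1 + 1) (Or.inr b3)
  have e3 := h1 (j + 1 + 1 + 1) (Or.inl b3)
  rw [if_neg b0] at e0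
  rw [if_pos b1] at e1
  rw [if_neg b2] at e2
  rw [if_pos b3] at e3
  exact hpat j ⟨e0, e1, e2, e3⟩
end ORam

namespace ORam
open Finset
open scoped Classical

theorem four (H : Fin 4 → Fin 4 → Prop) (hr : NoRun H) (ha : ¬ ∀ i, H i (i + 1) ↔ ¬ H (i + 1) (i + 1 + 1)) :
    ∀ i, H i (i + 1) ↔ ¬ H (i + 1 + 1) (i + 1 + 1 + 1) := by
  have key : ∀ s : Fin 4 → Bool, (∀ i, ¬ (s i = s (i + 1) ∧ s (i + 1) = s (i + 1 + 1))) →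
    (¬ (∀ i, s i = true ↔ ¬ s (i + 1) = true)) → (∀ i, s i = true ↔ ¬ s (i + 1 + 1) = true) := by decide
  have := key (fun i => decide (H i (i + 1))) (by
    intro i
    have := hr i
    simpa using this) (by simpa using ha)
  simpa using this

theorem prop4 {s0 s1 s2 s3 σ τ A B C D : Prop} (e0 : s0 ↔ σ) (e3 : s3 ↔ ¬ τ) (p0 : s0 ↔ ¬ s2) (p1 : s1 ↔ ¬ s3)
    (g1 : (s1 → A) ∧ (¬ s1 → B)) (g2 : (s2 → C) ∧ (¬ s2 → D)) :
    ((τ → A) ∧ (¬ τ → B)) ∧ ((σ → D) ∧ (¬ σ → C)) := by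
  by_cases h1 : σ <;> by_cases h2 : τ <;> simp_all

variable {n : ℕ} {H : Fin 4 → Fin 4 → Prop} {G : SimpleGraph (Fin n)}

theorem four_common (hH : CycO H) (hm : MinArr G H) (hp : ∀ i, H i (i + 1) ↔ ¬ H (i + 1 + 1) (i + 1 + 1 + 1))
    (v a b : Fin n) (hab : b ≠ a) (hva : G.Adj v a) (hvb : G.Adj v b) (hN : ∀ x, G.Adj v x → x = a ∨ x = b) :
    ∃ Y : Finset (Fin n), Y.card = 5 ∧ ∀ y ∈ Y, G.Adj a y ∧ G.Adj b y := by
  obtain ⟨o1, hasym, hext⟩ := cyc_tool hH hm (fun x => x = v) ⟨v, a, rfl, hva⟩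
  have n1 := hva.ne
  have n2 := hvb.ne
  have h44 : ∀ i : Fin 4, i + 1 + 1 + 1 + 1 = i := by decide
  have key : ∀ σa σb : Prop, ∃ x, x ≠ v ∧ G.Adj a x ∧ G.Adj b x ∧ (σb → o1 a x) ∧ (¬ σb → o1 x a) ∧
      (σa → o1 b x) ∧ (¬ σa → o1 x b) := by
    intro σa σb
    obtain ⟨f, hf, hadj, ⟨i, hi⟩, h1, h2⟩ := hext
      (fun x y => (x = v ∧ ((y = a ∧ σa) ∨ (y = b ∧ σb))) ∨ (y = v ∧ ((x = a ∧ ¬ σa) ∨ (x = b ∧ ¬ σb)))) (by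
        intro x y hxy hX
        have := hxy.ne
        rcases hX with rfl | rfl
        · have := hN y hxy
          by_cases σa <;> by_cases σb <;> grind
        · have := hN x hxy.symm
          by_cases σa <;> by_cases σb <;> grind)
    have a0 := hadj i
    have a1 := hadj (i + 1)
    have a2 := hadj (i + 1 + 1)
    have a3 := hadj (i + 1 + 1 + 1)
    have s0 := skip_ne hH hf i
    have s1 := skip_ne hH hf (i + 1)
    have p0 := hp i
    have p1 := hp (i + 1)
    have e0 := h1 i (Or.inl hi)
    have e3 := h1 (i + 1 + 1 + 1) (Or.inr (by rw [h44]; exact hi))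
    rw [h44] at a3 e3 p1
    rw [hi] at a0 a3 e0 e3 s0
    have g1 := h2 (i + 1) a0.ne.symm s0.symm
    have g2 := h2 (i + 1 + 1) s0.symm a3.ne
    have m1 := hN _ a0
    have m3 := hN _ a3.symm
    refine ⟨f (i + 1 + 1), s0.symm, ?_⟩
    have q1 := a1.symm
    have q2 := a2.symm
    rcases m1 with m1 | m1 <;> rcases m3 with m3 | m3
    · exact absurd (m1.trans m3.symm) s1
    · rw [m1] at e0 g1 a1 q1
      rw [m3] at e3 g2 a2 q2
      simp only [hab, hab.symm, n1, n2, n1.symm, n2.symm, true_and, false_and, and_true, and_false, or_false,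
        false_or] at e0 e3
      exact ⟨a1, q2, (prop4 e0 e3 p0 p1 g1 g2).1.1, (prop4 e0 e3 p0 p1 g1 g2).1.2,
        (prop4 e0 e3 p0 p1 g1 g2).2⟩
    · rw [m1] at e0 g1 a1 q1
      rw [m3] at e3 g2 a2 q2
      simp only [hab, hab.symm, n1, n2, n1.symm, n2.symm, true_and, false_and, and_true, and_false, or_false,
        false_or] at e0 e3
      have := prop4 e0 e3 p0 p1 g1 g2
      exact ⟨q2, a1, this.2.1, this.2.2, this.1.1, this.1.2⟩
    · exact absurd (m1.trans m3.symm) s1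
  obtain ⟨x1, k1, ya1, yb1, c1⟩ := key True True
  obtain ⟨x2, k2, ya2, yb2, c2⟩ := key True False
  obtain ⟨x3, k3, ya3, yb3, c3⟩ := key False True
  obtain ⟨x4, k4, ya4, yb4, c4⟩ := key False False
  simp only [true_imp_iff, not_true, not_false_iff, false_imp_iff, true_and, and_true] at c1 c2 c3 c4
  have d12 : x1 ≠ x2 := by rintro rfl; exact hasym _ _ c1.1 c2.1
  have d13 : x1 ≠ x3 := by rintro rfl; exact hasym _ _ c1.2 c3.2
  have d14 : x1 ≠ x4 := by rintro rfl; exact hasym _ _ c1.1 c4.1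
  have d23 : x2 ≠ x3 := by rintro rfl; exact hasym _ _ c3.1 c2.1
  have d24 : x2 ≠ x4 := by rintro rfl; exact hasym _ _ c2.2 c4.2
  have d34 : x3 ≠ x4 := by rintro rfl; exact hasym _ _ c3.1 c4.1
  refine ⟨{v, x1, x2, x3, x4}, ?_, ?_⟩
  · rw [card_insert_of_notMem, card_insert_of_notMem, card_insert_of_notMem, card_insert_of_notMem, card_singleton]
    all_goals simp only [mem_insert, mem_singleton, not_or]
    · exact d34
    · exact ⟨d23, d24⟩
    · exact ⟨d12, d13, d14⟩
    · exact ⟨k1.symm, k2.symm, k3.symm, k4.symm⟩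
  · intro y hy
    simp only [mem_insert, mem_singleton] at hy
    rcases hy with rfl | rfl | rfl | rfl | rfl
    · exact ⟨hva.symm, hvb.symm⟩
    · exact ⟨ya1, yb1⟩
    · exact ⟨ya2, yb2⟩
    · exact ⟨ya3, yb3⟩
    · exact ⟨ya4, yb4⟩

theorem four_deg (hH : CycO H) (hm : MinArr G H) (hp : ∀ i, H i (i + 1) ↔ ¬ H (i + 1 + 1) (i + 1 + 1 + 1))
    (v a : Fin n) (hva : G.Adj v a) (hd : G.degree v = 2) : 5 ≤ G.degree a := by
  obtain ⟨b, hba, hvb, hN⟩ := other_nb hd hva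
  obtain ⟨Y, hY, hY'⟩ := four_common hH hm hp v a b hba hva hvb hN
  rw [← SimpleGraph.card_neighborFinset_eq_degree, ← hY]
  apply card_le_card
  intro y hy
  simpa using (hY' y hy).1

theorem four_star (hH : CycO H) (hm : MinArr G H) (hp : ∀ i, H i (i + 1) ↔ ¬ H (i + 1 + 1) (i + 1 + 1 + 1))
    (a : Fin n) (hd : G.degree a = 5) (hall : ∀ x, G.Adj a x → G.degree x = 2) : False := by
  have hne : (G.neighborFinset a).Nonempty := by
    rw [← card_pos, SimpleGraph.card_neighborFinset_eq_degree]; omega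
  obtain ⟨v, hv⟩ := hne
  have hav : G.Adj a v := by simpa using hv
  obtain ⟨b, hba, hvb, hN⟩ := other_nb (hall v hav) hav.symm
  obtain ⟨Y, hY, hY'⟩ := four_common hH hm hp v a b hba hav.symm hvb hN
  have hYN : Y = G.neighborFinset a := by
    apply eq_of_subset_of_card_le
    · intro y hy
      simpa using (hY' y hy).1
    · rw [SimpleGraph.card_neighborFinset_eq_degree]; omega
  have hb : ∀ x, G.Adj a x → G.Adj x b := by
    intro x hx
    have : x ∈ Y := by rw [hYN]; simpa using hx
    exact (hY' x this).2.symm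
  have hab : ¬ G.Adj a b := by
    intro h
    have := hall b h
    have := four_deg hH hm hp v b hvb (hall v hav)
    omega
  have hnb : ∀ x, G.Adj a x → ∀ y, G.Adj x y → y = a ∨ y = b := by
    intro x hx
    obtain ⟨b', hb', hxb', hN'⟩ := other_nb (hall x hx) hx.symm
    intro y hy
    rcases hN' b (hb x hx) with h | h
    · exact absurd h hba
    · rw [h]; exact hN' y hy
  have hind : ∀ x y, G.Adj a x → G.Adj x y → ¬ G.Adj a y := by
    intro x y hx hxy
    rcases hnb x hx y hxy with rfl | rfl
    · exact SimpleGraph.irrefl G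
    · exact hab
  obtain ⟨o1, -, hext⟩ := cyc_tool hH hm (fun x => G.Adj a x) ⟨v, a, hav, hav.symm⟩
  obtain ⟨f, hf, hadj, ⟨i, hi⟩, h1, -⟩ := hext (fun x y => G.Adj a x) (by
    intro x y hxy hX
    have := hind x y
    have := hind y x
    have := hxy.symm
    tauto)
  have a0 := hadj i
  have a1 := hadj (i + 1)
  have a2 := hadj (i + 1 + 1)
  have a3 := hadj (i + 1 + 1 + 1)
  have h44 : ∀ i : Fin 4, i + 1 + 1 + 1 + 1 = i := by decide
  rw [h44] at a3
  have m1 := hnb _ hi _ a0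
  have m3 := hnb _ hi _ a3.symm
  have s1 := skip_ne hH hf (i + 1)
  have hx : G.Adj a (f (i + 1 + 1)) := by
    rcases m1 with m1 | m1
    · rw [← m1]; exact a1
    · rcases m3 with m3 | m3
      · rw [← m3]; exact a2.symm
      · exact absurd (m1.trans m3.symm) s1
  have e0 := (h1 i (Or.inl hi)).2 hi
  have e2 := (h1 (i + 1 + 1) (Or.inl hx)).2 hx
  exact (hp i).1 e0 e2
end ORam

namespace ORam
open Finset
open scoped Classical

theorem supp_ends {n : ℕ} {G : SimpleGraph (Fin n)} : ∀ e ∈ eF G, ∀ x ∈ e, x ∈ supp G := by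
  intro e
  induction e with | _ x y => ?_
  intro he z hz
  have hadj : G.Adj x y := by rw [mem_eF] at he; exact he
  rw [mem_supp']
  rcases Sym2.mem_iff.1 hz with rfl | rfl
  · exact ⟨_, hadj⟩
  · exact ⟨_, hadj.symm⟩

variable {t n : ℕ} [NeZero t] {H : Fin t → Fin t → Prop} {G : SimpleGraph (Fin n)}

theorem dtwo_zero (v : Fin n) (h : ∀ w, G.Adj v w → G.degree w ≠ 2) : dtwo G v = 0 := by
  rw [dtwo, card_eq_zero, filter_eq_empty_iff]
  intro w _ hw
  exact h w hw.1 hw.2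

theorem dtwo_full (v : Fin n) (h : G.degree v ≤ dtwo G v) : ∀ w, G.Adj v w → G.degree w = 2 := by
  have : (univ.filter (fun w => G.Adj v w ∧ G.degree w = 2)) = G.neighborFinset v := by
    apply eq_of_subset_of_card_le
    · intro w hw
      have := (mem_filter.1 hw).2.1
      simpa using this
    · rw [SimpleGraph.card_neighborFinset_eq_degree]; exact h
  intro w hw
  have hw' : w ∈ G.neighborFinset v := by simpa using hw
  rw [← this] at hw'
  exact (mem_filter.1 hw').2.2

theorem dlC (ht : 4 ≤ t) (hH : CycO H) (hl : 1 ≤ (arcs H).card) (hm : MinArr G H) :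
    ∃ W : Finset (Sym2 (Fin n)), ∃ V : Finset (Fin n), W ⊆ eF G ∧ W.Nonempty ∧ (∀ e ∈ W, ∀ x ∈ e, x ∈ V) ∧
      (t - 1) * V.card ≤ (t - 2) * W.card := by
  by_contra hcon
  have hden : ∀ (W : Finset (Sym2 (Fin n))) (V : Finset (Fin n)), W ⊆ eF G → W.Nonempty →
      (∀ e ∈ W, ∀ x ∈ e, x ∈ V) → (t - 2) * W.card < (t - 1) * V.card := by
    intro W V h1 h2 h3
    by_contra h4
    exact hcon ⟨W, V, h1, h2, h3, by omega⟩
  have h23 : ∀ (W : Finset (Sym2 (Fin n))) (V : Finset (Fin n)), W ⊆ eF G → W.Nonempty →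
      (∀ e ∈ W, ∀ x ∈ e, x ∈ V) → 2 * W.card < 3 * V.card := by
    intro W V h1 h2 h3
    have h4 := hden W V h1 h2 h3
    obtain ⟨m, rfl⟩ : ∃ m, t = m + 4 := ⟨t - 4, by omega⟩
    rw [show m + 4 - 2 = m + 2 by omega, show m + 4 - 1 = m + 3 by omega] at h4
    by_contra h5
    push Not at h5
    nlinarith
  obtain ⟨c, hc⟩ := three_col h23
  have hr : NoRun H := col_run hH hm.1 c hc
  have hsum := col_sum hH hm.1 c hc
  have hE := hden (eF G) (supp G) subset_rfl (minarr_edge hl hm) supp_ends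
  have hE2 := h23 (eF G) (supp G) subset_rfl (minarr_edge hl hm) supp_ends
  have hmin : ∀ v ∈ supp G, 2 ≤ G.degree v := by
    intro v hv
    obtain ⟨w, hw⟩ := (mem_supp' G v).1 hv
    exact cyc_mindeg hH hm v w hw
  have hnadj : ∀ v, G.degree v = 2 → dtwo G v = 0 := by
    intro v hv
    exact dtwo_zero v fun w hw hw2 => no_adj2 hH hm hr v w hw hv hw2
  obtain ⟨v0, hv0⟩ : ∃ v, G.degree v = 2 := by
    by_contra hno
    push Not at hno
    have := disch G 1 3 (by
      intro v hv
      have h1 := hmin v hv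
      have h2 := hno v
      rw [dtwo_zero v (fun w _ => hno w), if_neg h2]
      omega)
    omega
  have hnalt := not_alt hH hm v0 hv0
  rcases Nat.lt_or_ge t 7 with ht7 | ht7
  · rcases (by omega : t = 4 ∨ t = 5 ∨ t = 6) with rfl | rfl | rfl
    · have hp := four H hr hnalt
      have := disch G 2 6 (by
        intro v hv
        have h1 := hmin v hv
        have h2 := dtwo_le (G := G) v
        split_ifs with h3
        · rw [hnadj v h3]; omega
        · by_cases h5 : 5 ≤ G.degree v
          · by_cases h6 : 6 ≤ G.degree v
            · omega
            · have h7 : dtwo G v ≠ 5 := by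
                intro h8
                exact four_star hH hm hp v (by omega) (dtwo_full v (by omega))
              omega
          · rw [dtwo_zero v (fun w hw hw2 => h5 (four_deg hH hm hp w v hw.symm hw2))]
            omega)
      omega
    · exact five H hr hsum
    · have := disch G 4 10 (by
        intro v hv
        have h1 := hmin v hv
        have h2 := dtwo_le (G := G) v
        split_ifs with h3
        · rw [hnadj v h3]; omega
        · by_cases h4 : 4 ≤ G.degree v
          · omega
          · have h7 : dtwo G v ≠ 3 := by
              intro h8
              have hfull := dtwo_full (G := G) v (by omega)
              obtain ⟨w, hw⟩ := (mem_supp' G v).1 hv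
              have hall : ∀ x, G.Adj v x → G.degree x = 2 ∧ ∀ y, G.Adj x y → G.degree y ≠ 2 := by
                intro x hx
                exact ⟨hfull x hx, fun y hy hy2 => no_adj2 hH hm hr x y hy (hfull x hx) hy2⟩
              rcases six H hr with h | h | h
              · exact hnalt h
              · refine star3 hH hm v w hw hall True fun i hi => h i ?_
                simpa using hi
              · refine star3 hH hm v w hw hall False fun i hi => h i ?_
                simpa using hi
            omega)
      omega
  · have := disch G 5 12 (by
      intro v hv
      have h1 := hmin v hv
      have h2 := dtwo_le (G := G) v
      split_ifs with h3
      · rw [hnadj v h3]; omega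
      · omega)
    obtain ⟨m, rfl⟩ : ∃ m, t = m + 7 := ⟨t - 7, by omega⟩
    rw [show m + 7 - 2 = m + 5 by omega, show m + 7 - 1 = m + 6 by omega] at hE
    nlinarith
end ORam

namespace ORam
open Finset
open scoped Classical

theorem mem_arcs {t : ℕ} {H : Fin t → Fin t → Prop} (x : Fin t × Fin t) : x ∈ arcs H ↔ H x.1 x.2 := by
  simp [arcs]

/-- complete graphs: edge bound -/
theorem K_bound {t : ℕ} {H : Fin t → Fin t → Prop} (hor : ∀ a b, H a b → ¬ H b a)
    (J : Finset (Fin t × Fin t)) (hJ : J ⊆ arcs H) (A : Finset (Fin t)) (hA : ∀ a ∈ J, a.1 ∈ A ∧ a.2 ∈ A) :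
    2 * J.card + A.card ≤ A.card * A.card := by
  have hsub : J ∪ J.image Prod.swap ⊆ A.offDiag := by
    intro x hx
    rw [mem_offDiag]
    rcases mem_union.1 hx with hx | hx
    · have := (mem_arcs x).1 (hJ hx)
      exact ⟨(hA x hx).1, (hA x hx).2, fun h => by rw [h] at this; exact hor _ _ this this⟩
    · obtain ⟨y, hy, rfl⟩ := mem_image.1 hx
      have := (mem_arcs y).1 (hJ hy)
      exact ⟨(hA y hy).2, (hA y hy).1, fun h => by
        simp only [Prod.fst_swap, Prod.snd_swap] at h
        rw [h] at this; exact hor _ _ this this⟩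
  have hdis : Disjoint J (J.image Prod.swap) := by
    rw [Finset.disjoint_left]
    intro x hx hx'
    obtain ⟨y, hy, rfl⟩ := mem_image.1 hx'
    exact hor _ _ ((mem_arcs _).1 (hJ hy)) ((mem_arcs _).1 (hJ hx))
  have h1 := card_le_card hsub
  rw [card_union_of_disjoint hdis, card_image_of_injective _ Prod.swap_injective, offDiag_card] at h1
  have : A.card ≤ A.card * A.card := Nat.le_mul_self _
  omega

theorem K_card {t : ℕ} {H : Fin t → Fin t → Prop} (hor : IsOrientation (⊤ : SimpleGraph (Fin t)) H) :
    2 * (arcs H).card + t = t * t := by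
  have hor' : ∀ a b, H a b → ¬ H b a := fun a b h => (hor.2 a b (hor.1 a b h)).1 h
  have hsub : arcs H ∪ (arcs H).image Prod.swap = (univ : Finset (Fin t)).offDiag := by
    ext x
    simp only [mem_union, mem_image, mem_arcs, mem_offDiag, mem_univ, true_and]
    constructor
    · rintro (h | ⟨y, h, rfl⟩)
      · exact (hor.1 _ _ h).ne
      · exact (hor.1 _ _ h).ne.symm
    · intro h
      have := hor.2 x.1 x.2 (by simpa using h)
      by_cases h1 : H x.1 x.2
      · exact Or.inl h1
      · exact Or.inr ⟨x.swap, by simp only [Prod.fst_swap, Prod.snd_swap]; tauto, by simp⟩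
  have hdis : Disjoint (arcs H) ((arcs H).image Prod.swap) := by
    rw [Finset.disjoint_left]
    intro x hx hx'
    obtain ⟨y, hy, rfl⟩ := mem_image.1 hx'
    exact hor' _ _ ((mem_arcs _).1 hy) ((mem_arcs _).1 hx)
  have h1 := congrArg card hsub
  rw [card_union_of_disjoint hdis, card_image_of_injective _ Prod.swap_injective, offDiag_card] at h1
  simp only [card_univ, Fintype.card_fin] at h1
  have : t ≤ t * t := Nat.le_mul_self _
  omega

/-- cycles -/
noncomputable def psi {t : ℕ} [NeZero t] (H : Fin t → Fin t → Prop) (i : Fin t) : Fin t × Fin t :=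
  if H i (i + 1) then (i, i + 1) else (i + 1, i)

theorem psi_inj {t : ℕ} [NeZero t] {H : Fin t → Fin t → Prop} (hH : CycO H) : Function.Injective (psi H) := by
  have hne : ∀ i : Fin t, i + 1 + 1 ≠ i := by
    intro i h
    rw [add_assoc] at h
    exact hH.n2 (by simpa using h)
  intro i j h
  simp only [psi] at h
  split_ifs at h <;> simp only [Prod.mk.injEq] at h
  · exact h.1
  · exact absurd h.2 (by rw [h.1]; exact hne j)
  · exact absurd h.1 (by rw [h.2]; exact hne j)
  · exact h.2

theorem psi_mem {t : ℕ} [NeZero t] {H : Fin t → Fin t → Prop} (hH : CycO H) (i : Fin t) : psi H i ∈ arcs H := by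
  rw [mem_arcs, psi]
  have := hH.alt i
  split_ifs with h
  · exact h
  · simp only; tauto

theorem arcs_psi {t : ℕ} [NeZero t] {H : Fin t → Fin t → Prop} (hH : CycO H) (x : Fin t × Fin t) (hx : x ∈ arcs H) :
    ∃ i, psi H i = x := by
  obtain ⟨a, b⟩ := x
  rw [mem_arcs] at hx
  simp only at hx
  rcases hH.arc a b hx with rfl | rfl
  · exact ⟨a, by rw [psi, if_pos hx]⟩
  · refine ⟨b, ?_⟩
    rw [psi, if_neg]
    have := hH.alt b
    tauto

theorem C_card {t : ℕ} [NeZero t] {H : Fin t → Fin t → Prop} (hH : CycO H) : (arcs H).card = t := by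
  have : arcs H = univ.image (psi H) := by
    ext x
    constructor
    · intro h
      obtain ⟨i, hi⟩ := arcs_psi hH x h
      exact mem_image.2 ⟨i, mem_univ _, hi⟩
    · intro h
      obtain ⟨i, -, rfl⟩ := mem_image.1 h
      exact psi_mem hH i
  rw [this, card_image_of_injective _ (psi_inj hH)]
  simp

theorem nsmul_one_val {t : ℕ} [NeZero t] (k : ℕ) : ((k • (1 : Fin t) : Fin t) : ℕ) = k % t := by
  induction k with
  | zero => simp
  | succ k ih => rw [succ_nsmul, Fin.val_add, ih, Fin.val_one', ← Nat.add_mod]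

theorem fin_all {t : ℕ} [NeZero t] (I : Finset (Fin t)) (hne : I.Nonempty) (h : ∀ i ∈ I, i + 1 ∈ I) : I = univ := by
  obtain ⟨i, hi⟩ := hne
  have h1 : ∀ k : ℕ, i + k • (1 : Fin t) ∈ I := by
    intro k
    induction k with
    | zero => simpa using hi
    | succ k ih => rw [succ_nsmul, ← add_assoc]; exact h _ ih
  rw [eq_univ_iff_forall]
  intro j
  have h2 := h1 ((j - i : Fin t) : ℕ)
  have : (((j - i : Fin t) : ℕ) • (1 : Fin t)) = j - i := by
    rw [Fin.ext_iff, nsmul_one_val]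
    exact Nat.mod_eq_of_lt (j - i).isLt
  rw [this] at h2
  simpa using h2

theorem C_bound {t : ℕ} [NeZero t] {H : Fin t → Fin t → Prop} (hH : CycO H)
    (J : Finset (Fin t × Fin t)) (hJ : J ⊆ arcs H) (hne : J.Nonempty) (A : Finset (Fin t))
    (hA : ∀ a ∈ J, a.1 ∈ A ∧ a.2 ∈ A) :
    (J = arcs H ∧ A.card = t) ∨ J.card + 1 ≤ A.card := by
  let I := univ.filter (fun i => psi H i ∈ J)
  have hI : I.image (psi H) = J := by
    ext x
    constructor
    · intro h
      obtain ⟨i, hi, rfl⟩ := mem_image.1 h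
      exact (mem_filter.1 hi).2
    · intro h
      obtain ⟨i, rfl⟩ := arcs_psi hH x (hJ h)
      exact mem_image.2 ⟨i, mem_filter.2 ⟨mem_univ _, h⟩, rfl⟩
  have hc : I.card = J.card := by rw [← hI, card_image_of_injective _ (psi_inj hH)]
  have hIA : ∀ i ∈ I, i ∈ A ∧ i + 1 ∈ A := by
    intro i hi
    have := hA _ (mem_filter.1 hi).2
    rw [psi] at this
    split_ifs at this
    · exact this
    · exact this.symm
  have hle : I.card ≤ A.card := card_le_card fun i hi => (hIA i hi).1
  by_cases heq : I.card = A.card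
  · left
    have hIA' : I = A := eq_of_subset_of_card_le (fun i hi => (hIA i hi).1) heq.ge
    have hu : I = univ := by
      refine fin_all I ?_ fun i hi => hIA' ▸ (hIA i hi).2
      rw [← card_pos, hc]; exact hne.card_pos
    have hct : I.card = t := by rw [hu]; simp
    refine ⟨eq_of_subset_of_card_le hJ ?_, by omega⟩
    rw [C_card hH]; omega
  · right; omega

/-- the maximum 2-density -/
theorem m2_eq {t : ℕ} {H : Fin t → Fin t → Prop} (hor : ∀ a b, H a b → ¬ H b a) {P Q : ℕ} (hQ : 0 < Q) (hQP : Q ≤ P)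
    (ht : 3 ≤ t) (hB1 : P * t + Q = Q * (arcs H).card + 2 * P)
    (hW : ∀ J ⊆ arcs H, ∀ A : Finset (Fin t), (∀ a ∈ J, a.1 ∈ A ∧ a.2 ∈ A) → J.Nonempty →
      Q * J.card + 2 * P ≤ P * A.card + Q) : m2Rel H = (P : ℝ) / Q := by
  have hQr : (0 : ℝ) < Q := by exact_mod_cast hQ
  have hPr : (0 : ℝ) ≤ P := by positivity
  have hecard : ∀ J : (SimpleGraph.fromRel H).Subgraph,
      J.edgeSet.ncard = ((arcs H).filter (fun a => J.Adj a.1 a.2)).card := by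
    intro J
    have : J.edgeSet = (((arcs H).filter (fun a => J.Adj a.1 a.2)).image (fun a => s(a.1, a.2)) : Set (Sym2 (Fin t))) := by
      ext e
      induction e with | _ x y => ?_
      rw [SimpleGraph.Subgraph.mem_edgeSet]
      simp only [coe_image, Set.mem_image, mem_coe, mem_filter, mem_arcs]
      constructor
      · intro h
        have h1 := J.adj_sub h
        rw [SimpleGraph.fromRel_adj] at h1
        rcases h1.2 with h2 | h2
        · exact ⟨(x, y), ⟨h2, h⟩, rfl⟩
        · exact ⟨(y, x), ⟨h2, h.symm⟩, Sym2.eq_swap⟩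
      · rintro ⟨⟨a, b⟩, ⟨h1, h2⟩, h3⟩
        simp only at h1 h2 h3
        rw [Sym2.eq_iff] at h3
        rcases h3 with ⟨rfl, rfl⟩ | ⟨rfl, rfl⟩
        · exact h2
        · exact h2.symm
    rw [this, Set.ncard_coe_finset, card_image_of_injOn]
    rintro ⟨a, b⟩ h1 ⟨c, d⟩ h2 h3
    have h1' := (mem_arcs _).1 (mem_filter.1 h1).1
    have h2' := (mem_arcs _).1 (mem_filter.1 h2).1
    simp only at h1' h2' h3
    rw [Sym2.eq_iff] at h3
    rcases h3 with ⟨rfl, rfl⟩ | ⟨rfl, rfl⟩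
    · rfl
    · exact absurd h2' (hor _ _ h1')
  unfold m2Rel m2
  apply IsGreatest.csSup_eq
  constructor
  · refine ⟨⊤, ?_⟩
    rw [hecard]
    have h1 : (⊤ : (SimpleGraph.fromRel H).Subgraph).verts.ncard = t := by
      rw [SimpleGraph.Subgraph.verts_top, Set.ncard_univ]; simp
    have h2 : ((arcs H).filter (fun a => (⊤ : (SimpleGraph.fromRel H).Subgraph).Adj a.1 a.2)) = arcs H := by
      rw [filter_eq_self]
      intro a ha
      have := (mem_arcs _).1 ha
      rw [SimpleGraph.Subgraph.top_adj, SimpleGraph.fromRel_adj]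
      exact ⟨fun h => by rw [h] at this; exact hor _ _ this this, Or.inl this⟩
    rw [h1, h2, d2, if_pos ht]
    have hB1r : (P : ℝ) * t + Q = Q * (arcs H).card + 2 * P := by exact_mod_cast hB1
    have ht' : (0 : ℝ) < t - 2 := by
      have : (3 : ℝ) ≤ t := by exact_mod_cast ht
      linarith
    rw [div_eq_div_iff hQr.ne' ht'.ne']
    linarith
  · rintro x ⟨J, rfl⟩
    rw [hecard]
    have h1 : (1 : ℝ) ≤ (P : ℝ) / Q := by
      rw [le_div_iff₀ hQr]; simpa using (by exact_mod_cast hQP : (Q : ℝ) ≤ P)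
    rw [d2]
    split_ifs with h3 h4
    · have hv : (0 : ℝ) < (J.verts.ncard : ℝ) - 2 := by
        have : (3 : ℝ) ≤ J.verts.ncard := by exact_mod_cast h3
        linarith
      rw [div_le_div_iff₀ hv hQr]
      rcases ((arcs H).filter (fun a => J.Adj a.1 a.2)).eq_empty_or_nonempty with h0 | h0
      · rw [h0]
        simp only [card_empty, Nat.cast_zero]
        nlinarith
      · have := hW _ (filter_subset _ _) (J.verts.toFinset) (by
          intro a ha
          have := (mem_filter.1 ha).2
          simp only [Set.mem_toFinset]
          exact ⟨J.edge_vert this, J.edge_vert this.symm⟩) h0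
        rw [← Set.ncard_eq_toFinset_card'] at this
        have hr : (Q : ℝ) * ((arcs H).filter (fun a => J.Adj a.1 a.2)).card + 2 * P ≤ P * J.verts.ncard + Q := by
          exact_mod_cast this
        linarith
    · linarith
    · linarith
end ORam

namespace ORam
open Finset Filter
open scoped Classical

theorem K_W {t : ℕ} (ht : 4 ≤ t) {H : Fin t → Fin t → Prop} (hor : ∀ a b, H a b → ¬ H b a) :
    ∀ J ⊆ arcs H, ∀ A : Finset (Fin t), (∀ a ∈ J, a.1 ∈ A ∧ a.2 ∈ A) → J.Nonempty →
      2 * J.card + 2 * (t + 1) ≤ (t + 1) * A.card + 2 := by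
  intro J hJ A hA hne
  have h1 := K_bound hor J hJ A hA
  have h2 : A.card ≤ t := by simpa using card_le_univ A
  have h3 : 2 ≤ A.card := by
    have := hne.card_pos
    by_contra h
    push Not at h
    interval_cases hh : A.card <;> omega
  obtain ⟨x, hx⟩ := Nat.exists_eq_add_of_le h2
  obtain ⟨y, hy⟩ := Nat.exists_eq_add_of_le h3
  rw [hy] at h1 hx ⊢
  subst hx
  nlinarith

theorem K_S {t : ℕ} (ht : 4 ≤ t) {H : Fin t → Fin t → Prop} (hor : IsOrientation (⊤ : SimpleGraph (Fin t)) H) :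
    ∀ J ⊆ arcs H, ∀ A : Finset (Fin t), (∀ a ∈ J, a.1 ∈ A ∧ a.2 ∈ A) → J ≠ arcs H → 3 ≤ A.card →
      2 * J.card + 2 * (t + 1) < (t + 1) * A.card + 2 := by
  intro J hJ A hA hne h3
  have h1 := K_bound (fun a b h => (hor.2 a b (hor.1 a b h)).1 h) J hJ A hA
  have h2 : A.card ≤ t := by simpa using card_le_univ A
  have h4 : J.card < (arcs H).card := card_lt_card (hJ.ssubset_of_ne hne)
  have h5 := K_card hor
  rcases h2.lt_or_eq with h2 | h2
  · obtain ⟨x, hx⟩ := Nat.exists_eq_add_of_lt h2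
    obtain ⟨y, hy⟩ := Nat.exists_eq_add_of_le h3
    rw [hy] at h1 hx ⊢
    subst hx
    nlinarith
  · rw [h2]
    nlinarith

theorem C_W {t : ℕ} [NeZero t] (ht : 4 ≤ t) {H : Fin t → Fin t → Prop} (hH : CycO H) :
    ∀ J ⊆ arcs H, ∀ A : Finset (Fin t), (∀ a ∈ J, a.1 ∈ A ∧ a.2 ∈ A) → J.Nonempty →
      (t - 2) * J.card + 2 * (t - 1) ≤ (t - 1) * A.card + (t - 2) := by
  intro J hJ A hA hne
  have h0 := hne.card_pos
  have hc := C_card hH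
  have h1 := C_bound hH J hJ hne A hA
  obtain ⟨m, hm⟩ : ∃ m, t = m + 4 := ⟨t - 4, by omega⟩
  rw [show t - 2 = m + 2 by omega, show t - 1 = m + 3 by omega]
  rcases h1 with ⟨rfl, h1⟩ | h1
  · rw [hc, h1, hm]; nlinarith
  · nlinarith

theorem C_S {t : ℕ} [NeZero t] (ht : 4 ≤ t) {H : Fin t → Fin t → Prop} (hH : CycO H) :
    ∀ J ⊆ arcs H, ∀ A : Finset (Fin t), (∀ a ∈ J, a.1 ∈ A ∧ a.2 ∈ A) → J ≠ arcs H → 3 ≤ A.card →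
      (t - 2) * J.card + 2 * (t - 1) < (t - 1) * A.card + (t - 2) := by
  intro J hJ A hA hne h3
  have hc := C_card hH
  obtain ⟨m, hm⟩ : ∃ m, t = m + 4 := ⟨t - 4, by omega⟩
  rw [show t - 2 = m + 2 by omega, show t - 1 = m + 3 by omega]
  rcases J.eq_empty_or_nonempty with rfl | h0
  · simp only [card_empty]; nlinarith
  · rcases C_bound hH J hJ h0 A hA with ⟨h1, -⟩ | h1
    · exact absurd h1 hne
    · nlinarith

theorem K_NC {t : ℕ} (ht : 4 ≤ t) {H : Fin t → Fin t → Prop} (hor : IsOrientation (⊤ : SimpleGraph (Fin t)) H) :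
    ∀ a0 b0, H a0 b0 → ∃ c : Fin t → Fin t → Prop, (∀ a b, H a b ∨ H b a → (c a b ↔ ¬ c b a)) ∧
      (∀ a b, c a b → H a b ∨ H b a) ∧ c a0 b0 ∧ ∃ x, Relation.TransGen c x x := by
  intro a0 b0 h0
  have hne := (hor.1 _ _ h0).ne
  have hadj : ∀ a b, (H a b ∨ H b a) ↔ a ≠ b := by
    intro a b
    constructor
    · rintro (h | h)
      · exact (hor.1 _ _ h).ne
      · exact (hor.1 _ _ h).ne.symm
    · intro h
      have := hor.2 a b (by simpa using h)
      tauto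
  obtain ⟨x, -, hx⟩ : ∃ x ∈ (univ : Finset (Fin t)), x ∉ ({a0, b0} : Finset (Fin t)) := by
    apply exists_mem_notMem_of_card_lt_card
    have := card_le_two (a := a0) (b := b0)
    rw [card_univ, Fintype.card_fin]
    omega
  simp only [mem_insert, mem_singleton, not_or] at hx
  obtain ⟨hx1, hx2⟩ := hx
  simp only [hadj]
  refine ⟨fun a b => a ≠ b ∧ ((a = a0 ∧ b = b0) ∨ (a = b0 ∧ b = x) ∨ (a = x ∧ b = a0) ∨
    (¬ (b = a0 ∧ a = b0) ∧ ¬ (b = b0 ∧ a = x) ∧ ¬ (b = x ∧ a = a0) ∧ a < b)), ?_, fun a b h => h.1,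
    ⟨hne, Or.inl ⟨rfl, rfl⟩⟩, a0, ?_⟩
  · intro a b hab
    have h1 : a < b ∨ b < a := lt_or_gt_of_ne hab
    have h2 : ¬ (a < b ∧ b < a) := fun h => lt_asymm h.1 h.2
    grind
  · refine Relation.TransGen.head ⟨hne, Or.inl ⟨rfl, rfl⟩⟩ ?_
    refine Relation.TransGen.head (b := x) ⟨Ne.symm hx2, Or.inr (Or.inl ⟨rfl, rfl⟩)⟩ ?_
    exact Relation.TransGen.single ⟨hx1, Or.inr (Or.inr (Or.inl ⟨rfl, rfl⟩))⟩

theorem fwd_cycle {t : ℕ} [NeZero t] : Relation.TransGen (fun a b : Fin t => b = a + 1) 0 0 := by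
  have h : ∀ k : ℕ, Relation.TransGen (fun a b : Fin t => b = a + 1) 0 ((k + 1) • (1 : Fin t)) := by
    intro k
    induction k with
    | zero => exact Relation.TransGen.single (by simp)
    | succ k ih => exact Relation.TransGen.tail ih (by rw [succ_nsmul])
  have h1 := h (t - 1)
  have ht : 0 < t := Nat.pos_of_ne_zero (NeZero.ne t)
  have h2 : ((t - 1 + 1) • (1 : Fin t)) = 0 := by
    rw [Fin.ext_iff, nsmul_one_val]
    rw [Nat.sub_add_cancel ht]; simp
  rwa [h2] at h1

theorem C_NC {t : ℕ} [NeZero t] {H : Fin t → Fin t → Prop} (hH : CycO H) :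
    ∀ a0 b0, H a0 b0 → ∃ c : Fin t → Fin t → Prop, (∀ a b, H a b ∨ H b a → (c a b ↔ ¬ c b a)) ∧
      (∀ a b, c a b → H a b ∨ H b a) ∧ c a0 b0 ∧ ∃ x, Relation.TransGen c x x := by
  have hne : ∀ i : Fin t, i + 1 + 1 ≠ i := by
    intro i h
    rw [add_assoc] at h
    exact hH.n2 (by simpa using h)
  have hadj : ∀ a b, (H a b ∨ H b a) ↔ (b = a + 1 ∨ a = b + 1) := by
    intro a b
    constructor
    · rintro (h | h)
      · exact hH.arc _ _ h
      · exact (hH.arc _ _ h).symm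
    · rintro (rfl | rfl)
      · have := hH.alt a; tauto
      · have := hH.alt b; tauto
  have hx : ∀ a b : Fin t, (b = a + 1 ∨ a = b + 1) → (b = a + 1 ↔ ¬ a = b + 1) := by
    intro a b h
    have : ¬ (b = a + 1 ∧ a = b + 1) := by
      rintro ⟨rfl, h⟩
      exact hne a h.symm
    tauto
  intro a0 b0 h0
  simp only [hadj]
  rcases hH.arc a0 b0 h0 with h | h
  · exact ⟨fun a b => b = a + 1, hx, fun a b h => Or.inl h, h, 0, fwd_cycle⟩
  · refine ⟨fun a b => a = b + 1, fun a b h => hx b a h.symm, fun a b h => Or.inr h, h, 0, ?_⟩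
    exact Relation.transGen_swap.1 fwd_cycle

theorem final4 {t : ℕ} (ht : 4 ≤ t) {H : Fin t → Fin t → Prop} (hac : RelAcyclic H) (hor : ∀ a b, H a b → ¬ H b a)
    (hcov : ∀ a, ∃ b, H a b ∨ H b a) {P Q : ℕ}
    (hQ : 0 < Q) (hPQ : Q < P) (h2 : 2 ≤ (arcs H).card) (hB1 : P * t + Q = Q * (arcs H).card + 2 * P)
    (hS : ∀ J ⊆ arcs H, ∀ A : Finset (Fin t), (∀ a ∈ J, a.1 ∈ A ∧ a.2 ∈ A) → J ≠ arcs H → 3 ≤ A.card →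
      Q * J.card + 2 * P < P * A.card + Q)
    (hW : ∀ J ⊆ arcs H, ∀ A : Finset (Fin t), (∀ a ∈ J, a.1 ∈ A ∧ a.2 ∈ A) → J.Nonempty →
      Q * J.card + 2 * P ≤ P * A.card + Q)
    (hNC : ∀ a0 b0, H a0 b0 → ∃ c : Fin t → Fin t → Prop, (∀ a b, H a b ∨ H b a → (c a b ↔ ¬ c b a)) ∧
      (∀ a b, c a b → H a b ∨ H b a) ∧ c a0 b0 ∧ ∃ x, Relation.TransGen c x x)
    (hDL : ∀ (n : ℕ) (G : SimpleGraph (Fin n)), MinArr G H → ∃ (W : Finset (Sym2 (Fin n))) (V : Finset (Fin n)),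
      W ⊆ eF G ∧ W.Nonempty ∧ (∀ e ∈ W, ∀ x ∈ e, x ∈ V) ∧ P * V.card ≤ Q * W.card)
    (p : ℕ → ℝ) (hp : ∀ n, 0 ≤ p n ∧ p n ≤ 1) :
      (Tendsto (fun n => p n * (n : ℝ) ^ (1 / m2Rel H)) atTop (nhds 0) →
        Tendsto (fun n => probGnp n (p n) (fun G => Arrows G H)) atTop (nhds 0)) ∧
      (Tendsto (fun n => p n * (n : ℝ) ^ (1 / m2Rel H)) atTop atTop →
        Tendsto (fun n => probGnp n (p n) (fun G => Arrows G H)) atTop (nhds 1)) := by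
  rw [m2_eq hor hQ hPQ.le (by omega) hB1 hW, one_div_div]
  exact ⟨zero_abs hac hor hcov hQ hPQ h2 hB1 hS hW hNC hDL p hp,
    one_stmt H hac P Q hQ hPQ.le (by omega) (by omega) hW p hp⟩
end ORam

open Filter in
/-- Thresholds for acyclic orientations of complete graphs and cycles:
`n^{-2/3}` for `t = 3` and `n^{-1/m₂(H_t)}` for `t ≥ 4`. -/
theorem stmt1 (t : ℕ) (ht : 3 ≤ t) (H : Fin t → Fin t → Prop)
    (hor : ∀ a b, H a b → ¬ H b a) (hacyclic : RelAcyclic H)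
    (horient : IsOrientation (⊤ : SimpleGraph (Fin t)) H ∨
      IsOrientation (SimpleGraph.cycleGraph t) H)
    (p : ℕ → ℝ) (hp : ∀ n, 0 ≤ p n ∧ p n ≤ 1) :
    (t = 3 →
      (Tendsto (fun n => p n * (n : ℝ) ^ ((2 : ℝ) / 3)) atTop (nhds 0) →
        Tendsto (fun n => probGnp n (p n) (fun G => Arrows G H)) atTop (nhds 0)) ∧
      (Tendsto (fun n => p n * (n : ℝ) ^ ((2 : ℝ) / 3)) atTop atTop →
        Tendsto (fun n => probGnp n (p n) (fun G => Arrows G H)) atTop (nhds 1))) ∧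
    (4 ≤ t →
      (Tendsto (fun n => p n * (n : ℝ) ^ (1 / m2Rel H)) atTop (nhds 0) →
        Tendsto (fun n => probGnp n (p n) (fun G => Arrows G H)) atTop (nhds 0)) ∧
      (Tendsto (fun n => p n * (n : ℝ) ^ (1 / m2Rel H)) atTop atTop →
        Tendsto (fun n => probGnp n (p n) (fun G => Arrows G H)) atTop (nhds 1))) := by
  constructor
  · rintro rfl
    have h : IsOrientation (⊤ : SimpleGraph (Fin 3)) H := by
      rcases horient with h | h
      · exact h
      · rwa [SimpleGraph.cycleGraph_three_eq_top] at h
    exact ⟨ORam.zero3 hacyclic h p hp, ORam.one3 hacyclic h p hp⟩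
  · intro ht4
    haveI : NeZero t := ⟨by omega⟩
    rcases horient with h | h
    · have hc := ORam.K_card h
      have hc2 : 2 ≤ (ORam.arcs H).card := by nlinarith
      refine ORam.final4 ht4 hacyclic hor ?_ (P := t + 1) (Q := 2) (by omega) (by omega) hc2 (by nlinarith)
        (ORam.K_S ht4 h) (ORam.K_W ht4 hor) (ORam.K_NC ht4 h)
        (fun n G hm => ORam.dlK ht4 hacyclic h (by omega) hm) p hp
      intro a
      have hne : a ≠ a + 1 := by
        intro h
        have h1 : (1 : Fin t) = 0 := by simpa using h.symm
        rw [Fin.ext_iff, ORam.fin_val_one (by omega)] at h1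
        simp at h1
      refine ⟨a + 1, ?_⟩
      have := h.2 a (a + 1) (by simpa using hne)
      tauto
    · have hH := ORam.cycO_of ht4 h
      have hc := ORam.C_card hH
      refine ORam.final4 ht4 hacyclic hor ?_ (P := t - 1) (Q := t - 2) (by omega) (by omega) (by omega) ?_
        (ORam.C_S ht4 hH) (ORam.C_W ht4 hH) (ORam.C_NC hH)
        (fun n G hm => ORam.dlC ht4 hH (by omega) hm) p hp
      · intro a
        refine ⟨a + 1, ?_⟩
        have := hH.alt a
        tauto
      · rw [hc]
        obtain ⟨m, hm⟩ : ∃ m, t = m + 4 := ⟨t - 4, by omega⟩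
        rw [show t - 2 = m + 2 by omega, show t - 1 = m + 3 by omega, hm]
        ring
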